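/- arXiv:2303.04832 — 16 statements merged into one kernel-verified Lean document; each statement's English description precedes it below -/
import Mathlib

section
/- Along any solution (X1, X2, Y1, Y2, H) : I → ℝ⁵ of the Einstein ODE in (X, Y, H)-coordinates on an interval I, the quantities S1 and S2 satisfy the ODE system (1/2)·S1' = S1·H·Q − ((1−H²)/n)·S2 and S2' = S1 + S2·H·(Q − 1), where Q = d1·X1² + d2·X2² + (1−H²)/n. In particular, if S1(s0) = 0 and S2(s0) = 0 at some s0 ∈ I, then S1(s) = 0 and S2(s) = 0 for all s ∈ I. -/
/-- Gronwall, forward version, with a continuous coefficient. -/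
theorem aux_forward (f f' k : ℝ → ℝ) (a b : ℝ) (hk : ContinuousOn k (Set.Icc a b))
    (hf : ∀ x ∈ Set.Icc a b, HasDerivAt f (f' x) x)
    (hb : ∀ x ∈ Set.Icc a b, |f' x| ≤ k x * |f x|) (ha : f a = 0) :
    ∀ x ∈ Set.Icc a b, f x = 0 := by
  obtain ⟨C, hC⟩ := isCompact_Icc.exists_bound_of_continuousOn hk
  refine eq_zero_of_abs_deriv_le_mul_abs_self_of_eq_zero_right (f' := f') (K := C)
    (fun x hx => (hf x hx).continuousAt.continuousWithinAt)
    (fun x hx => (hf x (Set.Ico_subset_Icc_self hx)).hasDerivWithinAt) ha ?_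
  intro x hx
  have hx' := Set.Ico_subset_Icc_self hx
  refine (hb x hx').trans ?_
  exact mul_le_mul_of_nonneg_right ((le_abs_self _).trans (hC x hx')) (abs_nonneg _)

/-- Gronwall on an interval, in both directions. -/
theorem aux_both (f f' k : ℝ → ℝ) (I : Set ℝ) (hI : I.OrdConnected) (hk : ContinuousOn k I)
    (hf : ∀ x ∈ I, HasDerivAt f (f' x) x)
    (hb : ∀ x ∈ I, |f' x| ≤ k x * |f x|) (a : ℝ) (haI : a ∈ I) (ha : f a = 0) :
    ∀ x ∈ I, f x = 0 := by
  intro x hx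
  rcases le_total a x with h | h
  · have hs := hI.out haI hx
    exact aux_forward f f' k a x (hk.mono hs) (fun y hy => hf y (hs hy))
      (fun y hy => hb y (hs hy)) ha x ⟨h, le_rfl⟩
  · have hs := hI.out hx haI
    have hm : ∀ y ∈ Set.Icc (-a) (-x), -y ∈ Set.Icc x a := by
      intro y hy
      exact ⟨by linarith [hy.2], by linarith [hy.1]⟩
    have := aux_forward (fun y => f (-y)) (fun y => - f' (-y)) (fun y => k (-y)) (-a) (-x)
      ((hk.mono hs).comp continuous_neg.continuousOn hm)
      (fun y hy => by
        have h1 := (hf (-y) (hs (hm y hy))).comp y (hasDerivAt_neg y)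
        simpa [Function.comp_def] using h1)
      (fun y hy => by simpa using hb (-y) (hs (hm y hy))) (by simpa using ha)
      (-x) ⟨by linarith, le_rfl⟩
    simpa using this

/-- The quadratic-form estimate behind the energy inequality. -/
theorem aux_bound (p q r u v : ℝ) :
    |p * u ^ 2 + q * (u * v) + r * v ^ 2| ≤ (|p| + |q| + |r|) * |u ^ 2 + v ^ 2| := by
  have h0 : |u ^ 2 + v ^ 2| = u ^ 2 + v ^ 2 := abs_of_nonneg (by positivity)
  have huv : |u * v| ≤ u ^ 2 + v ^ 2 := by
    rw [abs_le]
    constructor <;> nlinarith [sq_nonneg (u + v), sq_nonneg (u - v), sq_nonneg u, sq_nonneg v]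
  have h1 : |p * u ^ 2| ≤ |p| * (u ^ 2 + v ^ 2) := by
    rw [abs_mul, abs_of_nonneg (sq_nonneg u)]
    exact mul_le_mul_of_nonneg_left (by nlinarith [sq_nonneg v]) (abs_nonneg _)
  have h2 : |q * (u * v)| ≤ |q| * (u ^ 2 + v ^ 2) := by
    rw [abs_mul]
    exact mul_le_mul_of_nonneg_left huv (abs_nonneg _)
  have h3 : |r * v ^ 2| ≤ |r| * (u ^ 2 + v ^ 2) := by
    rw [abs_mul, abs_of_nonneg (sq_nonneg v)]
    exact mul_le_mul_of_nonneg_left (by nlinarith [sq_nonneg u]) (abs_nonneg _)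
  rw [h0]
  have := abs_add_le (p * u ^ 2 + q * (u * v)) (r * v ^ 2)
  have := abs_add_le (p * u ^ 2) (q * (u * v))
  linarith

/-- Along any solution of the Einstein ODE in (X,Y,H)-coordinates the
quantities `S1`, `S2` satisfy the stated ODE system, and hence vanish identically
once they vanish at a single point of the interval. -/
theorem stmt0 (d1 d2 : ℕ) (hd1 : 2 ≤ d1) (hd2 : 2 ≤ d2) (n : ℕ) (hn : n = d1 + d2)
    (I : Set ℝ) (hI : I.OrdConnected)
    (X1 X2 Y1 Y2 H Q S1 S2 : ℝ → ℝ)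
    (hQ : ∀ s, Q s = (d1 : ℝ) * (X1 s) ^ 2 + (d2 : ℝ) * (X2 s) ^ 2 + (1 - (H s) ^ 2) / n)
    (hS1 : ∀ s, S1 s = (d1 : ℝ) * (X1 s) ^ 2 + (d2 : ℝ) * (X2 s) ^ 2
      + (d1 : ℝ) * ((d1 : ℝ) - 1) * (Y1 s) ^ 2 + (d2 : ℝ) * ((d2 : ℝ) - 1) * (Y2 s) ^ 2
      - (H s) ^ 2 / n - ((n : ℝ) - 1) / n)
    (hS2 : ∀ s, S2 s = (d1 : ℝ) * X1 s + (d2 : ℝ) * X2 s - H s)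
    (hX1 : ∀ s ∈ I, HasDerivAt X1
      (X1 s * H s * (Q s - 1) + ((d1 : ℝ) - 1) * (Y1 s) ^ 2 - (1 - (H s) ^ 2) / n) s)
    (hX2 : ∀ s ∈ I, HasDerivAt X2
      (X2 s * H s * (Q s - 1) + ((d2 : ℝ) - 1) * (Y2 s) ^ 2 - (1 - (H s) ^ 2) / n) s)
    (hY1 : ∀ s ∈ I, HasDerivAt Y1 (Y1 s * (H s * Q s - X1 s)) s)
    (hY2 : ∀ s ∈ I, HasDerivAt Y2 (Y2 s * (H s * Q s - X2 s)) s)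
    (hH : ∀ s ∈ I, HasDerivAt H (((H s) ^ 2 - 1) * Q s) s) :
    (∀ s ∈ I,
      HasDerivAt S1 (2 * (S1 s * H s * Q s - ((1 - (H s) ^ 2) / n) * S2 s)) s ∧
      HasDerivAt S2 (S1 s + S2 s * H s * (Q s - 1)) s) ∧
    (∀ s0 ∈ I, S1 s0 = 0 → S2 s0 = 0 → ∀ s ∈ I, S1 s = 0 ∧ S2 s = 0) := by
  have hn0 : (n : ℝ) ≠ 0 := by
    have : n ≠ 0 := by omega
    exact_mod_cast this
  have hnc : (n : ℝ) = d1 + d2 := by rw [hn]; push_cast; ring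
  have key : ∀ s ∈ I,
      HasDerivAt S1 (2 * (S1 s * H s * Q s - ((1 - (H s) ^ 2) / n) * S2 s)) s ∧
      HasDerivAt S2 (S1 s + S2 s * H s * (Q s - 1)) s := by
    intro s hs
    have x1 := hX1 s hs
    have x2 := hX2 s hs
    have y1 := hY1 s hs
    have y2 := hY2 s hs
    have h := hH s hs
    constructor
    · rw [funext hS1]
      have D := ((((((x1.pow 2).const_mul (d1 : ℝ)).add ((x2.pow 2).const_mul (d2 : ℝ))).add
        ((y1.pow 2).const_mul ((d1 : ℝ) * ((d1 : ℝ) - 1)))).add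
        ((y2.pow 2).const_mul ((d2 : ℝ) * ((d2 : ℝ) - 1)))).sub
        ((h.pow 2).div_const (n : ℝ))).sub_const (((n : ℝ) - 1) / n)
      refine HasDerivAt.congr_deriv D ?_
      have hd : (d2 : ℝ) = n - d1 := by linarith
      simp only [hS2, hQ, hd]
      field_simp
      ring
    · rw [funext hS2]
      have D := ((x1.const_mul (d1 : ℝ)).add (x2.const_mul (d2 : ℝ))).sub h
      refine HasDerivAt.congr_deriv D ?_
      have hd : (d2 : ℝ) = n - d1 := by linarith
      simp only [hS1, hQ, hd]
      field_simp
      ring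
  refine ⟨key, ?_⟩
  intro s0 hs0 h1 h2 s hs
  have cX1 : ContinuousOn X1 I := fun x hx => (hX1 x hx).continuousAt.continuousWithinAt
  have cX2 : ContinuousOn X2 I := fun x hx => (hX2 x hx).continuousAt.continuousWithinAt
  have cH : ContinuousOn H I := fun x hx => (hH x hx).continuousAt.continuousWithinAt
  have cQ : ContinuousOn Q I := by
    rw [funext hQ]
    fun_prop
  have E := aux_both (fun t => S1 t ^ 2 + S2 t ^ 2)
    (fun t => (4 * (H t * Q t)) * S1 t ^ 2 + (2 - 4 * ((1 - H t ^ 2) / n)) * (S1 t * S2 t)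
      + (2 * (H t * (Q t - 1))) * S2 t ^ 2)
    (fun t => |4 * (H t * Q t)| + |2 - 4 * ((1 - H t ^ 2) / n)| + |2 * (H t * (Q t - 1))|)
    I hI (by fun_prop)
    (fun t ht => by
      obtain ⟨k1, k2⟩ := key t ht
      refine HasDerivAt.congr_deriv ((k1.pow 2).add (k2.pow 2)) ?_
      ring)
    (fun t _ => aux_bound _ _ _ _ _) s0 hs0 (by simp [h1, h2]) s hs
  have E' : S1 s ^ 2 + S2 s ^ 2 = 0 := E
  constructor
  · exact pow_eq_zero_iff (two_ne_zero) |>.1 (by nlinarith [sq_nonneg (S1 s), sq_nonneg (S2 s)])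
  · exact pow_eq_zero_iff (two_ne_zero) |>.1 (by nlinarith [sq_nonneg (S1 s), sq_nonneg (S2 s)])
end

section
/- The set S is compact, and it is invariant under the Einstein ODE in (Y, Δ, H)-coordinates: every maximal solution with initial value in S remains in S and is defined for all s ∈ ℝ. The boundary part S ∩ ({Y1 = 0} ∪ {Y2 = 0} ∪ {H² = 1}) is likewise invariant. Moreover, along any solution in S the coordinate H is non-increasing, and H'(s) < 0 at every s with H(s)² ≠ 1. -/
open Set Filter Topology

theorem lin_ode (a b : ℝ) (f g : ℝ → ℝ)
    (hf : ∀ t ∈ uIcc a b, HasDerivAt f (g t * f t) t)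
    (hg : ContinuousOn g (uIcc a b)) : ∃ k : ℝ, 0 < k ∧ f b = k * f a := by
  have hle : min a b ≤ max a b := min_le_max
  set g' : ℝ → ℝ := IccExtend hle ((Icc (min a b) (max a b)).domRestrict g) with hg'
  have hgc : Continuous g' := by
    apply Continuous.Icc_extend'
    exact continuousOn_iff_continuous_domRestrict.mp hg
  have hgeq : ∀ t ∈ uIcc a b, g' t = g t := by
    intro t ht
    rw [hg', IccExtend_of_mem hle _ ht]
    rfl
  set G : ℝ → ℝ := fun t => ∫ x in a..t, g' x with hG
  have hGd : ∀ t, HasDerivAt G (g' t) t := fun t =>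
    hgc.integral_hasStrictDerivAt a t |>.hasDerivAt
  set F : ℝ → ℝ := fun t => Real.exp (-G t) * f t with hF
  have hFd : ∀ t ∈ uIcc a b, HasDerivWithinAt F 0 (uIcc a b) t := by
    intro t ht
    have h := ((hGd t).neg.exp).mul (hf t ht)
    refine HasDerivAt.hasDerivWithinAt ?_
    refine HasDerivAt.congr_deriv (f := F) h ?_
    rw [hgeq t ht]
    simp only [Pi.neg_apply]
    ring
  have hconst : F a = F b := by
    have h := (convex_uIcc a b).norm_image_sub_le_of_norm_hasDerivWithin_le (C := 0)
      hFd (fun t _ => by simp) right_mem_uIcc left_mem_uIcc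
    rw [zero_mul, norm_le_zero_iff, sub_eq_zero] at h
    exact h
  have hGa : G a = 0 := by simp [hG]
  refine ⟨Real.exp (G b), Real.exp_pos _, ?_⟩
  have : f a = Real.exp (-G b) * f b := by
    have h := hconst
    simp only [hF, hGa] at h
    simpa using h
  rw [this, ← mul_assoc, ← Real.exp_add]
  simp

theorem global_ode {E : Type*} [NormedAddCommGroup E] [NormedSpace ℝ E] [CompleteSpace E]
    (W : E → E) (K L : NNReal) (hK : LipschitzWith K W) (hL : ∀ x, ‖W x‖ ≤ L) (p : E) :
    ∃ γ : ℝ → E, γ 0 = p ∧ ∀ s, HasDerivAt γ (W (γ s)) s := by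
  have hloc : ∀ T : ℝ, 0 < T → ∃ α : ℝ → E, α 0 = p ∧
      ∀ t ∈ Ioo (-T) T, HasDerivAt α (W (α t)) t := by
    intro T hT
    have h0 : (0 : ℝ) ∈ Icc (-T) T := ⟨by linarith, hT.le⟩
    have hpl : IsPicardLindelof (fun _ => W) (⟨0, h0⟩ : Icc (-T) T) p (L * T.toNNReal) 0 L K := by
      apply IsPicardLindelof.of_time_independent
      · exact fun x _ => hL x
      · exact hK.lipschitzOnWith
      · simp [hT.le]
    obtain ⟨α, h1, h2⟩ := hpl.exists_eq_forall_mem_Icc_hasDerivWithinAt₀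
    exact ⟨α, h1, fun t ht => (h2 t (Ioo_subset_Icc_self ht)).hasDerivAt (Icc_mem_nhds ht.1 ht.2)⟩
  choose! α h0 hα using hloc
  have key : ∀ T T' : ℝ, 0 < T → T ≤ T' → EqOn (α T) (α T') (Ioo (-T) T) := by
    intro T T' hT hTT
    refine ODE_solution_unique_of_mem_Ioo (v := fun _ => W) (s := fun _ => univ) (K := K) (t₀ := 0)
      (fun _ _ => hK.lipschitzOnWith) ⟨by linarith, hT⟩ (fun t ht => ⟨hα T hT t ht, mem_univ _⟩)
      (fun t ht => ⟨hα T' (by linarith) t ⟨by linarith [ht.1], by linarith [ht.2]⟩, mem_univ _⟩) ?_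
    rw [h0 T hT, h0 T' (by linarith)]
  refine ⟨fun t => α (|t| + 1) t, h0 _ (by positivity), fun s => ?_⟩
  have hs : s ∈ Ioo (-(|s| + 2)) (|s| + 2) := by
    constructor <;> linarith [neg_abs_le s, le_abs_self s]
  have hev : (fun t => α (|t| + 1) t) =ᶠ[𝓝 s] α (|s| + 2) := by
    have hnear : ∀ᶠ t in 𝓝 s, |t| < |s| + 1 :=
      (continuous_abs.tendsto s).eventually (gt_mem_nhds (by linarith))
    filter_upwards [hnear] with t ht
    refine key (|t| + 1) (|s| + 2) (by positivity) (by linarith) ?_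
    constructor <;> linarith [neg_abs_le t, le_abs_self t]
  have hd := (hα (|s| + 2) (by positivity) s hs).congr_of_eventuallyEq hev
  rwa [← hev.eq_of_nhds] at hd

theorem core (d1 d2 : ℕ) (hd1 : 2 ≤ d1) (hd2 : 2 ≤ d2) (n : ℕ) (hn : n = d1 + d2)
    (V : ℝ × ℝ × ℝ × ℝ → ℝ × ℝ × ℝ × ℝ)
    (hV : ∀ p : ℝ × ℝ × ℝ × ℝ,
      V p = (((d1 : ℝ) * d2 / n) * p.1 * p.2.2.1 * (p.2.2.1 * p.2.2.2 - 1 / d1),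
             ((d1 : ℝ) * d2 / n) * p.2.1 * p.2.2.1 * (p.2.2.1 * p.2.2.2 + 1 / d2),
             (p.2.2.1 * p.2.2.2 / n) * ((d1 : ℝ) * d2 * p.2.2.1 ^ 2 - ((n : ℝ) - 1))
               + ((d1 : ℝ) - 1) * p.1 ^ 2 - ((d2 : ℝ) - 1) * p.2.1 ^ 2,
             -((1 - p.2.2.2 ^ 2) / n) * ((d1 : ℝ) * d2 * p.2.2.1 ^ 2 + 1)))
    (γ : ℝ → ℝ × ℝ × ℝ × ℝ) (c : ℝ → ℝ) (a b : ℝ)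
    (hγ : ∀ t ∈ uIcc a b, HasDerivAt γ (c t • V (γ t)) t)
    (hc : ContinuousOn c (uIcc a b)) :
    (∃ k : ℝ, 0 < k ∧ (γ b).1 = k * (γ a).1) ∧
    (∃ k : ℝ, 0 < k ∧ (γ b).2.1 = k * (γ a).2.1) ∧
    (∃ k : ℝ, 0 < k ∧ 1 - (γ b).2.2.2 ^ 2 = k * (1 - (γ a).2.2.2 ^ 2)) ∧
    (∃ k : ℝ, 0 < k ∧
      ((d1 : ℝ) * ((d1 : ℝ) - 1) * (γ b).1 ^ 2 + (d2 : ℝ) * ((d2 : ℝ) - 1) * (γ b).2.1 ^ 2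
        + ((d1 : ℝ) * d2 / n) * (γ b).2.2.1 ^ 2 - ((n : ℝ) - 1) / n) =
      k * ((d1 : ℝ) * ((d1 : ℝ) - 1) * (γ a).1 ^ 2 + (d2 : ℝ) * ((d2 : ℝ) - 1) * (γ a).2.1 ^ 2
        + ((d1 : ℝ) * d2 / n) * (γ a).2.2.1 ^ 2 - ((n : ℝ) - 1) / n)) := by
  have hd1' : (d1 : ℝ) ≠ 0 := by positivity
  have hd2' : (d2 : ℝ) ≠ 0 := by positivity
  have hn' : (n : ℝ) ≠ 0 := by
    have : n ≠ 0 := by omega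
    exact_mod_cast this
  have hγc : ContinuousOn γ (uIcc a b) := fun t ht => (hγ t ht).continuousAt.continuousWithinAt
  have hD : ContinuousOn (fun t => (γ t).2.2.1) (uIcc a b) := by fun_prop
  have hH : ContinuousOn (fun t => (γ t).2.2.2) (uIcc a b) := by fun_prop
  have e1 : ∀ t ∈ uIcc a b, HasDerivAt (fun t => (γ t).1) (c t * (V (γ t)).1) t :=
    fun t ht => (hγ t ht).fst
  have e2 : ∀ t ∈ uIcc a b, HasDerivAt (fun t => (γ t).2.1) (c t * (V (γ t)).2.1) t :=
    fun t ht => (hγ t ht).snd.fst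
  have e3 : ∀ t ∈ uIcc a b, HasDerivAt (fun t => (γ t).2.2.1) (c t * (V (γ t)).2.2.1) t :=
    fun t ht => (hγ t ht).snd.snd.fst
  have e4 : ∀ t ∈ uIcc a b, HasDerivAt (fun t => (γ t).2.2.2) (c t * (V (γ t)).2.2.2) t :=
    fun t ht => (hγ t ht).snd.snd.snd
  refine ⟨?_, ?_, ?_, ?_⟩
  · refine lin_ode a b (fun t => (γ t).1)
      (fun t => c t * (((d1 : ℝ) * d2 / n) * (γ t).2.2.1 * ((γ t).2.2.1 * (γ t).2.2.2 - 1 / d1)))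
      (fun t ht => ?_) (by fun_prop)
    convert e1 t ht using 1
    rw [hV]
    ring
  · refine lin_ode a b (fun t => (γ t).2.1)
      (fun t => c t * (((d1 : ℝ) * d2 / n) * (γ t).2.2.1 * ((γ t).2.2.1 * (γ t).2.2.2 + 1 / d2)))
      (fun t ht => ?_) (by fun_prop)
    convert e2 t ht using 1
    rw [hV]
    ring
  · refine lin_ode a b (fun t => 1 - (γ t).2.2.2 ^ 2)
      (fun t => c t * (2 * (γ t).2.2.2 * ((d1 : ℝ) * d2 * (γ t).2.2.1 ^ 2 + 1) * (1 / n)))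
      (fun t ht => ?_) (by fun_prop)
    refine HasDerivAt.congr_deriv (((e4 t ht).pow 2).const_sub 1) ?_
    rw [hV]
    norm_num
    ring
  · refine lin_ode a b (fun t => (d1 : ℝ) * ((d1 : ℝ) - 1) * (γ t).1 ^ 2
        + (d2 : ℝ) * ((d2 : ℝ) - 1) * (γ t).2.1 ^ 2
        + ((d1 : ℝ) * d2 / n) * (γ t).2.2.1 ^ 2 - ((n : ℝ) - 1) / n)
      (fun t => c t * (2 * ((d1 : ℝ) * d2 / n) * (γ t).2.2.1 ^ 2 * (γ t).2.2.2))
      (fun t ht => ?_) (by fun_prop)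
    refine HasDerivAt.congr_deriv ((((((e1 t ht).pow 2).const_mul ((d1 : ℝ) * ((d1 : ℝ) - 1))).add
      (((e2 t ht).pow 2).const_mul ((d2 : ℝ) * ((d2 : ℝ) - 1)))).add
      (((e3 t ht).pow 2).const_mul ((d1 : ℝ) * d2 / n))).sub_const (((n : ℝ) - 1) / n)) ?_
    rw [hV]
    norm_num
    field_simp
    ring

/-- The set `S` is compact and invariant under the Einstein ODE in
(Y, Δ, H)-coordinates, solutions through points of `S` exist for all times, the
boundary part is invariant, `H` is non-increasing along solutions in `S`, and `H`
is strictly decreasing wherever `H² ≠ 1`.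
A point `p : ℝ × ℝ × ℝ × ℝ` encodes `(Y1, Y2, Δ, H) = (p.1, p.2.1, p.2.2.1, p.2.2.2)`. -/
theorem stmt1 (d1 d2 : ℕ) (hd1 : 2 ≤ d1) (hd2 : 2 ≤ d2) (n : ℕ) (hn : n = d1 + d2)
    (V : ℝ × ℝ × ℝ × ℝ → ℝ × ℝ × ℝ × ℝ)
    (hV : ∀ p : ℝ × ℝ × ℝ × ℝ,
      V p = (((d1 : ℝ) * d2 / n) * p.1 * p.2.2.1 * (p.2.2.1 * p.2.2.2 - 1 / d1),
             ((d1 : ℝ) * d2 / n) * p.2.1 * p.2.2.1 * (p.2.2.1 * p.2.2.2 + 1 / d2),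
             (p.2.2.1 * p.2.2.2 / n) * ((d1 : ℝ) * d2 * p.2.2.1 ^ 2 - ((n : ℝ) - 1))
               + ((d1 : ℝ) - 1) * p.1 ^ 2 - ((d2 : ℝ) - 1) * p.2.1 ^ 2,
             -((1 - p.2.2.2 ^ 2) / n) * ((d1 : ℝ) * d2 * p.2.2.1 ^ 2 + 1)))
    (S : Set (ℝ × ℝ × ℝ × ℝ))
    (hS : S = {p : ℝ × ℝ × ℝ × ℝ | 0 ≤ p.1 ∧ 0 ≤ p.2.1 ∧ p.2.2.2 ^ 2 ≤ 1 ∧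
      (d1 : ℝ) * ((d1 : ℝ) - 1) * p.1 ^ 2 + (d2 : ℝ) * ((d2 : ℝ) - 1) * p.2.1 ^ 2
        + ((d1 : ℝ) * d2 / n) * p.2.2.1 ^ 2 - ((n : ℝ) - 1) / n = 0}) :
    -- `S` is compact
    IsCompact S ∧
    -- `S` is invariant: solutions with a value in `S` remain in `S`
    (∀ J : Set ℝ, J.OrdConnected → ∀ γ : ℝ → ℝ × ℝ × ℝ × ℝ,
      (∀ s ∈ J, HasDerivAt γ (V (γ s)) s) →
      ∀ s0 ∈ J, γ s0 ∈ S → ∀ s ∈ J, γ s ∈ S) ∧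
    -- solutions through points of `S` exist for all `s ∈ ℝ` (and stay in `S`)
    (∀ p ∈ S, ∃ γ : ℝ → ℝ × ℝ × ℝ × ℝ, γ 0 = p ∧
      ∀ s : ℝ, HasDerivAt γ (V (γ s)) s ∧ γ s ∈ S) ∧
    -- the boundary part `S ∩ ({Y1 = 0} ∪ {Y2 = 0} ∪ {H² = 1})` is invariant
    (∀ J : Set ℝ, J.OrdConnected → ∀ γ : ℝ → ℝ × ℝ × ℝ × ℝ,
      (∀ s ∈ J, HasDerivAt γ (V (γ s)) s) →
      ∀ s0 ∈ J, γ s0 ∈ S ∩ {p | p.1 = 0 ∨ p.2.1 = 0 ∨ p.2.2.2 ^ 2 = 1} →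
      ∀ s ∈ J, γ s ∈ S ∩ {p | p.1 = 0 ∨ p.2.1 = 0 ∨ p.2.2.2 ^ 2 = 1}) ∧
    -- `H` is non-increasing along solutions in `S`, and strictly decreasing where `H² ≠ 1`
    (∀ J : Set ℝ, J.OrdConnected → ∀ γ : ℝ → ℝ × ℝ × ℝ × ℝ,
      (∀ s ∈ J, HasDerivAt γ (V (γ s)) s) → (∀ s ∈ J, γ s ∈ S) →
      (∀ s ∈ J, ∀ t ∈ J, s ≤ t → (γ t).2.2.2 ≤ (γ s).2.2.2) ∧
      (∀ s ∈ J, ((γ s).2.2.2) ^ 2 ≠ 1 →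
        ∃ d : ℝ, d < 0 ∧ HasDerivAt (fun u => (γ u).2.2.2) d s)) := by
  have hn4 : 4 ≤ n := by omega
  have hd1r : (2 : ℝ) ≤ d1 := by exact_mod_cast hd1
  have hd2r : (2 : ℝ) ≤ d2 := by exact_mod_cast hd2
  have hnr : (4 : ℝ) ≤ n := by exact_mod_cast hn4
  have hn0 : (0 : ℝ) < n := by linarith
  have hsmooth : ContDiff ℝ 1 V := by
    rw [funext hV]
    fun_prop
  have hinv : ∀ (γ : ℝ → ℝ × ℝ × ℝ × ℝ) (c : ℝ → ℝ) (a b : ℝ),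
      (∀ t ∈ uIcc a b, HasDerivAt γ (c t • V (γ t)) t) → ContinuousOn c (uIcc a b) →
      γ a ∈ S → γ b ∈ S := by
    intro γ c a b hγ hc ha
    obtain ⟨⟨k1, p1, q1⟩, ⟨k2, p2, q2⟩, ⟨k3, p3, q3⟩, ⟨k4, p4, q4⟩⟩ :=
      core d1 d2 hd1 hd2 n hn V hV γ c a b hγ hc
    rw [hS] at ha ⊢
    obtain ⟨h1, h2, h3, h4⟩ := ha
    refine ⟨?_, ?_, ?_, ?_⟩
    · rw [q1]; positivity
    · rw [q2]; positivity
    · have : 0 ≤ k3 * (1 - (γ a).2.2.2 ^ 2) := mul_nonneg p3.le (by linarith)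
      linarith
    · rw [q4, h4, mul_zero]
  have hone : ∀ (γ : ℝ → ℝ × ℝ × ℝ × ℝ) (J : Set ℝ), J.OrdConnected →
      (∀ s ∈ J, HasDerivAt γ (V (γ s)) s) → ∀ a ∈ J, ∀ b ∈ J,
      ∀ t ∈ uIcc a b, HasDerivAt γ ((fun _ : ℝ => (1 : ℝ)) t • V (γ t)) t := by
    intro γ J hJ hγ a ha b hb t ht
    simpa using hγ t (hJ.uIcc_subset ha hb ht)
  have hcompact : IsCompact S := by
    apply Metric.isCompact_of_isClosed_isBounded
    · rw [hS]
      simp only [setOf_and]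
      refine IsClosed.inter ?_ (IsClosed.inter ?_ (IsClosed.inter ?_ ?_))
      · exact isClosed_le (by fun_prop) (by fun_prop)
      · exact isClosed_le (by fun_prop) (by fun_prop)
      · exact isClosed_le (by fun_prop) (by fun_prop)
      · exact isClosed_eq (by fun_prop) (by fun_prop)
    · refine (Metric.isBounded_Icc ((-1, -1, -1, -1) : ℝ × ℝ × ℝ × ℝ) (1, 1, 1, 1)).subset ?_
      rw [hS]
      rintro ⟨y1, y2, D, H⟩ ⟨h1, h2, h3, h4⟩
      simp only at h1 h2 h3 h4
      have hc1 : (2 : ℝ) ≤ (d1 : ℝ) * ((d1 : ℝ) - 1) := by nlinarith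
      have hc2 : (2 : ℝ) ≤ (d2 : ℝ) * ((d2 : ℝ) - 1) := by nlinarith
      have hc3 : (1 : ℝ) ≤ (d1 : ℝ) * d2 / n := by
        rw [le_div_iff₀ hn0, hn]
        push_cast
        nlinarith
      have hc4 : ((n : ℝ) - 1) / n ≤ 1 := by
        rw [div_le_one hn0]
        linarith
      have b1 := mul_nonneg (sub_nonneg.mpr hc1) (sq_nonneg y1)
      have b2 := mul_nonneg (sub_nonneg.mpr hc2) (sq_nonneg y2)
      have b3 := mul_nonneg (sub_nonneg.mpr hc3) (sq_nonneg D)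
      have a1 : |y1| ≤ 1 := by
        rw [← sq_le_one_iff_abs_le_one]; nlinarith [sq_nonneg y1, sq_nonneg y2, sq_nonneg D]
      have a2 : |y2| ≤ 1 := by
        rw [← sq_le_one_iff_abs_le_one]; nlinarith [sq_nonneg y1, sq_nonneg y2, sq_nonneg D]
      have a3 : |D| ≤ 1 := by
        rw [← sq_le_one_iff_abs_le_one]; nlinarith [sq_nonneg y1, sq_nonneg y2, sq_nonneg D]
      have a4 : |H| ≤ 1 := by
        rw [← sq_le_one_iff_abs_le_one]; exact h3
      rw [abs_le] at a1 a2 a3 a4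
      exact ⟨⟨a1.1, a2.1, a3.1, a4.1⟩, ⟨a1.2, a2.2, a3.2, a4.2⟩⟩
  refine ⟨hcompact, ?_, ?_, ?_, ?_⟩
  · intro J hJ γ hγ s0 hs0 h0 s hs
    exact hinv γ (fun _ => 1) s0 s (hone γ J hJ hγ s0 hs0 s hs) continuousOn_const h0
  · intro p hp
    obtain ⟨R, hR0, hR⟩ := hcompact.isBounded.subset_closedBall_lt 0 (0 : ℝ × ℝ × ℝ × ℝ)
    let χ : ContDiffBump (0 : ℝ × ℝ × ℝ × ℝ) := ⟨R, R + 1, hR0, by linarith⟩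
    have hχ : ContDiff ℝ 1 (fun x => χ x) := χ.contDiff
    have hWs : ContDiff ℝ 1 (fun x => χ x • V x) := hχ.smul hsmooth
    have hWc : HasCompactSupport (fun x => χ x • V x) := χ.hasCompactSupport.smul_right
    obtain ⟨K, hK⟩ := hWs.lipschitzWith_of_hasCompactSupport hWc one_ne_zero
    obtain ⟨L, hL⟩ := hWc.exists_bound_of_continuous hWs.continuous
    obtain ⟨γ, h0, hγ⟩ := global_ode (fun x => χ x • V x) K L.toNNReal hK
      (fun x => (hL x).trans (Real.le_coe_toNNReal L)) p
    have hγc : Continuous γ := continuous_iff_continuousAt.mpr fun t => (hγ t).continuousAt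
    have hmem : ∀ s, γ s ∈ S := fun s =>
      hinv γ (fun t => χ (γ t)) 0 s (fun t _ => hγ t)
        (hχ.continuous.comp hγc).continuousOn (by rw [h0]; exact hp)
    refine ⟨γ, h0, fun s => ⟨?_, hmem s⟩⟩
    have h1 : χ (γ s) = 1 := χ.one_of_mem_closedBall (hR (hmem s))
    have := hγ s
    simpa only [h1, one_smul] using this
  · intro J hJ γ hγ s0 hs0 h0 s hs
    refine ⟨hinv γ (fun _ => 1) s0 s (hone γ J hJ hγ s0 hs0 s hs) continuousOn_const h0.1, ?_⟩
    obtain ⟨⟨k1, p1, q1⟩, ⟨k2, p2, q2⟩, ⟨k3, p3, q3⟩, -⟩ :=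
      core d1 d2 hd1 hd2 n hn V hV γ (fun _ => 1) s0 s (hone γ J hJ hγ s0 hs0 s hs)
        continuousOn_const
    rcases h0.2 with h | h | h
    · left; rw [q1, h, mul_zero]
    · right; left; rw [q2, h, mul_zero]
    · right; right
      rw [h] at q3
      linarith
  · intro J hJ γ hγ hJS
    have e4 : ∀ s ∈ J, HasDerivAt (fun t => (γ t).2.2.2)
        (-((1 - (γ s).2.2.2 ^ 2) / n) * ((d1 : ℝ) * d2 * (γ s).2.2.1 ^ 2 + 1)) s := by
      intro s hs
      have h : HasDerivAt (fun t => (γ t).2.2.2) (V (γ s)).2.2.2 s := (hγ s hs).snd.snd.snd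
      rwa [hV] at h
    have hH : ∀ s ∈ J, (γ s).2.2.2 ^ 2 ≤ 1 := by
      intro s hs
      have h := hJS s hs
      rw [hS] at h
      exact h.2.2.1
    constructor
    · have hanti : AntitoneOn (fun t => (γ t).2.2.2) J := by
        refine antitoneOn_of_hasDerivWithinAt_nonpos hJ.convex
          (fun t ht => (e4 t ht).continuousAt.continuousWithinAt)
          (fun t ht => (e4 t (interior_subset ht)).hasDerivWithinAt) (fun t ht => ?_)
        have h1 : 0 ≤ (1 - (γ t).2.2.2 ^ 2) / n :=
          div_nonneg (by linarith [hH t (interior_subset ht)]) hn0.le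
        have h2 : 0 ≤ (d1 : ℝ) * d2 * (γ t).2.2.1 ^ 2 + 1 := by positivity
        nlinarith [mul_nonneg h1 h2]
      exact fun s hs t ht hst => hanti hs ht hst
    · intro s hs hne
      refine ⟨_, ?_, e4 s hs⟩
      have h1 : 0 < (1 - (γ s).2.2.2 ^ 2) / n :=
        div_pos (by linarith [lt_of_le_of_ne (hH s hs) hne]) hn0
      have h2 : 0 < (d1 : ℝ) * d2 * (γ s).2.2.1 ^ 2 + 1 := by positivity
      nlinarith [mul_pos h1 h2]
end

section
/- Along any solution (Y1, Y2, Δ, H) of the Einstein ODE in (Y, Δ, H)-coordinates, the function G(s) = Y1(s)^(2·d1)·Y2(s)^(2·d2) satisfies G'(s) = 2·d1·d2·G(s)·Δ(s)²·H(s). In particular, G is non-decreasing on every interval on which H ≥ 0. -/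
/-- Along any solution `(Y1, Y2, D, H)` of the Einstein ODE in
(Y, Δ, H)-coordinates (here `D` denotes `Δ`), the function
`G = Y1^(2 d1) · Y2^(2 d2)` satisfies `G' = 2 d1 d2 · G · Δ² · H`; in particular
`G` is non-decreasing on every subinterval on which `H ≥ 0`. -/
theorem stmt2 (d1 d2 : ℕ) (hd1 : 2 ≤ d1) (hd2 : 2 ≤ d2) (n : ℕ) (hn : n = d1 + d2)
    (J : Set ℝ) (hJ : J.OrdConnected)
    (Y1 Y2 D H : ℝ → ℝ)
    (hY1 : ∀ s ∈ J, HasDerivAt Y1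
      (((d1 : ℝ) * d2 / n) * Y1 s * D s * (D s * H s - 1 / d1)) s)
    (hY2 : ∀ s ∈ J, HasDerivAt Y2
      (((d1 : ℝ) * d2 / n) * Y2 s * D s * (D s * H s + 1 / d2)) s)
    (hD : ∀ s ∈ J, HasDerivAt D
      ((D s * H s / n) * ((d1 : ℝ) * d2 * (D s) ^ 2 - ((n : ℝ) - 1))
        + ((d1 : ℝ) - 1) * (Y1 s) ^ 2 - ((d2 : ℝ) - 1) * (Y2 s) ^ 2) s)
    (hH : ∀ s ∈ J, HasDerivAt H
      (-((1 - (H s) ^ 2) / n) * ((d1 : ℝ) * d2 * (D s) ^ 2 + 1)) s)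
    (G : ℝ → ℝ) (hG : ∀ s, G s = Y1 s ^ (2 * d1) * Y2 s ^ (2 * d2)) :
    (∀ s ∈ J, HasDerivAt G (2 * (d1 : ℝ) * d2 * G s * (D s) ^ 2 * H s) s) ∧
    (∀ s ∈ J, ∀ t ∈ J, s ≤ t → (∀ u ∈ Set.Icc s t, 0 ≤ H u) → G s ≤ G t) := by
  have hd1' : (d1 : ℝ) ≠ 0 := by
    have : d1 ≠ 0 := by omega
    exact_mod_cast this
  have hd2' : (d2 : ℝ) ≠ 0 := by
    have : d2 ≠ 0 := by omega
    exact_mod_cast this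
  have hn' : (n : ℝ) = d1 + d2 := by
    rw [hn]; push_cast; ring
  have hn0 : (d1 : ℝ) + d2 ≠ 0 := by positivity
  have key : ∀ s ∈ J, HasDerivAt G (2 * (d1 : ℝ) * d2 * G s * (D s) ^ 2 * H s) s := by
    intro s hs
    have hGe : G = fun s => Y1 s ^ (2 * d1) * Y2 s ^ (2 * d2) := funext hG
    have h := ((hY1 s hs).fun_pow (2 * d1)).fun_mul ((hY2 s hs).fun_pow (2 * d2))
    rw [hGe]
    refine h.congr_deriv ?_
    have e1 : Y1 s ^ (2 * d1) = Y1 s ^ (2 * d1 - 1) * Y1 s := by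
      rw [← pow_succ]; congr 1; omega
    have e2 : Y2 s ^ (2 * d2) = Y2 s ^ (2 * d2 - 1) * Y2 s := by
      rw [← pow_succ]; congr 1; omega
    simp only [e1, e2, hn']
    push_cast
    field_simp
    ring
  refine ⟨key, ?_⟩
  intro s hs t ht hst hu
  have hsub : Set.Icc s t ⊆ J := hJ.out hs ht
  have hmono : MonotoneOn G (Set.Icc s t) := by
    apply monotoneOn_of_hasDerivWithinAt_nonneg (convex_Icc s t)
      (fun u hu' => (key u (hsub hu')).continuousAt.continuousWithinAt)
      (fun u hu' => (key u (hsub (interior_subset hu'))).hasDerivWithinAt)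
    intro u hu'
    have hH0 := hu u (interior_subset hu')
    have hG0 : 0 ≤ G u := by
      rw [hG, pow_mul, pow_mul]
      positivity
    positivity
  exact hmono (Set.left_mem_Icc.2 hst) (Set.right_mem_Icc.2 hst) hst
end

section
/- Let (Y1, Y2, Δ, H) : I → ℝ⁴ be a solution of the Einstein ODE in (Y, Δ, H)-coordinates whose values lie in the set S (in particular S1 = 0 along the solution). Then the curve (Z, Δ, H) : I → ℝ³ with Z := (d1−1)·Y1² − (d2−1)·Y2² is a solution of the Einstein ODE in (Z, Δ, H)-coordinates, and its values satisfy d1·Z + (d1·d2/n)·Δ² ≤ (n−1)/n and −d2·Z + (d1·d2/n)·Δ² ≤ (n−1)/n. -/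
/-- If `(Y1, Y2, D, H)` is a solution of the Einstein ODE in
(Y, Δ, H)-coordinates with values in the set `S` (here `D` denotes `Δ`), then
`Z := (d1−1)·Y1² − (d2−1)·Y2²` turns `(Z, D, H)` into a solution of the Einstein
ODE in (Z, Δ, H)-coordinates, whose values satisfy the two stated inequalities. -/
theorem stmt3 (d1 d2 : ℕ) (hd1 : 2 ≤ d1) (hd2 : 2 ≤ d2) (n : ℕ) (hn : n = d1 + d2)
    (J : Set ℝ) (hJ : J.OrdConnected)
    (Y1 Y2 D H : ℝ → ℝ)
    (hY1 : ∀ s ∈ J, HasDerivAt Y1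
      (((d1 : ℝ) * d2 / n) * Y1 s * D s * (D s * H s - 1 / d1)) s)
    (hY2 : ∀ s ∈ J, HasDerivAt Y2
      (((d1 : ℝ) * d2 / n) * Y2 s * D s * (D s * H s + 1 / d2)) s)
    (hD : ∀ s ∈ J, HasDerivAt D
      ((D s * H s / n) * ((d1 : ℝ) * d2 * (D s) ^ 2 - ((n : ℝ) - 1))
        + ((d1 : ℝ) - 1) * (Y1 s) ^ 2 - ((d2 : ℝ) - 1) * (Y2 s) ^ 2) s)
    (hH : ∀ s ∈ J, HasDerivAt H
      (-((1 - (H s) ^ 2) / n) * ((d1 : ℝ) * d2 * (D s) ^ 2 + 1)) s)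
    (hmem : ∀ s ∈ J, 0 ≤ Y1 s ∧ 0 ≤ Y2 s ∧ (H s) ^ 2 ≤ 1 ∧
      (d1 : ℝ) * ((d1 : ℝ) - 1) * (Y1 s) ^ 2 + (d2 : ℝ) * ((d2 : ℝ) - 1) * (Y2 s) ^ 2
        + ((d1 : ℝ) * d2 / n) * (D s) ^ 2 - ((n : ℝ) - 1) / n = 0)
    (Z : ℝ → ℝ)
    (hZ : ∀ s, Z s = ((d1 : ℝ) - 1) * (Y1 s) ^ 2 - ((d2 : ℝ) - 1) * (Y2 s) ^ 2) :
    ∀ s ∈ J,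
      HasDerivAt Z ((2 / n) * D s * ((d1 : ℝ) * d2 * Z s * D s * H s
        + ((d1 : ℝ) * d2 / n) * (D s) ^ 2 - ((n : ℝ) - 1) / n
        + ((d1 : ℝ) - (d2 : ℝ)) * Z s)) s ∧
      HasDerivAt D (D s * H s * (((d1 : ℝ) * d2 / n) * (D s) ^ 2 - ((n : ℝ) - 1) / n)
        + Z s) s ∧
      HasDerivAt H (-((1 - (H s) ^ 2) / n) * ((d1 : ℝ) * d2 * (D s) ^ 2 + 1)) s ∧
      (d1 : ℝ) * Z s + ((d1 : ℝ) * d2 / n) * (D s) ^ 2 ≤ ((n : ℝ) - 1) / n ∧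
      -(d2 : ℝ) * Z s + ((d1 : ℝ) * d2 / n) * (D s) ^ 2 ≤ ((n : ℝ) - 1) / n := by
  intro s hs
  obtain ⟨-, -, -, hS⟩ := hmem s hs
  have h1 : (2 : ℝ) ≤ d1 := by exact_mod_cast hd1
  have h2 : (2 : ℝ) ≤ d2 := by exact_mod_cast hd2
  have hn0 : (n : ℝ) ≠ 0 := by
    have : n ≠ 0 := by omega
    exact_mod_cast this
  have h10 : (d1 : ℝ) ≠ 0 := by positivity
  have h20 : (d2 : ℝ) ≠ 0 := by positivity
  have ha : 0 ≤ ((d1 : ℝ) - 1) * (Y1 s) ^ 2 := mul_nonneg (by linarith) (sq_nonneg _)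
  have hb : 0 ≤ ((d2 : ℝ) - 1) * (Y2 s) ^ 2 := mul_nonneg (by linarith) (sq_nonneg _)
  refine ⟨?_, ?_, hH s hs, ?_, ?_⟩
  · have hZf : Z = fun s => ((d1 : ℝ) - 1) * (Y1 s) ^ 2 - ((d2 : ℝ) - 1) * (Y2 s) ^ 2 :=
      funext hZ
    have hder := (((hY1 s hs).fun_pow 2).const_mul ((d1 : ℝ) - 1)).fun_sub
      (((hY2 s hs).fun_pow 2).const_mul ((d2 : ℝ) - 1))
    rw [← hZf] at hder
    refine hder.congr_deriv ?_
    have e1 : ((d1 : ℝ) * d2 / n) * (D s) ^ 2 - ((n : ℝ) - 1) / n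
        = -((d1 : ℝ) * ((d1 : ℝ) - 1) * (Y1 s) ^ 2
          + (d2 : ℝ) * ((d2 : ℝ) - 1) * (Y2 s) ^ 2) := by linarith
    rw [add_sub_assoc, e1, hZ s]
    push_cast
    field_simp
    ring
  · refine (hD s hs).congr_deriv ?_
    rw [hZ s]
    field_simp
    ring
  · rw [hZ s]
    nlinarith [mul_nonneg (Nat.cast_nonneg (α := ℝ) d1) hb, mul_nonneg (Nat.cast_nonneg (α := ℝ) d2) hb]
  · rw [hZ s]
    nlinarith [mul_nonneg (Nat.cast_nonneg (α := ℝ) d1) ha, mul_nonneg (Nat.cast_nonneg (α := ℝ) d2) ha]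
end

section
/- The two surfaces {(Z, Δ, H) ∈ ℝ³ : d1·Z + (d1·d2/n)·Δ² = (n−1)/n} and {(Z, Δ, H) ∈ ℝ³ : −d2·Z + (d1·d2/n)·Δ² = (n−1)/n} are invariant under the Einstein ODE in (Z, Δ, H)-coordinates: any solution whose initial value lies on one of these surfaces remains on that surface for all times in its interval of existence. -/
lemma aux_fwd {f g : ℝ → ℝ} {a b : ℝ} (hab : a ≤ b)
    (hf : ∀ s ∈ Set.Icc a b, HasDerivAt f (g s * f s) s)
    (hg : ContinuousOn g (Set.Icc a b)) (h0 : f a = 0) : f b = 0 := by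
  obtain ⟨K, hK⟩ := isCompact_Icc.exists_bound_of_continuousOn hg
  refine eq_zero_of_abs_deriv_le_mul_abs_self_of_eq_zero_right (f := f) (f' := fun s => g s * f s)
    (K := K) (a := a) (b := b) (fun s hs => (hf s hs).continuousAt.continuousWithinAt)
    (fun s hs => (hf s (Set.Ico_subset_Icc_self hs)).hasDerivWithinAt) h0
    (fun s hs => ?_) b ⟨hab, le_rfl⟩
  rw [norm_mul]
  exact mul_le_mul_of_nonneg_right (hK s (Set.Ico_subset_Icc_self hs)) (norm_nonneg _)

lemma aux_ord {f g : ℝ → ℝ} {J : Set ℝ} (hJ : J.OrdConnected)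
    (hf : ∀ s ∈ J, HasDerivAt f (g s * f s) s)
    (hg : ContinuousOn g J) {a : ℝ} (ha : a ∈ J) (h0 : f a = 0) : ∀ s ∈ J, f s = 0 := by
  intro b hb
  rcases le_total a b with h | h
  · exact aux_fwd h (fun s hs => hf s (hJ.out ha hb hs)) (hg.mono (hJ.out ha hb)) h0
  · have hm : ∀ s ∈ Set.Icc (-a) (-b), -s ∈ J := fun s hs =>
      hJ.out hb ha ⟨by linarith [hs.2], by linarith [hs.1]⟩
    have := aux_fwd (f := fun s => f (-s)) (g := fun s => -g (-s)) (a := -a) (b := -b)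
      (by linarith)
      (fun s hs => by
        have h1 := (hf (-s) (hm s hs)).comp s (hasDerivAt_neg s)
        refine h1.congr_deriv ?_
        ring)
      ((hg.comp continuous_neg.continuousOn hm).neg) (by simpa using h0)
    simpa using this

/-- The two surfaces `{d1·Z + (d1·d2/n)·Δ² = (n−1)/n}` and
`{−d2·Z + (d1·d2/n)·Δ² = (n−1)/n}` are invariant under the Einstein ODE in
(Z, Δ, H)-coordinates.  A point `p : ℝ × ℝ × ℝ` encodes `(Z, Δ, H) = (p.1, p.2.1, p.2.2)`. -/
theorem stmt4 (d1 d2 : ℕ) (hd1 : 2 ≤ d1) (hd2 : 2 ≤ d2) (n : ℕ) (hn : n = d1 + d2)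
    (W : ℝ × ℝ × ℝ → ℝ × ℝ × ℝ)
    (hW : ∀ p : ℝ × ℝ × ℝ,
      W p = ((2 / n) * p.2.1 * ((d1 : ℝ) * d2 * p.1 * p.2.1 * p.2.2
               + ((d1 : ℝ) * d2 / n) * p.2.1 ^ 2 - ((n : ℝ) - 1) / n
               + ((d1 : ℝ) - (d2 : ℝ)) * p.1),
             p.2.1 * p.2.2 * (((d1 : ℝ) * d2 / n) * p.2.1 ^ 2 - ((n : ℝ) - 1) / n) + p.1,
             -((1 - p.2.2 ^ 2) / n) * ((d1 : ℝ) * d2 * p.2.1 ^ 2 + 1))) :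
    ∀ J : Set ℝ, J.OrdConnected → ∀ γ : ℝ → ℝ × ℝ × ℝ,
      (∀ s ∈ J, HasDerivAt γ (W (γ s)) s) → ∀ s0 ∈ J,
      (((d1 : ℝ) * (γ s0).1 + ((d1 : ℝ) * d2 / n) * (γ s0).2.1 ^ 2 = ((n : ℝ) - 1) / n →
        ∀ s ∈ J, (d1 : ℝ) * (γ s).1 + ((d1 : ℝ) * d2 / n) * (γ s).2.1 ^ 2 = ((n : ℝ) - 1) / n) ∧
      (-(d2 : ℝ) * (γ s0).1 + ((d1 : ℝ) * d2 / n) * (γ s0).2.1 ^ 2 = ((n : ℝ) - 1) / n →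
        ∀ s ∈ J, -(d2 : ℝ) * (γ s).1 + ((d1 : ℝ) * d2 / n) * (γ s).2.1 ^ 2 = ((n : ℝ) - 1) / n)) := by
  intro J hJ γ hγ s0 hs0
  have hn0 : (n : ℝ) ≠ 0 := by
    have : n ≠ 0 := by omega
    exact_mod_cast this
  have hnr : (n : ℝ) = d1 + d2 := by exact_mod_cast hn
  have hc : ContinuousOn γ J := fun s hs => (hγ s hs).continuousAt.continuousWithinAt
  have hZ : ∀ s ∈ J, HasDerivAt (fun t => (γ t).1) (W (γ s)).1 s := fun s hs => (hγ s hs).fst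
  have hD : ∀ s ∈ J, HasDerivAt (fun t => (γ t).2.1) (W (γ s)).2.1 s :=
    fun s hs => (hγ s hs).snd.fst
  have hcD : ContinuousOn (fun t => (γ t).2.1) J := hc.snd.fst
  have hcH : ContinuousOn (fun t => (γ t).2.2) J := hc.snd.snd
  have key : ∀ e : ℝ, (e = d1 ∨ e = -d2) →
      e * (γ s0).1 + ((d1 : ℝ) * d2 / n) * (γ s0).2.1 ^ 2 = ((n : ℝ) - 1) / n →
      ∀ s ∈ J, e * (γ s).1 + ((d1 : ℝ) * d2 / n) * (γ s).2.1 ^ 2 = ((n : ℝ) - 1) / n := by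
    intro e he h0 s hs
    have := aux_ord (J := J) (a := s0)
      (f := fun t => e * (γ t).1 + ((d1 : ℝ) * d2 / n) * (γ t).2.1 ^ 2 - ((n : ℝ) - 1) / n)
      (g := fun t => 2 * ((d1 : ℝ) * d2 / n) * (γ t).2.1 ^ 2 * (γ t).2.2 + 2 * e / n * (γ t).2.1)
      hJ ?_ (by fun_prop) hs0 (by simpa [sub_eq_zero] using h0) s hs
    · exact sub_eq_zero.mp this
    · intro t ht
      refine ((((hZ t ht).const_mul e).add
        (((hD t ht).pow 2).const_mul ((d1 : ℝ) * d2 / n))).sub_const _).congr_deriv ?_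
      rw [hW]
      rcases he with rfl | rfl <;>
      · push_cast
        simp only [Nat.add_one_sub_one, pow_one]
        field_simp
        ring
  exact ⟨key d1 (Or.inl rfl), key (-d2) (Or.inr rfl)⟩
end

section
/- A point p ∈ S is a zero of the vector field defining the Einstein ODE in (Z, Δ, H)-coordinates if and only if p is one of the following points: p1± = ((d1−1)/d1², ±1/d1, ±1); p2± = (−(d2−1)/d2², ∓1/d2, ±1); cone± = (0, 0, ±1); q1± = (0, ∓√((n−1)/(d1·d2)), ±1); q2± = (0, ±√((n−1)/(d1·d2)), ±1). -/
/-- A point `p ∈ S` is a zero of the vector field of the Einstein ODE in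
(Z, Δ, H)-coordinates iff it is one of the ten listed fixed points.
A point `p : ℝ × ℝ × ℝ` encodes `(Z, Δ, H) = (p.1, p.2.1, p.2.2)`. -/
theorem stmt5 (d1 d2 : ℕ) (hd1 : 2 ≤ d1) (hd2 : 2 ≤ d2) (n : ℕ) (hn : n = d1 + d2)
    (W : ℝ × ℝ × ℝ → ℝ × ℝ × ℝ)
    (hW : ∀ p : ℝ × ℝ × ℝ,
      W p = ((2 / n) * p.2.1 * ((d1 : ℝ) * d2 * p.1 * p.2.1 * p.2.2
               + ((d1 : ℝ) * d2 / n) * p.2.1 ^ 2 - ((n : ℝ) - 1) / n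
               + ((d1 : ℝ) - (d2 : ℝ)) * p.1),
             p.2.1 * p.2.2 * (((d1 : ℝ) * d2 / n) * p.2.1 ^ 2 - ((n : ℝ) - 1) / n) + p.1,
             -((1 - p.2.2 ^ 2) / n) * ((d1 : ℝ) * d2 * p.2.1 ^ 2 + 1)))
    (S : Set (ℝ × ℝ × ℝ))
    (hS : S = {p : ℝ × ℝ × ℝ |
      (d1 : ℝ) * p.1 + ((d1 : ℝ) * d2 / n) * p.2.1 ^ 2 ≤ ((n : ℝ) - 1) / n ∧
      -(d2 : ℝ) * p.1 + ((d1 : ℝ) * d2 / n) * p.2.1 ^ 2 ≤ ((n : ℝ) - 1) / n ∧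
      p.2.2 ^ 2 ≤ 1})
    (p : ℝ × ℝ × ℝ) (hp : p ∈ S) :
    W p = 0 ↔
      p = ((((d1 : ℝ) - 1) / d1 ^ 2, 1 / (d1 : ℝ), (1 : ℝ))) ∨
      p = ((((d1 : ℝ) - 1) / d1 ^ 2, -(1 / (d1 : ℝ)), (-1 : ℝ))) ∨
      p = ((-(((d2 : ℝ) - 1) / d2 ^ 2), -(1 / (d2 : ℝ)), 1)) ∨
      p = ((-(((d2 : ℝ) - 1) / d2 ^ 2), 1 / (d2 : ℝ), -1)) ∨
      p = ((0, 0, 1)) ∨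
      p = ((0, 0, -1)) ∨
      p = ((0, -Real.sqrt (((n : ℝ) - 1) / ((d1 : ℝ) * d2)), 1)) ∨
      p = ((0, Real.sqrt (((n : ℝ) - 1) / ((d1 : ℝ) * d2)), -1)) ∨
      p = ((0, Real.sqrt (((n : ℝ) - 1) / ((d1 : ℝ) * d2)), 1)) ∨
      p = ((0, -Real.sqrt (((n : ℝ) - 1) / ((d1 : ℝ) * d2)), -1)) := by
  obtain ⟨z, x, h⟩ := p
  have ha : (0 : ℝ) < d1 := by
    have : 0 < d1 := by omega
    exact_mod_cast this
  have hb : (0 : ℝ) < d2 := by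
    have : 0 < d2 := by omega
    exact_mod_cast this
  have hN : (n : ℝ) = d1 + d2 := by rw [hn]; push_cast; rfl
  have hn1 : (1 : ℝ) ≤ n := by
    have : 1 ≤ n := by omega
    exact_mod_cast this
  have hsq : Real.sqrt (((n : ℝ) - 1) / ((d1 : ℝ) * d2)) ^ 2 = ((n : ℝ) - 1) / ((d1 : ℝ) * d2) :=
    Real.sq_sqrt (div_nonneg (by linarith) (by positivity))
  rw [hW]
  clear hW hp hS W S
  generalize Real.sqrt (((n : ℝ) - 1) / ((d1 : ℝ) * d2)) = r at *
  generalize (n : ℝ) = N at *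
  generalize (d1 : ℝ) = a at *
  generalize (d2 : ℝ) = b at *
  have hN0 : (0 : ℝ) < N := by linarith
  have hr : a * b / N * r ^ 2 - (N - 1) / N = 0 := by rw [hsq]; field_simp; ring
  simp only [Prod.mk_eq_zero, Prod.mk.injEq]
  have key1 : a * b / N * (1 / a) ^ 2 - (N - 1) / N = (1 - a) / a := by
    field_simp; rw [hN]; ring
  have key2 : a * b / N * (1 / b) ^ 2 - (N - 1) / N = (1 - b) / b := by
    field_simp; rw [hN]; ring
  constructor
  · rintro ⟨h1, h2, h3⟩
    have hh : h = 1 ∨ h = -1 := by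
      rcases mul_eq_zero.1 h3 with h3 | h3
      · have : 1 - h ^ 2 = 0 := by
          field_simp at h3; linarith
        exact (sq_eq_sq_iff_eq_or_eq_neg (a := h) (b := 1)).1 (by linarith)
      · have := mul_pos ha hb
        nlinarith [sq_nonneg x, mul_nonneg this.le (sq_nonneg x)]
    have hh2 : h ^ 2 = 1 := by rcases hh with rfl | rfl <;> norm_num
    by_cases hx : x = 0
    · subst hx
      have : z = 0 := by linarith
      subst this
      rcases hh with rfl | rfl <;> simp
    have h1' : a * b * z * x * h + a * b / N * x ^ 2 - (N - 1) / N + (a - b) * z = 0 := by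
      refine (mul_eq_zero.1 h1).resolve_left ?_
      positivity
    have hz : z = -(x * h * (a * b / N * x ^ 2 - (N - 1) / N)) := by linarith
    have hf : (a * b / N * x ^ 2 - (N - 1) / N) * ((a * (x * h) - 1) * (b * (x * h) + 1)) = 0 := by
      generalize hA : a * b / N * x ^ 2 - (N - 1) / N = A at *
      rw [hz] at h1'
      linear_combination hA - h1'
    have hxx : x = (x * h) * h := by linear_combination (-x) * hh2
    rcases mul_eq_zero.1 hf with hA | hf
    · have hz0 : z = 0 := by rw [hz, hA]; ring
      have : x ^ 2 = r ^ 2 := by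
        have : a * b / N * (x ^ 2 - r ^ 2) = 0 := by linarith
        have := (mul_eq_zero.1 this).resolve_left (by positivity)
        linarith
      rcases sq_eq_sq_iff_eq_or_eq_neg.1 this with hx | hx <;> rcases hh with hh | hh <;> simp [hz0, hx, hh]
    have hx2 : x ^ 2 = (x * h) ^ 2 := by linear_combination (-x ^ 2) * hh2
    rcases mul_eq_zero.1 hf with hf | hf
    · have hy : x * h = 1 / a := by field_simp; linarith
      have hzz : z = (a - 1) / a ^ 2 := by
        rw [hz, hx2, hy, key1]; field_simp; ring
      rw [hy] at hxx
      rcases hh with rfl | rfl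
      · left; exact ⟨hzz, by linarith, rfl⟩
      · right; left; exact ⟨hzz, by linarith, rfl⟩
    · have hy : x * h = -(1 / b) := by field_simp; linarith
      have hzz : z = -((b - 1) / b ^ 2) := by
        rw [hz, hx2, hy, neg_sq, key2]; field_simp; ring
      rw [hy] at hxx
      rcases hh with rfl | rfl
      · right; right; left; exact ⟨hzz, by linarith, rfl⟩
      · right; right; right; left; exact ⟨hzz, by linarith, rfl⟩
  · rintro (⟨rfl, rfl, rfl⟩ | ⟨rfl, rfl, rfl⟩ | ⟨rfl, rfl, rfl⟩ | ⟨rfl, rfl, rfl⟩ | ⟨rfl, rfl, rfl⟩ |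
      ⟨rfl, rfl, rfl⟩ | ⟨rfl, rfl, rfl⟩ | ⟨rfl, rfl, rfl⟩ | ⟨rfl, rfl, rfl⟩ | ⟨rfl, rfl, rfl⟩)
    all_goals try simp only [neg_sq, add_sub_assoc, key1, key2, hr]
    all_goals refine ⟨?_, ?_, ?_⟩
    all_goals first
      | (simp; done)
      | (field_simp; done)
      | (field_simp; ring)
end

section
/- Let J be the Jacobian matrix (total derivative) of the vector field defining the Einstein ODE in (Z, Δ, H)-coordinates at the fixed point p1+ = ((d1−1)/d1², 1/d1, 1). Then J has eigenvalue 2/d1 with the two linearly independent eigenvectors (1 + (d1−d2)/(d1·n), 1, 0) and ((d1−1)/d1², 0, 1), and eigenvalue −(d1−1)/d1 with eigenvector (−(2/n)·(d2/d1), 1, 0). -/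
/-- The Jacobian `J` (total derivative) of the vector field of the
Einstein ODE in (Z, Δ, H)-coordinates at the fixed point
`p1+ = ((d1−1)/d1², 1/d1, 1)` has eigenvalue `2/d1` with the two linearly
independent eigenvectors `(1 + (d1−d2)/(d1·n), 1, 0)` and `((d1−1)/d1², 0, 1)`,
and eigenvalue `−(d1−1)/d1` with eigenvector `(−(2/n)·(d2/d1), 1, 0)`. -/
theorem stmt6 (d1 d2 : ℕ) (hd1 : 2 ≤ d1) (hd2 : 2 ≤ d2) (n : ℕ) (hn : n = d1 + d2)
    (W : ℝ × ℝ × ℝ → ℝ × ℝ × ℝ)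
    (hW : ∀ p : ℝ × ℝ × ℝ,
      W p = ((2 / n) * p.2.1 * ((d1 : ℝ) * d2 * p.1 * p.2.1 * p.2.2
               + ((d1 : ℝ) * d2 / n) * p.2.1 ^ 2 - ((n : ℝ) - 1) / n
               + ((d1 : ℝ) - (d2 : ℝ)) * p.1),
             p.2.1 * p.2.2 * (((d1 : ℝ) * d2 / n) * p.2.1 ^ 2 - ((n : ℝ) - 1) / n) + p.1,
             -((1 - p.2.2 ^ 2) / n) * ((d1 : ℝ) * d2 * p.2.1 ^ 2 + 1)))
    (J : ℝ × ℝ × ℝ →L[ℝ] ℝ × ℝ × ℝ)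
    (hJ : HasFDerivAt W J ((((d1 : ℝ) - 1) / d1 ^ 2, 1 / (d1 : ℝ), (1 : ℝ)))) :
    J ((1 + ((d1 : ℝ) - (d2 : ℝ)) / ((d1 : ℝ) * n), 1, 0))
      = ((2 : ℝ) / d1) • ((1 + ((d1 : ℝ) - (d2 : ℝ)) / ((d1 : ℝ) * n), 1, 0)) ∧
    J ((((d1 : ℝ) - 1) / d1 ^ 2, 0, 1))
      = ((2 : ℝ) / d1) • ((((d1 : ℝ) - 1) / d1 ^ 2, 0, 1)) ∧
    J ((-(2 / (n : ℝ)) * ((d2 : ℝ) / d1), 1, 0))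
      = (-(((d1 : ℝ) - 1) / d1)) • ((-(2 / (n : ℝ)) * ((d2 : ℝ) / d1), 1, 0)) ∧
    LinearIndependent ℝ
      ![((1 + ((d1 : ℝ) - (d2 : ℝ)) / ((d1 : ℝ) * n), 1, 0) : ℝ × ℝ × ℝ),
        ((((d1 : ℝ) - 1) / d1 ^ 2, 0, 1) : ℝ × ℝ × ℝ)] := by
  have hx : (d1 : ℝ) ≠ 0 := by positivity
  have hy : (n : ℝ) = d1 + d2 := by rw [hn]; push_cast; ring
  have hs : (d1 : ℝ) + d2 ≠ 0 := by positivity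
  have key : ∀ a b c : ℝ, J (a, b, c) =
      ((2 / n) * a + (2 / (n * d1)) * (d2 * (d1 - 1) / d1 + 2 * d2 / n) * b
          + (2 / (n * d1)) * (d2 * (d1 - 1) / d1 ^ 2) * c,
        a + ((1 - d1) / d1 + 2 * d2 / (n * d1)) * b + (1 - d1) / d1 ^ 2 * c,
        (2 / d1) * c) := by
    intro a b c
    have e1 : HasFDerivAt (fun p : ℝ × ℝ × ℝ => p.1) (ContinuousLinearMap.fst ℝ ℝ (ℝ × ℝ))
      ((((d1 : ℝ) - 1) / d1 ^ 2, 1 / (d1 : ℝ), (1 : ℝ))) := hasFDerivAt_fst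
    have e2 : HasFDerivAt (fun p : ℝ × ℝ × ℝ => p.2.1)
      ((ContinuousLinearMap.fst ℝ ℝ ℝ).comp (ContinuousLinearMap.snd ℝ ℝ (ℝ × ℝ)))
      ((((d1 : ℝ) - 1) / d1 ^ 2, 1 / (d1 : ℝ), (1 : ℝ))) := hasFDerivAt_snd.fst
    have e3 : HasFDerivAt (fun p : ℝ × ℝ × ℝ => p.2.2)
      ((ContinuousLinearMap.snd ℝ ℝ ℝ).comp (ContinuousLinearMap.snd ℝ ℝ (ℝ × ℝ)))
      ((((d1 : ℝ) - 1) / d1 ^ 2, 1 / (d1 : ℝ), (1 : ℝ))) := hasFDerivAt_snd.snd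
    have f1 := (e2.const_mul (2 / (n : ℝ))).mul ((((((e1.const_mul ((d1 : ℝ) * d2)).mul e2).mul e3).add
      ((e2.pow 2).const_mul ((d1 : ℝ) * d2 / n))).sub_const (((n : ℝ) - 1) / n)).add
      (e1.const_mul ((d1 : ℝ) - (d2 : ℝ))))
    have f2 := ((e2.mul e3).mul (((e2.pow 2).const_mul ((d1 : ℝ) * d2 / n)).sub_const
      (((n : ℝ) - 1) / n))).add e1
    have f3 := ((((e3.pow 2).const_sub 1).mul_const ((n : ℝ)⁻¹)).neg).mul
      (((e2.pow 2).const_mul ((d1 : ℝ) * d2)).add_const 1)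
    have F := f1.prodMk (f2.prodMk f3)
    have hF : J = _ := hJ.unique (F.congr_of_eventuallyEq (Filter.Eventually.of_forall fun p => by
      rw [hW p]; simp [div_eq_mul_inv]))
    rw [hF]
    ext <;> simp <;> rw [hy] <;> field_simp <;> ring
  refine ⟨?_, ?_, ?_, ?_⟩
  · rw [key]; ext <;> simp <;> (try rw [hy]) <;> field_simp <;> ring
  · rw [key]; ext <;> simp <;> (try rw [hy]) <;> field_simp <;> ring
  · rw [key]; ext <;> simp <;> (try rw [hy]) <;> field_simp <;> ring
  · rw [LinearIndependent.pair_iff]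
    intro s t h
    simp only [Prod.smul_mk, Prod.mk_add_mk, Prod.mk_eq_zero, smul_eq_mul] at h
    obtain ⟨-, h1, h2⟩ := h
    constructor <;> linarith
end

section
/- The following curves ℝ → ℝ³ are solutions of the Einstein ODE in (Z, Δ, H)-coordinates: (i) the cone solution s ↦ (0, 0, −tanh(s/n)); (ii) the singular solutions s ↦ (0, −√((n−1)/(d1·d2)), −tanh(s)) and s ↦ (0, √((n−1)/(d1·d2)), −tanh(s)). -/
theorem tanh_deriv_aux (s : ℝ) : HasDerivAt Real.tanh (1 - Real.tanh s ^ 2) s := by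
  have hc : Real.cosh s ≠ 0 := (Real.cosh_pos s).ne'
  have h := (Real.hasDerivAt_sinh s).div (Real.hasDerivAt_cosh s) hc
  have e : Real.tanh = Real.sinh / Real.cosh := by
    funext x
    simp [Real.tanh_eq_sinh_div_cosh]
  rw [← e] at h
  have e2 : 1 - Real.tanh s ^ 2 =
      (Real.cosh s * Real.cosh s - Real.sinh s * Real.sinh s) / Real.cosh s ^ 2 := by
    rw [Real.tanh_eq_sinh_div_cosh]
    field_simp
  rw [e2]
  exact h

/-- The cone solution `s ↦ (0, 0, −tanh(s/n))` and the two singular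
solutions `s ↦ (0, ∓√((n−1)/(d1·d2)), −tanh s)` solve the Einstein ODE in
(Z, Δ, H)-coordinates.  A point `p : ℝ × ℝ × ℝ` encodes `(Z, Δ, H)`. -/
theorem stmt7 (d1 d2 : ℕ) (hd1 : 2 ≤ d1) (hd2 : 2 ≤ d2) (n : ℕ) (hn : n = d1 + d2)
    (W : ℝ × ℝ × ℝ → ℝ × ℝ × ℝ)
    (hW : ∀ p : ℝ × ℝ × ℝ,
      W p = ((2 / n) * p.2.1 * ((d1 : ℝ) * d2 * p.1 * p.2.1 * p.2.2
               + ((d1 : ℝ) * d2 / n) * p.2.1 ^ 2 - ((n : ℝ) - 1) / n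
               + ((d1 : ℝ) - (d2 : ℝ)) * p.1),
             p.2.1 * p.2.2 * (((d1 : ℝ) * d2 / n) * p.2.1 ^ 2 - ((n : ℝ) - 1) / n) + p.1,
             -((1 - p.2.2 ^ 2) / n) * ((d1 : ℝ) * d2 * p.2.1 ^ 2 + 1))) :
    (∀ s : ℝ, HasDerivAt (fun t : ℝ => ((0 : ℝ), (0 : ℝ), -Real.tanh (t / n)))
      (W ((0 : ℝ), (0 : ℝ), -Real.tanh (s / n))) s) ∧
    (∀ s : ℝ, HasDerivAt
      (fun t : ℝ => ((0 : ℝ), -Real.sqrt (((n : ℝ) - 1) / ((d1 : ℝ) * d2)), -Real.tanh t))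
      (W ((0 : ℝ), -Real.sqrt (((n : ℝ) - 1) / ((d1 : ℝ) * d2)), -Real.tanh s)) s) ∧
    (∀ s : ℝ, HasDerivAt
      (fun t : ℝ => ((0 : ℝ), Real.sqrt (((n : ℝ) - 1) / ((d1 : ℝ) * d2)), -Real.tanh t))
      (W ((0 : ℝ), Real.sqrt (((n : ℝ) - 1) / ((d1 : ℝ) * d2)), -Real.tanh s)) s) := by
  have hn0 : (n : ℝ) ≠ 0 := by
    have : n ≠ 0 := by omega
    exact_mod_cast this
  have hn1 : (1 : ℝ) ≤ n := by
    have : 1 ≤ n := by omega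
    exact_mod_cast this
  have h1 : (d1 : ℝ) ≠ 0 := by
    have : d1 ≠ 0 := by omega
    exact_mod_cast this
  have h2 : (d2 : ℝ) ≠ 0 := by
    have : d2 ≠ 0 := by omega
    exact_mod_cast this
  have key : ∀ c : ℝ, (d1 : ℝ) * d2 * c ^ 2 = n - 1 → ∀ s : ℝ,
      HasDerivAt (fun t : ℝ => ((0 : ℝ), c, -Real.tanh t)) (W ((0 : ℝ), c, -Real.tanh s)) s := by
    intro c hc s
    have h := (hasDerivAt_const s (0 : ℝ)).prodMk
      ((hasDerivAt_const s c).prodMk (tanh_deriv_aux s).neg)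
    have hc' : (d1 : ℝ) * d2 / n * c ^ 2 = (n - 1) / n := by
      rw [← hc]; ring
    have e : W ((0 : ℝ), c, -Real.tanh s) = (0, 0, -(1 - Real.tanh s ^ 2)) := by
      rw [hW]
      simp only [hc, hc']
      refine Prod.ext ?_ (Prod.ext ?_ ?_)
      · simp
      · simp
      · simp only
        field_simp
        ring
    rw [e]
    exact h
  have hs : (d1 : ℝ) * d2 * Real.sqrt (((n : ℝ) - 1) / ((d1 : ℝ) * d2)) ^ 2 = n - 1 := by
    rw [Real.sq_sqrt (div_nonneg (by linarith) (by positivity))]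
    field_simp
  refine ⟨fun s => ?_, key _ (by rw [neg_sq]; exact hs), key _ hs⟩
  have ht := ((tanh_deriv_aux (s / n)).comp s ((hasDerivAt_id s).div_const (n : ℝ))).neg
  have h := (hasDerivAt_const s (0 : ℝ)).prodMk ((hasDerivAt_const s (0 : ℝ)).prodMk ht)
  have e : W ((0 : ℝ), (0 : ℝ), -Real.tanh (s / n)) =
      (0, 0, -((1 - Real.tanh (s / n) ^ 2) * (1 / n))) := by
    rw [hW]
    refine Prod.ext ?_ (Prod.ext ?_ ?_)
    · simp
    · simp
    · simp only
      ring
  rw [e]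
  exact h
end

section
/- Every point of S satisfies d1·d2·Δ² ≤ n − 1. Moreover, along any solution (Z, Δ, H) of the Einstein ODE in (Z, Δ, H)-coordinates taking values in S, the following hold at any time s0: (i) if Δ(s0) = 0 then Z'(s0) = 0 and Δ'(s0) = Z(s0); (ii) if Z(s0) = 0, Δ(s0) ≠ 0 and d1·d2·Δ(s0)² < n − 1, then Z'(s0)·Δ(s0) < 0. (These sign conditions express that solutions cross the coordinate axes of the (Z, Δ)-plane only counterclockwise around the origin.) -/
/-- Every point of `S` satisfies `d1·d2·Δ² ≤ n − 1`; and along any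
solution of the Einstein ODE in (Z, Δ, H)-coordinates with values in `S`:
(i) if `Δ(s0) = 0` then `Z'(s0) = 0` and `Δ'(s0) = Z(s0)`;
(ii) if `Z(s0) = 0`, `Δ(s0) ≠ 0` and `d1·d2·Δ(s0)² < n − 1` then `Z'(s0)·Δ(s0) < 0`.
A point `p : ℝ × ℝ × ℝ` encodes `(Z, Δ, H) = (p.1, p.2.1, p.2.2)`. -/
theorem stmt8 (d1 d2 : ℕ) (hd1 : 2 ≤ d1) (hd2 : 2 ≤ d2) (n : ℕ) (hn : n = d1 + d2)
    (W : ℝ × ℝ × ℝ → ℝ × ℝ × ℝ)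
    (hW : ∀ p : ℝ × ℝ × ℝ,
      W p = ((2 / n) * p.2.1 * ((d1 : ℝ) * d2 * p.1 * p.2.1 * p.2.2
               + ((d1 : ℝ) * d2 / n) * p.2.1 ^ 2 - ((n : ℝ) - 1) / n
               + ((d1 : ℝ) - (d2 : ℝ)) * p.1),
             p.2.1 * p.2.2 * (((d1 : ℝ) * d2 / n) * p.2.1 ^ 2 - ((n : ℝ) - 1) / n) + p.1,
             -((1 - p.2.2 ^ 2) / n) * ((d1 : ℝ) * d2 * p.2.1 ^ 2 + 1)))
    (S : Set (ℝ × ℝ × ℝ))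
    (hS : S = {p : ℝ × ℝ × ℝ |
      (d1 : ℝ) * p.1 + ((d1 : ℝ) * d2 / n) * p.2.1 ^ 2 ≤ ((n : ℝ) - 1) / n ∧
      -(d2 : ℝ) * p.1 + ((d1 : ℝ) * d2 / n) * p.2.1 ^ 2 ≤ ((n : ℝ) - 1) / n ∧
      p.2.2 ^ 2 ≤ 1}) :
    (∀ p ∈ S, (d1 : ℝ) * d2 * p.2.1 ^ 2 ≤ (n : ℝ) - 1) ∧
    (∀ J : Set ℝ, ∀ γ : ℝ → ℝ × ℝ × ℝ,
      (∀ s ∈ J, HasDerivAt γ (W (γ s)) s) → (∀ s ∈ J, γ s ∈ S) → ∀ s0 ∈ J,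
      ((γ s0).2.1 = 0 →
        HasDerivAt (fun s => (γ s).1) 0 s0 ∧
        HasDerivAt (fun s => (γ s).2.1) ((γ s0).1) s0) ∧
      ((γ s0).1 = 0 → (γ s0).2.1 ≠ 0 → (d1 : ℝ) * d2 * (γ s0).2.1 ^ 2 < (n : ℝ) - 1 →
        ∃ dZ : ℝ, HasDerivAt (fun s => (γ s).1) dZ s0 ∧ dZ * (γ s0).2.1 < 0)) := by
  have hnpos : (0 : ℝ) < n := by
    have : 0 < n := by omega
    exact_mod_cast this
  refine ⟨?_, ?_⟩
  · intro p hp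
    rw [hS] at hp
    obtain ⟨h1, h2, -⟩ := hp
    have hd1' : (0 : ℝ) ≤ d1 := Nat.cast_nonneg _
    have hd2' : (0 : ℝ) ≤ d2 := Nat.cast_nonneg _
    have key : ((d1 : ℝ) * d2 / n) * p.2.1 ^ 2 ≤ ((n : ℝ) - 1) / n := by
      rcases le_total 0 p.1 with h | h
      · nlinarith [mul_nonneg hd1' h]
      · nlinarith [mul_nonneg hd2' (neg_nonneg.mpr h)]
    rw [div_mul_eq_mul_div] at key
    exact (div_le_div_iff_of_pos_right hnpos).mp key
  · intro J γ hγ _ s0 hs0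
    have hd := hγ s0 hs0
    have hZ : HasDerivAt (fun s => (γ s).1) (W (γ s0)).1 s0 := hd.fst
    have hD : HasDerivAt (fun s => (γ s).2.1) (W (γ s0)).2.1 s0 := hd.snd.fst
    rw [hW] at hZ hD
    refine ⟨?_, ?_⟩
    · intro h0
      refine ⟨?_, ?_⟩
      · simpa [h0] using hZ
      · simpa [h0] using hD
    · intro hz hne hlt
      refine ⟨_, hZ, ?_⟩
      have hsq : 0 < (γ s0).2.1 ^ 2 := by positivity
      have hq : ((d1 : ℝ) * d2 * (γ s0).2.1 ^ 2 - ((n : ℝ) - 1)) / n < 0 :=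
        div_neg_of_neg_of_pos (by linarith) hnpos
      have h2 : (0 : ℝ) < 2 / n * (γ s0).2.1 ^ 2 := by positivity
      have := mul_neg_of_pos_of_neg h2 hq
      simp only [hz]
      calc _ = _ := by ring
        _ < 0 := this
end

section
/- Define F(Z, Δ) = ((n−1)/n − (d1·d2/n)·Δ² + d2·Z)^(d1) · ((n−1)/n − (d1·d2/n)·Δ² − d1·Z)^(d2). Along any solution (Z, Δ, H) of the Einstein ODE in (Z, Δ, H)-coordinates, the function s ↦ F(Z(s), Δ(s)) satisfies (F ∘ (Z, Δ))'(s) = 2·d1·d2·Δ(s)²·H(s)·F(Z(s), Δ(s)). In particular, F(Z(s), Δ(s)) is non-decreasing on every interval on which H ≥ 0 and F ≥ 0. -/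
/-- Along any solution `(Z, D, H)` of the Einstein ODE in
(Z, Δ, H)-coordinates (here `D` denotes `Δ`), the function
`F(Z, Δ) = ((n−1)/n − (d1·d2/n)·Δ² + d2·Z)^d1 · ((n−1)/n − (d1·d2/n)·Δ² − d1·Z)^d2`
satisfies `(F ∘ (Z, Δ))' = 2·d1·d2·Δ²·H·F`; in particular `F(Z, Δ)` is
non-decreasing on every subinterval on which `H ≥ 0` and `F ≥ 0`. -/
theorem stmt9 (d1 d2 : ℕ) (hd1 : 2 ≤ d1) (hd2 : 2 ≤ d2) (n : ℕ) (hn : n = d1 + d2)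
    (F : ℝ → ℝ → ℝ)
    (hF : ∀ z δ : ℝ, F z δ =
      (((n : ℝ) - 1) / n - ((d1 : ℝ) * d2 / n) * δ ^ 2 + (d2 : ℝ) * z) ^ d1 *
      (((n : ℝ) - 1) / n - ((d1 : ℝ) * d2 / n) * δ ^ 2 - (d1 : ℝ) * z) ^ d2)
    (J : Set ℝ) (hJ : J.OrdConnected)
    (Z D H : ℝ → ℝ)
    (hZ : ∀ s ∈ J, HasDerivAt Z ((2 / n) * D s * ((d1 : ℝ) * d2 * Z s * D s * H s
      + ((d1 : ℝ) * d2 / n) * (D s) ^ 2 - ((n : ℝ) - 1) / n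
      + ((d1 : ℝ) - (d2 : ℝ)) * Z s)) s)
    (hD : ∀ s ∈ J, HasDerivAt D (D s * H s * (((d1 : ℝ) * d2 / n) * (D s) ^ 2
      - ((n : ℝ) - 1) / n) + Z s) s)
    (hH : ∀ s ∈ J, HasDerivAt H (-((1 - (H s) ^ 2) / n)
      * ((d1 : ℝ) * d2 * (D s) ^ 2 + 1)) s) :
    (∀ s ∈ J, HasDerivAt (fun u => F (Z u) (D u))
      (2 * (d1 : ℝ) * d2 * (D s) ^ 2 * H s * F (Z s) (D s)) s) ∧
    (∀ s ∈ J, ∀ t ∈ J, s ≤ t →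
      (∀ u ∈ Set.Icc s t, 0 ≤ H u ∧ 0 ≤ F (Z u) (D u)) →
      F (Z s) (D s) ≤ F (Z t) (D t)) := by
  have hn0 : (n : ℝ) ≠ 0 := by
    have : n ≠ 0 := by omega
    exact_mod_cast this
  have hnR : (n : ℝ) = d1 + d2 := by rw [hn]; push_cast; ring
  have key : ∀ s ∈ J, HasDerivAt (fun u => F (Z u) (D u))
      (2 * (d1 : ℝ) * d2 * (D s) ^ 2 * H s * F (Z s) (D s)) s := by
    intro s hs
    have hW : HasDerivAt (fun u => ((n : ℝ) - 1) / n - ((d1 : ℝ) * d2 / n) * (D u) ^ 2)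
        _ s := (((hD s hs).pow 2).const_mul ((d1 : ℝ) * d2 / n)).const_sub (((n : ℝ) - 1) / n)
    have hA : HasDerivAt (fun u => ((n : ℝ) - 1) / n - ((d1 : ℝ) * d2 / n) * (D u) ^ 2
        + (d2 : ℝ) * Z u)
        ((2 * (d1 * d2 / n) * (D s) ^ 2 * H s - 2 * d2 / n * D s) *
          (((n : ℝ) - 1) / n - ((d1 : ℝ) * d2 / n) * (D s) ^ 2 + (d2 : ℝ) * Z s)) s := by
      refine (hW.add ((hZ s hs).const_mul (d2 : ℝ))).congr_deriv ?_
      generalize ((n : ℝ) - 1) / n = c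
      field_simp
      push_cast
      ring
    have hB : HasDerivAt (fun u => ((n : ℝ) - 1) / n - ((d1 : ℝ) * d2 / n) * (D u) ^ 2
        - (d1 : ℝ) * Z u)
        ((2 * (d1 * d2 / n) * (D s) ^ 2 * H s + 2 * d1 / n * D s) *
          (((n : ℝ) - 1) / n - ((d1 : ℝ) * d2 / n) * (D s) ^ 2 - (d1 : ℝ) * Z s)) s := by
      refine (hW.sub ((hZ s hs).const_mul (d1 : ℝ))).congr_deriv ?_
      generalize ((n : ℝ) - 1) / n = c
      field_simp
      push_cast
      ring
    have hfun : (fun u => F (Z u) (D u)) = fun u =>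
      (((n : ℝ) - 1) / n - ((d1 : ℝ) * d2 / n) * (D u) ^ 2 + (d2 : ℝ) * Z u) ^ d1 *
      (((n : ℝ) - 1) / n - ((d1 : ℝ) * d2 / n) * (D u) ^ 2 - (d1 : ℝ) * Z u) ^ d2 := by
      funext u; exact hF _ _
    rw [hfun, hF]
    refine ((hA.pow d1).mul (hB.pow d2)).congr_deriv ?_
    simp only [Pi.pow_apply]
    generalize ((n : ℝ) - 1) / n - ((d1 : ℝ) * d2 / n) * (D s) ^ 2 + (d2 : ℝ) * Z s = A
    generalize ((n : ℝ) - 1) / n - ((d1 : ℝ) * d2 / n) * (D s) ^ 2 - (d1 : ℝ) * Z s = B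
    have e1 : A ^ d1 = A ^ (d1 - 1) * A := by
      rw [← pow_succ]; congr 1; omega
    have e2 : B ^ d2 = B ^ (d2 - 1) * B := by
      rw [← pow_succ]; congr 1; omega
    rw [e1, e2]
    generalize A ^ (d1 - 1) = P
    generalize B ^ (d2 - 1) = Q
    field_simp
    rw [hnR]
    ring
  refine ⟨key, ?_⟩
  intro s hs t ht hst hpos
  have hsub : Set.Icc s t ⊆ J := hJ.out hs ht
  have hmono : MonotoneOn (fun u => F (Z u) (D u)) (Set.Icc s t) := by
    refine monotoneOn_of_deriv_nonneg (convex_Icc s t)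
      (fun u hu => (key u (hsub hu)).continuousAt.continuousWithinAt)
      (fun u hu => (key u (hsub (interior_subset hu))).differentiableAt.differentiableWithinAt)
      (fun u hu => ?_)
    have hu' := interior_subset hu
    rw [(key u (hsub hu')).deriv]
    obtain ⟨h1, h2⟩ := hpos u hu'
    positivity
  exact hmono (Set.left_mem_Icc.2 hst) (Set.right_mem_Icc.2 hst) hst
end

section
/- Every maximal solution of the H = 1 subsystem with initial value in the interior of S₁ remains in the interior of S₁, is defined for all forward time, and converges to the origin (0, 0) as s → +∞. -/
lemma aux_cd {f g : ℝ → ℝ} {u v x : ℝ} (h : HasDerivAt f u x) (hfg : f = g) (huv : u = v) :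
    HasDerivAt g v x := by
  subst hfg; subst huv; exact h

open Set Filter Topology in
lemma aux_pos (P k : ℝ → ℝ) (s0 s1 : ℝ) (h : s0 ≤ s1) (hk : ContinuousOn k (Icc s0 s1))
    (hP : ∀ s ∈ Icc s0 s1, HasDerivAt P (k s * P s) s) (h0 : 0 < P s0) : 0 < P s1 := by
  set kt : ℝ → ℝ := IccExtend h ((Icc s0 s1).domRestrict k) with hkt
  have hc : Continuous kt := (continuousOn_iff_continuous_domRestrict.1 hk).Icc_extend'
  have he : ∀ s ∈ Icc s0 s1, kt s = k s := fun s hs => by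
    rw [hkt, IccExtend_of_mem h _ hs]; rfl
  have hK : ∀ s, HasDerivAt (fun u => ∫ x in s0..u, kt x) (kt s) s := fun s =>
    intervalIntegral.integral_hasDerivAt_right (hc.intervalIntegrable _ _)
      hc.aestronglyMeasurable.stronglyMeasurableAtFilter hc.continuousAt
  set G : ℝ → ℝ := fun s => P s * Real.exp (-(∫ x in s0..s, kt x)) with hG
  have hGd : ∀ s ∈ Icc s0 s1, HasDerivAt G 0 s := by
    intro s hs
    have := (hP s hs).mul ((hK s).neg.exp)
    refine aux_cd this rfl ?_
    simp only [Pi.neg_apply]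
    rw [he s hs]; ring
  have hconst := constant_of_has_deriv_right_zero (f := G) (a := s0) (b := s1)
    (fun s hs => (hGd s hs).continuousAt.continuousWithinAt)
    (fun s hs => (hGd s ⟨hs.1, hs.2.le⟩).hasDerivWithinAt) s1 ⟨h, le_rfl⟩
  have h3 : 0 < G s1 := by
    rw [hconst, hG]; positivity
  exact pos_of_mul_pos_left h3 (Real.exp_pos _).le

open Set Filter Topology in
lemma aux_barbalat (F g g' : ℝ → ℝ) (s0 K l : ℝ) (hF : ∀ s, s0 ≤ s → HasDerivAt F (g s) s)
    (hg : ∀ s, s0 ≤ s → HasDerivAt g (g' s) s) (hK : ∀ s, s0 ≤ s → |g' s| ≤ K)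
    (hl : Tendsto F atTop (𝓝 l)) : Tendsto g atTop (𝓝 0) := by
  have hK0 : 0 ≤ K := (abs_nonneg _).trans (hK s0 le_rfl)
  rw [Metric.tendsto_atTop]
  intro ε hε
  set h : ℝ := ε / (2 * (K + 1)) with hh
  have hpos : 0 < h := by positivity
  have hKh : K * h < ε / 2 := by
    have : (K + 1) * h = ε / 2 := by rw [hh]; field_simp
    nlinarith
  rw [Metric.tendsto_atTop] at hl
  obtain ⟨N, hN⟩ := hl (h * ε / 4) (by positivity)
  refine ⟨max N s0, fun s hs => ?_⟩
  have hs1 : N ≤ s := (le_max_left _ _).trans hs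
  have hs2 : s0 ≤ s := (le_max_right _ _).trans hs
  obtain ⟨c, hc, hce⟩ := exists_hasDerivAt_eq_slope F g (show s < s + h by linarith)
    (fun x hx => (hF x (hs2.trans hx.1)).continuousAt.continuousWithinAt)
    (fun x hx => hF x (hs2.trans hx.1.le))
  obtain ⟨e, he, hee⟩ := exists_hasDerivAt_eq_slope g g' hc.1
    (fun x hx => (hg x (hs2.trans hx.1)).continuousAt.continuousWithinAt)
    (fun x hx => hg x (hs2.trans hx.1.le))
  have a1 := hN s hs1
  have a2 := hN (s + h) (by linarith)
  rw [Real.dist_eq, abs_lt] at a1 a2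
  have a3 := hK e (hs2.trans he.1.le)
  have hcs : 0 < c - s := sub_pos.2 hc.1
  have b1 : g c * h = F (s + h) - F s := by rw [hce, add_sub_cancel_left]; field_simp
  have b2 : g' e * (c - s) = g c - g s := by rw [hee]; field_simp
  have b3 : |g c - g s| ≤ K * h := by
    rw [← b2, abs_mul, abs_of_pos hcs]
    exact mul_le_mul a3 (by linarith [hc.2]) hcs.le hK0
  have b4 : |g c| < ε / 2 := by
    rw [abs_lt]; constructor
    · by_contra hh
      push Not at hh
      nlinarith
    · by_contra hh
      push Not at hh
      nlinarith
  rw [Real.dist_eq, sub_zero]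
  have := abs_sub_abs_le_abs_sub (g s) (g c)
  rw [abs_sub_comm] at this
  linarith

open Set Filter Topology in
lemma aux_global {E : Type*} [NormedAddCommGroup E] [NormedSpace ℝ E] [CompleteSpace E]
    (W : E → E) (K L : NNReal) (hW : LipschitzWith K W) (hL : ∀ x, ‖W x‖ ≤ L) (p : E) :
    ∃ γ : ℝ → E, γ 0 = p ∧ ∀ s, HasDerivAt γ (W (γ s)) s := by
  have hloc : ∀ N : ℕ, ∃ α : ℝ → E, α 0 = p ∧
      ∀ t ∈ Ioo (-(N + 1 : ℝ)) (N + 1), HasDerivAt α (W (α t)) t := by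
    intro N
    have h0 : (0 : ℝ) ∈ Icc (-(N + 1 : ℝ)) (N + 1) := by constructor <;> linarith [N.cast_nonneg (α := ℝ)]
    have hPL : IsPicardLindelof (fun _ => W) (tmin := -(N + 1 : ℝ)) (tmax := N + 1) ⟨0, h0⟩ p
        (L * (N + 1)) 0 L K :=
      { lipschitzOnWith := fun _ _ => hW.lipschitzOnWith
        continuousOn := fun _ _ => continuousOn_const
        norm_le := fun _ _ x _ => hL x
        mul_max_le := by simp }
    obtain ⟨α, h1, h2⟩ := hPL.exists_eq_forall_mem_Icc_hasDerivWithinAt₀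
    exact ⟨α, h1, fun t ht => (h2 t ⟨ht.1.le, ht.2.le⟩).hasDerivAt (Icc_mem_nhds ht.1 ht.2)⟩
  choose α h1 h2 using hloc
  have hagree : ∀ M N : ℕ, M ≤ N → EqOn (α M) (α N) (Ioo (-(M + 1 : ℝ)) (M + 1)) := by
    intro M N hMN
    have hMN' : (M : ℝ) ≤ N := by exact_mod_cast hMN
    have hM : (0 : ℝ) ≤ M := M.cast_nonneg
    refine ODE_solution_unique_of_mem_Ioo (v := fun _ => W) (s := fun _ => univ) (K := K) (t₀ := 0)
      (fun _ _ => hW.lipschitzOnWith) ⟨by linarith, by linarith⟩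
      (fun t ht => ⟨h2 M t ht, trivial⟩)
      (fun t ht => ⟨h2 N t ⟨by linarith [ht.1], by linarith [ht.2]⟩, trivial⟩) (by rw [h1, h1])
  refine ⟨fun t => α ⌈|t|⌉₊ t, by simp [h1], fun s => ?_⟩
  have key : ∀ N : ℕ, ∀ t : ℝ, |t| < N → α ⌈|t|⌉₊ t = α N t := by
    intro N t ht
    refine hagree _ N (Nat.ceil_le.2 ht.le) ?_
    have := abs_lt.1 (lt_of_le_of_lt (Nat.le_ceil |t|) (lt_add_one _))
    exact this
  obtain ⟨N, hN⟩ := exists_nat_gt |s|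
  have hev : (fun t => α ⌈|t|⌉₊ t) =ᶠ[𝓝 s] α N := by
    filter_upwards [continuous_abs.continuousAt.eventually (gt_mem_nhds hN)] with t ht
    exact key N t ht
  have hs := abs_lt.1 hN
  have := (h2 N s ⟨by linarith [hs.1], by linarith [hs.2]⟩).congr_of_eventuallyEq hev
  simpa only [key N s hN] using this

open Set Filter Topology in
lemma aux_inv (a b n : ℝ) (ha : 2 ≤ a) (hb : 2 ≤ b) (hn : n = a + b) (Z D χ : ℝ → ℝ) (s0 s1 : ℝ)
    (h : s0 ≤ s1) (hχ : ContinuousOn χ (Icc s0 s1))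
    (hZ : ∀ s ∈ Icc s0 s1, HasDerivAt Z (χ s * ((2 / n) * D s * (a * b * Z s * D s
               + (a * b / n) * D s ^ 2 - (n - 1) / n + (a - b) * Z s))) s)
    (hD : ∀ s ∈ Icc s0 s1, HasDerivAt D (χ s * (D s * ((a * b / n) * D s ^ 2 - (n - 1) / n) + Z s)) s)
    (h1 : a * Z s0 + (a * b / n) * D s0 ^ 2 < (n - 1) / n)
    (h2 : -b * Z s0 + (a * b / n) * D s0 ^ 2 < (n - 1) / n) :
    a * Z s1 + (a * b / n) * D s1 ^ 2 < (n - 1) / n ∧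
    -b * Z s1 + (a * b / n) * D s1 ^ 2 < (n - 1) / n := by
  have hn0 : n ≠ 0 := by rw [hn]; positivity
  have hDc : ContinuousOn D (Icc s0 s1) := fun s hs => (hD s hs).continuousAt.continuousWithinAt
  constructor
  · have := aux_pos (fun s => (n - 1) / n - (a * Z s + (a * b / n) * D s ^ 2))
      (fun s => χ s * (2 * (a * b / n) * D s ^ 2 + (2 * a / n) * D s)) s0 s1 h (by fun_prop)
      (fun s hs => by
        have := (((hZ s hs).const_mul a).add (((hD s hs).pow 2).const_mul (a * b / n))).const_sub
          ((n - 1) / n)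
        refine aux_cd this rfl ?_
        simp only [Nat.cast_ofNat, Nat.add_one_sub_one, pow_one]
        subst hn
        field_simp
        ring) (by simpa using h1)
    simpa using this
  · have := aux_pos (fun s => (n - 1) / n - (-b * Z s + (a * b / n) * D s ^ 2))
      (fun s => χ s * (2 * (a * b / n) * D s ^ 2 - (2 * b / n) * D s)) s0 s1 h (by fun_prop)
      (fun s hs => by
        have := (((hZ s hs).const_mul (-b)).add (((hD s hs).pow 2).const_mul (a * b / n))).const_sub
          ((n - 1) / n)
        refine aux_cd this rfl ?_
        simp only [Nat.cast_ofNat, Nat.add_one_sub_one, pow_one]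
        subst hn
        field_simp
        ring) (by simpa using h2)
    simpa using this

lemma aux_bound_s10 (a b n : ℝ) (ha : 2 ≤ a) (hb : 2 ≤ b) (hn : n = a + b) (z d : ℝ)
    (h1 : a * z + (a * b / n) * d ^ 2 < (n - 1) / n)
    (h2 : -b * z + (a * b / n) * d ^ 2 < (n - 1) / n) : |z| ≤ 1 ∧ |d| ≤ 1 := by
  have hn0 : 0 < n := by linarith
  have hm : (n - 1) / n < 1 := by rw [div_lt_one hn0]; linarith
  have hc : 1 ≤ a * b / n := by rw [le_div_iff₀ hn0]; nlinarith
  have h3 : d ^ 2 ≤ a * b / n * d ^ 2 := le_mul_of_one_le_left (sq_nonneg d) hc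
  have hd := sq_nonneg d
  refine ⟨abs_le.2 ⟨?_, ?_⟩, ?_⟩
  · by_contra hh; push Not at hh; nlinarith
  · by_contra hh; push Not at hh; nlinarith
  · rw [← sq_le_one_iff_abs_le_one]
    by_contra hh; push Not at hh
    rcases le_total 0 z with h | h <;> nlinarith

open Set Filter Topology in
lemma aux_conv (a b n : ℝ) (ha : 2 ≤ a) (hb : 2 ≤ b) (hn : n = a + b) (Z D : ℝ → ℝ) (s0 : ℝ)
    (hZ : ∀ s, s0 ≤ s → HasDerivAt Z ((2 / n) * D s * (a * b * Z s * D s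
               + (a * b / n) * D s ^ 2 - (n - 1) / n + (a - b) * Z s)) s)
    (hD : ∀ s, s0 ≤ s → HasDerivAt D (D s * ((a * b / n) * D s ^ 2 - (n - 1) / n) + Z s) s)
    (hin : ∀ s, s0 ≤ s → a * Z s + (a * b / n) * D s ^ 2 < (n - 1) / n ∧
      -b * Z s + (a * b / n) * D s ^ 2 < (n - 1) / n) :
    Tendsto Z atTop (𝓝 0) ∧ Tendsto D atTop (𝓝 0) := by
  have hn0 : 0 < n := by linarith
  have hbd : ∀ s, s0 ≤ s → |Z s| ≤ 1 ∧ |D s| ≤ 1 := fun s hs =>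
    aux_bound_s10 a b n ha hb hn _ _ (hin s hs).1 (hin s hs).2
  have hcpt : ∀ H : ℝ × ℝ → ℝ, Continuous H → ∃ C, ∀ s, s0 ≤ s → |H (Z s, D s)| ≤ C := by
    intro H hH
    obtain ⟨C, hC⟩ := ((isCompact_Icc (a := (-1 : ℝ)) (b := 1)).prod
      (isCompact_Icc (a := (-1 : ℝ)) (b := 1))).exists_bound_of_continuousOn hH.continuousOn
    exact ⟨C, fun s hs => hC (Z s, D s) ⟨abs_le.1 (hbd s hs).1, abs_le.1 (hbd s hs).2⟩⟩
  set Q : ℝ → ℝ := fun s => (n - 1) / n - (a * Z s + (a * b / n) * D s ^ 2) with hQ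
  set P : ℝ → ℝ := fun s => (n - 1) / n - (-b * Z s + (a * b / n) * D s ^ 2) with hP
  have hQp : ∀ s, s0 ≤ s → 0 < Q s := fun s hs => sub_pos.2 (hin s hs).1
  have hPp : ∀ s, s0 ≤ s → 0 < P s := fun s hs => sub_pos.2 (hin s hs).2
  set F : ℝ → ℝ := fun s => a * Real.log (P s) + b * Real.log (Q s) with hF
  have hFd : ∀ s, s0 ≤ s → HasDerivAt F (2 * a * b * D s ^ 2) s := by
    intro s hs
    have hQd : HasDerivAt Q (Q s * (2 * (a * b / n) * D s ^ 2 + (2 * a / n) * D s)) s := by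
      have := (((hZ s hs).const_mul a).add (((hD s hs).pow 2).const_mul (a * b / n))).const_sub
          ((n - 1) / n)
      refine aux_cd this rfl ?_
      simp only [hQ, Nat.cast_ofNat, Nat.add_one_sub_one, pow_one]
      subst hn
      field_simp
      ring
    have hPd : HasDerivAt P (P s * (2 * (a * b / n) * D s ^ 2 - (2 * b / n) * D s)) s := by
      have := (((hZ s hs).const_mul (-b)).add (((hD s hs).pow 2).const_mul (a * b / n))).const_sub
          ((n - 1) / n)
      refine aux_cd this rfl ?_
      simp only [hP, Nat.cast_ofNat, Nat.add_one_sub_one, pow_one]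
      subst hn
      field_simp
      ring
    have := ((hPd.log (hPp s hs).ne').const_mul a).add ((hQd.log (hQp s hs).ne').const_mul b)
    refine aux_cd this rfl ?_
    rw [mul_div_cancel_left₀ _ (hPp s hs).ne', mul_div_cancel_left₀ _ (hQp s hs).ne']
    subst hn
    field_simp
    ring
  have hmono : MonotoneOn F (Ici s0) := by
    apply monotoneOn_of_deriv_nonneg (convex_Ici s0)
      (fun s hs => (hFd s hs).continuousAt.continuousWithinAt)
    · intro s hs
      rw [interior_Ici] at hs
      exact (hFd s (le_of_lt hs)).differentiableAt.differentiableWithinAt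
    · intro s hs
      rw [interior_Ici] at hs
      rw [(hFd s (le_of_lt hs)).deriv]
      positivity
  have hFb : ∃ C, ∀ s, s0 ≤ s → F s ≤ C := by
    obtain ⟨C, hC⟩ := hcpt (fun p => a * ((n - 1) / n - (-b * p.1 + (a * b / n) * p.2 ^ 2) - 1)
      + b * ((n - 1) / n - (a * p.1 + (a * b / n) * p.2 ^ 2) - 1)) (by fun_prop)
    refine ⟨C, fun s hs => le_trans ?_ ((le_abs_self _).trans (hC s hs))⟩
    exact add_le_add
      (mul_le_mul_of_nonneg_left (Real.log_le_sub_one_of_pos (hPp s hs)) (by linarith))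
      (mul_le_mul_of_nonneg_left (Real.log_le_sub_one_of_pos (hQp s hs)) (by linarith))
  have hlim : ∃ l, Tendsto F atTop (𝓝 l) := by
    obtain ⟨C, hC⟩ := hFb
    have hm : Monotone (fun s => F (max s s0)) := fun x y hxy =>
      hmono (le_max_right x s0) (le_max_right y s0) (max_le_max_right s0 hxy)
    refine ⟨_, (tendsto_atTop_ciSup hm ⟨C, ?_⟩).congr' ?_⟩
    · rintro _ ⟨s, rfl⟩
      exact hC _ (le_max_right _ _)
    · filter_upwards [eventually_ge_atTop s0] with s hs
      rw [max_eq_left hs]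
  obtain ⟨l, hl⟩ := hlim
  obtain ⟨K1, hK1⟩ := hcpt (fun p => 2 * a * b * (2 * p.2 *
    (p.2 * ((a * b / n) * p.2 ^ 2 - (n - 1) / n) + p.1))) (by fun_prop)
  have t1 := aux_barbalat F (fun s => 2 * a * b * D s ^ 2) _ s0 K1 l hFd (fun s hs => by
    have := ((hD s hs).pow 2).const_mul (2 * a * b)
    simpa using this) hK1 hl
  have tD : Tendsto D atTop (𝓝 0) := by
    have t2 : Tendsto (fun s => D s ^ 2) atTop (𝓝 0) := by
      have := t1.const_mul (1 / (2 * a * b))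
      rw [mul_zero] at this
      refine this.congr fun s => ?_
      field_simp
    have t3 := t2.sqrt
    rw [Real.sqrt_zero] at t3
    rw [tendsto_zero_iff_abs_tendsto_zero]
    refine t3.congr fun s => ?_
    exact Real.sqrt_sq_eq_abs _
  refine ⟨?_, tD⟩
  obtain ⟨K2, hK2⟩ := hcpt (fun p => ((p.2 * ((a * b / n) * p.2 ^ 2 - (n - 1) / n) + p.1)
      * ((a * b / n) * p.2 ^ 2 - (n - 1) / n) + p.2 * ((a * b / n) * (2 * p.2 *
        (p.2 * ((a * b / n) * p.2 ^ 2 - (n - 1) / n) + p.1)))) + (2 / n) * p.2 * (a * b * p.1 * p.2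
               + (a * b / n) * p.2 ^ 2 - (n - 1) / n + (a - b) * p.1)) (by fun_prop)
  have t4 := aux_barbalat D (fun s => D s * ((a * b / n) * D s ^ 2 - (n - 1) / n) + Z s) _ s0 K2 0
    hD (fun s hs => by
      have := ((hD s hs).mul ((((hD s hs).pow 2).const_mul (a * b / n)).sub_const
        ((n - 1) / n))).add (hZ s hs)
      exact aux_cd this rfl (by simp)) hK2 tD
  have t5 := t4.sub (tD.mul (((tD.pow 2).const_mul (a * b / n)).sub_const ((n - 1) / n)))
  simpa using t5

/-- Every maximal solution of the `H = 1` subsystem with initial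
value in the interior of `S₁` remains in the interior of `S₁`, exists for all
forward time, and converges to the origin as `s → +∞`.
A point `p : ℝ × ℝ` encodes `(Z, Δ) = (p.1, p.2)`. -/
theorem stmt10 (d1 d2 : ℕ) (hd1 : 2 ≤ d1) (hd2 : 2 ≤ d2) (n : ℕ) (hn : n = d1 + d2)
    (V : ℝ × ℝ → ℝ × ℝ)
    (hV : ∀ p : ℝ × ℝ,
      V p = ((2 / n) * p.2 * ((d1 : ℝ) * d2 * p.1 * p.2
               + ((d1 : ℝ) * d2 / n) * p.2 ^ 2 - ((n : ℝ) - 1) / n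
               + ((d1 : ℝ) - (d2 : ℝ)) * p.1),
             p.2 * (((d1 : ℝ) * d2 / n) * p.2 ^ 2 - ((n : ℝ) - 1) / n) + p.1))
    (intS1 : Set (ℝ × ℝ))
    (hintS1 : intS1 = {p : ℝ × ℝ |
      (d1 : ℝ) * p.1 + ((d1 : ℝ) * d2 / n) * p.2 ^ 2 < ((n : ℝ) - 1) / n ∧
      -(d2 : ℝ) * p.1 + ((d1 : ℝ) * d2 / n) * p.2 ^ 2 < ((n : ℝ) - 1) / n}) :
    -- forward invariance of the interior of S₁
    (∀ γ : ℝ → ℝ × ℝ, ∀ s0 s1 : ℝ, s0 ≤ s1 →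
      (∀ s ∈ Set.Icc s0 s1, HasDerivAt γ (V (γ s)) s) →
      γ s0 ∈ intS1 → γ s1 ∈ intS1) ∧
    -- existence of a globally forward-defined solution through each interior point
    (∀ p ∈ intS1, ∃ γ : ℝ → ℝ × ℝ, γ 0 = p ∧
      ∀ s : ℝ, 0 ≤ s → HasDerivAt γ (V (γ s)) s ∧ γ s ∈ intS1) ∧
    -- every forward-global solution starting in the interior converges to the origin
    (∀ γ : ℝ → ℝ × ℝ, ∀ s0 : ℝ,
      (∀ s : ℝ, s0 ≤ s → HasDerivAt γ (V (γ s)) s) → γ s0 ∈ intS1 →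
      Filter.Tendsto γ Filter.atTop (nhds ((0 : ℝ), (0 : ℝ)))) := by
  subst hintS1
  have ha : (2 : ℝ) ≤ d1 := by exact_mod_cast hd1
  have hb : (2 : ℝ) ≤ d2 := by exact_mod_cast hd2
  have hn' : (n : ℝ) = d1 + d2 := by exact_mod_cast hn
  have hfst : ∀ (γ : ℝ → ℝ × ℝ) (v : ℝ × ℝ) (s : ℝ), HasDerivAt γ v s →
      HasDerivAt (fun s => (γ s).1) v.1 s := fun γ v s h =>
    (hasFDerivAt_fst (𝕜 := ℝ) (p := γ s)).comp_hasDerivAt s h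
  have hsnd : ∀ (γ : ℝ → ℝ × ℝ) (v : ℝ × ℝ) (s : ℝ), HasDerivAt γ v s →
      HasDerivAt (fun s => (γ s).2) v.2 s := fun γ v s h =>
    (hasFDerivAt_snd (𝕜 := ℝ) (p := γ s)).comp_hasDerivAt s h
  have hinv : ∀ γ : ℝ → ℝ × ℝ, ∀ s0 s1 : ℝ, s0 ≤ s1 →
      (∀ s ∈ Set.Icc s0 s1, HasDerivAt γ (V (γ s)) s) →
      γ s0 ∈ {p : ℝ × ℝ |
      (d1 : ℝ) * p.1 + ((d1 : ℝ) * d2 / n) * p.2 ^ 2 < ((n : ℝ) - 1) / n ∧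
      -(d2 : ℝ) * p.1 + ((d1 : ℝ) * d2 / n) * p.2 ^ 2 < ((n : ℝ) - 1) / n} →
      γ s1 ∈ {p : ℝ × ℝ |
      (d1 : ℝ) * p.1 + ((d1 : ℝ) * d2 / n) * p.2 ^ 2 < ((n : ℝ) - 1) / n ∧
      -(d2 : ℝ) * p.1 + ((d1 : ℝ) * d2 / n) * p.2 ^ 2 < ((n : ℝ) - 1) / n} := by
    intro γ s0 s1 h hγ h0
    refine aux_inv d1 d2 n ha hb hn' (fun s => (γ s).1) (fun s => (γ s).2) (fun _ => 1) s0 s1 h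
      continuousOn_const ?_ ?_ h0.1 h0.2
    · intro s hs
      have := hfst _ _ _ (hγ s hs)
      rw [hV] at this
      simpa only [one_mul] using this
    · intro s hs
      have := hsnd _ _ _ (hγ s hs)
      rw [hV] at this
      simpa only [one_mul] using this
  refine ⟨hinv, ?_, ?_⟩
  · intro p hp
    let χ : ContDiffBump (0 : ℝ × ℝ) := ⟨1, 2, by norm_num, by norm_num⟩
    have hVs : ContDiff ℝ 1 V := by
      rw [show V = _ from funext hV]
      fun_prop
    have hWs : ContDiff ℝ 1 (fun x => χ x • V x) := χ.contDiff.smul hVs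
    have hWc : HasCompactSupport (fun x => χ x • V x) := χ.hasCompactSupport.smul_right
    obtain ⟨K, hK⟩ := hWs.lipschitzWith_of_hasCompactSupport hWc one_ne_zero
    obtain ⟨L, hL⟩ := hWs.continuous.bounded_above_of_compact_support hWc
    obtain ⟨γ, hγ0, hγ⟩ := aux_global _ K L.toNNReal hK
      (fun x => (hL x).trans (Real.le_coe_toNNReal L)) p
    have hmem : ∀ s, 0 ≤ s → γ s ∈ {p : ℝ × ℝ |
        (d1 : ℝ) * p.1 + ((d1 : ℝ) * d2 / n) * p.2 ^ 2 < ((n : ℝ) - 1) / n ∧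
        -(d2 : ℝ) * p.1 + ((d1 : ℝ) * d2 / n) * p.2 ^ 2 < ((n : ℝ) - 1) / n} := by
      intro s hs
      have hγc : Continuous γ := continuous_iff_continuousAt.2 fun s => (hγ s).continuousAt
      rw [← hγ0] at hp
      refine aux_inv d1 d2 n ha hb hn' (fun s => (γ s).1) (fun s => (γ s).2) (fun s => χ (γ s))
        0 s hs (χ.continuous.comp hγc).continuousOn ?_ ?_ hp.1 hp.2
      · intro s hs
        have := hfst _ _ _ (hγ s)
        rw [hV] at this
        simpa only [Prod.smul_fst, smul_eq_mul] using this
      · intro s hs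
        have := hsnd _ _ _ (hγ s)
        rw [hV] at this
        simpa only [Prod.smul_snd, smul_eq_mul] using this
    refine ⟨γ, hγ0, fun s hs => ⟨?_, hmem s hs⟩⟩
    have h1 := hγ s
    have h2 := aux_bound_s10 d1 d2 n ha hb hn' _ _ (hmem s hs).1 (hmem s hs).2
    have h3 : χ (γ s) = 1 := by
      apply χ.one_of_mem_closedBall
      rw [mem_closedBall_zero_iff, Prod.norm_def]
      exact max_le h2.1 h2.2
    simpa only [h3, one_smul] using h1
  · intro γ s0 hγ h0
    have h := aux_conv d1 d2 n ha hb hn' (fun s => (γ s).1) (fun s => (γ s).2) s0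
      (fun s hs => by
        have := hfst _ _ _ (hγ s hs)
        rw [hV] at this
        exact this)
      (fun s hs => by
        have := hsnd _ _ _ (hγ s hs)
        rw [hV] at this
        exact this)
      (fun s hs => hinv γ s0 s hs (fun t ht => hγ t ht.1) h0)
    exact h.1.prodMk_nhds h.2
end

section
/- For every h ∈ ℝ, the Jacobian matrix of the vector field defining the Einstein ODE in (Z, Δ, H)-coordinates at the point (0, 0, h) of the cone solution equals the matrix A(h) with rows (0, −2(n−1)/n², 0), (1, −(n−1)·h/n, 0), (0, 0, 2h/n). The characteristic polynomial of A(h) is (t − 2h/n)·(t² + ((n−1)·h/n)·t + 2(n−1)/n²); the eigenvalue 2h/n has eigenvector (0, 0, 1), and for every (possibly complex) root λ of t² + ((n−1)·h/n)·t + 2(n−1)/n², the vector (−2(n−1)/n², λ, 0) is an eigenvector of A(h) with eigenvalue λ. -/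
open Polynomial

/-- For every `h`, the Jacobian of the vector field of the Einstein ODE in
(Z, Δ, H)-coordinates at the point `(0, 0, h)` of the cone solution equals the matrix
`A(h)` with rows `(0, −2(n−1)/n², 0)`, `(1, −(n−1)h/n, 0)`, `(0, 0, 2h/n)`; the
characteristic polynomial of `A(h)` factors as stated, `(0,0,1)` is an eigenvector for
the eigenvalue `2h/n`, and for every complex root `λ` of `t² + ((n−1)h/n)t + 2(n−1)/n²`
the vector `(−2(n−1)/n², λ, 0)` is an eigenvector of `A(h)` with eigenvalue `λ`.
A point `p : Fin 3 → ℝ` encodes `(Z, Δ, H) = (p 0, p 1, p 2)`. -/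
theorem stmt11 (d1 d2 : ℕ) (hd1 : 2 ≤ d1) (hd2 : 2 ≤ d2) (n : ℕ) (hn : n = d1 + d2)
    (W : (Fin 3 → ℝ) → (Fin 3 → ℝ))
    (hW : ∀ p : Fin 3 → ℝ,
      W p = ![(2 / n) * p 1 * ((d1 : ℝ) * d2 * p 0 * p 1 * p 2
               + ((d1 : ℝ) * d2 / n) * (p 1) ^ 2 - ((n : ℝ) - 1) / n
               + ((d1 : ℝ) - (d2 : ℝ)) * p 0),
             p 1 * p 2 * (((d1 : ℝ) * d2 / n) * (p 1) ^ 2 - ((n : ℝ) - 1) / n) + p 0,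
             -((1 - (p 2) ^ 2) / n) * ((d1 : ℝ) * d2 * (p 1) ^ 2 + 1)])
    (h : ℝ) (A : Matrix (Fin 3) (Fin 3) ℝ)
    (hA : A = !![0, -(2 * ((n : ℝ) - 1) / (n : ℝ) ^ 2), 0;
                 1, -(((n : ℝ) - 1) * h / n), 0;
                 0, 0, 2 * h / n]) :
    HasFDerivAt W (LinearMap.toContinuousLinearMap A.mulVecLin) ![0, 0, h] ∧
    A.charpoly = (X - C (2 * h / n)) *
      (X ^ 2 + C (((n : ℝ) - 1) * h / n) * X + C (2 * ((n : ℝ) - 1) / (n : ℝ) ^ 2)) ∧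
    A.mulVec ![0, 0, 1] = (2 * h / (n : ℝ)) • ![0, 0, 1] ∧
    (∀ lam : ℂ,
      lam ^ 2 + Complex.ofReal (((n : ℝ) - 1) * h / n) * lam
        + Complex.ofReal (2 * ((n : ℝ) - 1) / (n : ℝ) ^ 2) = 0 →
      (A.map Complex.ofReal).mulVec
          ![Complex.ofReal (-(2 * ((n : ℝ) - 1) / (n : ℝ) ^ 2)), lam, 0]
        = lam • ![Complex.ofReal (-(2 * ((n : ℝ) - 1) / (n : ℝ) ^ 2)), lam, 0]) := by
  refine ⟨?_, ?_, ?_, ?_⟩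
  · have hWf : W = fun p => _ := funext hW
    have P : ∀ i : Fin 3, HasFDerivAt (fun p : Fin 3 → ℝ => p i)
        (ContinuousLinearMap.proj (R := ℝ) (φ := fun _ : Fin 3 => ℝ) i) ![0, 0, h] :=
      fun i => hasFDerivAt_apply i _
    rw [hWf, hasFDerivAt_pi']
    intro i
    fin_cases i
    · have H := ((P 1).const_mul (2 / (n : ℝ))).mul
        ((((((P 0).const_mul ((d1 : ℝ) * d2)).mul (P 1)).mul (P 2)).add
          (((P 1).pow 2).const_mul ((d1 : ℝ) * d2 / n))).sub_const (((n : ℝ) - 1) / n)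
          |>.add ((P 0).const_mul ((d1 : ℝ) - (d2 : ℝ))))
      refine H.congr_fderiv ?_
      ext v
      simp [hA, Matrix.mulVec, dotProduct, Fin.sum_univ_three]
      try ring
    · have H := (((P 1).mul (P 2)).mul
        ((((P 1).pow 2).const_mul ((d1 : ℝ) * d2 / n)).sub_const (((n : ℝ) - 1) / n))).add (P 0)
      refine H.congr_fderiv ?_
      ext v
      simp [hA, Matrix.mulVec, dotProduct, Fin.sum_univ_three]
      try ring
    · have H := ((((P 2).pow 2).const_sub 1).mul_const ((n : ℝ)⁻¹)).neg.mul
        ((((P 1).pow 2).const_mul ((d1 : ℝ) * d2)).add_const 1)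
      refine H.congr_fderiv ?_
      ext v
      simp [hA, Matrix.mulVec, dotProduct, Fin.sum_univ_three]
      try ring
  · subst hA
    rw [Matrix.charpoly, Matrix.det_fin_three]
    simp [Matrix.charmatrix_apply, -map_mul, -map_div₀, -map_sub, -map_pow]
    try ring
  · subst hA
    ext i
    fin_cases i <;> simp [Matrix.mulVec, dotProduct, Fin.sum_univ_three]
  · intro lam hl
    subst hA
    ext i
    fin_cases i
    · simp [Matrix.mulVec, dotProduct, Fin.sum_univ_three]
      try ring
    · simp [Matrix.mulVec, dotProduct, Fin.sum_univ_three]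
      push_cast at hl
      linear_combination -hl
    · simp [Matrix.mulVec, dotProduct, Fin.sum_univ_three]
end

section
/- Let d1 + d2 = 9 with d1, d2 ≥ 2 integers (so n = 9). Let (Z, Δ) : [s0, ∞) → ℝ² be a solution of the H = 1 subsystem with initial value in the interior of S₁ and with (Z(s0), Δ(s0)) ≠ (0, 0). Then (Z(s), Δ(s)) ≠ (0, 0) for all s, and the normalized vector (Z(s), Δ(s))/‖(Z(s), Δ(s))‖ converges, as s → +∞, to either (4, 9)/√97 or −(4, 9)/√97. -/
open Filter Set Topology

lemma mono_aux {f f' : ℝ → ℝ} {T : ℝ} (h : ∀ s, T ≤ s → HasDerivAt f (f' s) s)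
    (h0 : ∀ s, T ≤ s → 0 ≤ f' s) : MonotoneOn f (Ici T) := by
  refine monotoneOn_of_deriv_nonneg (convex_Ici T) ?_ ?_ ?_
  · intro s hs; exact (h s hs).continuousAt.continuousWithinAt
  · intro s hs
    exact (h s (interior_subset hs)).differentiableAt.differentiableWithinAt
  · intro s hs
    have := interior_subset hs
    rw [(h s this).deriv]; exact h0 s this

lemma mono_Icc {f f' : ℝ → ℝ} {T S : ℝ} (hTS : T ≤ S)
    (h : ∀ s ∈ Icc T S, HasDerivAt f (f' s) s)
    (h0 : ∀ s ∈ Icc T S, 0 ≤ f' s) : f T ≤ f S := by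
  have : MonotoneOn f (Icc T S) := by
    refine monotoneOn_of_deriv_nonneg (convex_Icc T S) ?_ ?_ ?_
    · intro s hs; exact (h s hs).continuousAt.continuousWithinAt
    · intro s hs
      exact (h s (interior_subset hs)).differentiableAt.differentiableWithinAt
    · intro s hs
      have := interior_subset hs
      rw [(h s this).deriv]; exact h0 s this
  exact this (left_mem_Icc.2 hTS) (right_mem_Icc.2 hTS) hTS

lemma hasDerivAt_expmul (K s : ℝ) :
    HasDerivAt (fun s => Real.exp (K * s)) (K * Real.exp (K * s)) s := by
  have := ((hasDerivAt_id s).const_mul K).exp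
  simp only [id, mul_one] at this
  rw [mul_comm]; exact this

lemma gron {f f' : ℝ → ℝ} {T S K : ℝ} (hTS : T ≤ S)
    (h : ∀ s ∈ Icc T S, HasDerivAt f (f' s) s)
    (h0 : ∀ s ∈ Icc T S, -K * f s ≤ f' s) :
    f T * Real.exp (K * T) ≤ f S * Real.exp (K * S) := by
  refine mono_Icc (f := fun s => f s * Real.exp (K * s))
    (f' := fun s => f' s * Real.exp (K * s) + f s * (K * Real.exp (K * s))) hTS ?_ ?_
  · intro s hs
    exact (h s hs).mul (hasDerivAt_expmul K s)
  · intro s hs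
    have h1 := h0 s hs
    have h2 := Real.exp_pos (K * s)
    have : 0 ≤ (f' s + K * f s) * Real.exp (K * s) := mul_nonneg (by linarith) h2.le
    nlinarith

lemma gron_pos {f f' : ℝ → ℝ} {T S K : ℝ} (hTS : T ≤ S)
    (h : ∀ s ∈ Icc T S, HasDerivAt f (f' s) s)
    (h0 : ∀ s ∈ Icc T S, -K * f s ≤ f' s) (hT : 0 < f T) : 0 < f S := by
  have h1 := gron hTS h h0
  have h2 : 0 < f T * Real.exp (K * T) := by positivity
  exact pos_of_mul_pos_left (lt_of_lt_of_le h2 h1) (Real.exp_pos _).le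

lemma lin_pos {A c : ℝ → ℝ} {T S : ℝ} (hTS : T ≤ S) (hc : ContinuousOn c (Icc T S))
    (h : ∀ s ∈ Icc T S, HasDerivAt A (c s * A s) s) (hT : 0 < A T) : 0 < A S := by
  obtain ⟨K, hK⟩ := isCompact_Icc.exists_bound_of_continuousOn hc
  have key : ∀ s ∈ Icc T S, A s ≠ 0 := by
    intro s hs h00
    have := gron_pos (f := fun s => A s ^ 2) (f' := fun s => 2 * A s * (c s * A s)) (K := 2 * K)
      hs.1 (fun u hu => by
        have := (h u ⟨hu.1, hu.2.trans hs.2⟩).pow 2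
        exact this.congr_deriv (by simp)) (fun u hu => by
        have h1 := hK u ⟨hu.1, hu.2.trans hs.2⟩
        rw [Real.norm_eq_abs] at h1
        have := (abs_le.1 h1).1
        nlinarith [mul_nonneg (sq_nonneg (A u)) (by linarith : 0 ≤ c u + K)]) (by positivity)
    simp [h00] at this
  by_contra hneg
  have hcont : ContinuousOn A (Icc T S) := fun s hs => (h s hs).continuousAt.continuousWithinAt
  have := intermediate_value_Icc' hTS hcont (show (0:ℝ) ∈ Icc (A S) (A T) from ⟨not_lt.1 hneg, hT.le⟩)
  obtain ⟨s, hs, h0⟩ := this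
  exact key s hs h0

lemma mono_lim {f : ℝ → ℝ} {T M : ℝ} (h : MonotoneOn f (Ici T)) (hM : ∀ s, T ≤ s → f s ≤ M) :
    ∃ l, Tendsto f atTop (𝓝 l) := by
  have hm : Monotone (fun s => f (max s T)) := fun a b hab =>
    h (le_max_right a T) (le_max_right b T) (max_le_max hab le_rfl)
  refine ⟨_, (tendsto_atTop_ciSup hm ⟨M, ?_⟩).congr' ?_⟩
  · rintro _ ⟨s, rfl⟩; exact hM _ (le_max_right _ _)
  · filter_upwards [eventually_ge_atTop T] with s hs
    simp [max_eq_left hs]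

lemma barb {F F' g g' : ℝ → ℝ} {T c K M B : ℝ} (hc : 0 < c) (hB : 0 < B) (hK : 0 ≤ K)
    (hF : ∀ s, T ≤ s → HasDerivAt F (F' s) s) (hg : ∀ s, T ≤ s → HasDerivAt g (g' s) s)
    (hFg : ∀ s, T ≤ s → c * g s ≤ F' s) (hg0 : ∀ s, T ≤ s → 0 ≤ g s)
    (hgB : ∀ s, T ≤ s → g s ≤ B) (hgK : ∀ s, T ≤ s → |g' s| ≤ K) (hM : ∀ s, T ≤ s → F s ≤ M) :
    Tendsto g atTop (𝓝 0) := by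
  obtain ⟨l1, h1⟩ := mono_lim (mono_aux hF fun s hs => (mul_nonneg hc.le (hg0 s hs)).trans (hFg s hs)) hM
  have hm2 : MonotoneOn (fun s => 2 * K / c * F s + g s ^ 2) (Ici T) := by
    refine mono_aux (f' := fun s => 2 * K / c * F' s + 2 * g s * g' s) ?_ ?_
    · intro s hs
      have := ((hF s hs).const_mul (2 * K / c)).add ((hg s hs).pow 2)
      exact this.congr_deriv (by simp)
    · intro s hs
      have e1 : 2 * K / c * (c * g s) ≤ 2 * K / c * F' s :=
        mul_le_mul_of_nonneg_left (hFg s hs) (by positivity)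
      have e2 : 2 * K / c * (c * g s) = 2 * K * g s := by field_simp
      have e3 := mul_nonneg (hg0 s hs) (by linarith [(abs_le.1 (hgK s hs)).1] : 0 ≤ g' s + K)
      nlinarith
  obtain ⟨l2, h2⟩ := mono_lim (M := 2 * K / c * M + B ^ 2) hm2 (fun s hs => by
    have e1 : 2 * K / c * F s ≤ 2 * K / c * M :=
        mul_le_mul_of_nonneg_left (hM s hs) (by positivity)
    have e2 : g s ^ 2 ≤ B ^ 2 := pow_le_pow_left₀ (hg0 s hs) (hgB s hs) 2
    linarith)
  have h3 : Tendsto (fun s => g s ^ 2) atTop (𝓝 (l2 - 2 * K / c * l1)) := by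
    have := h2.sub (h1.const_mul (2 * K / c))
    refine this.congr fun s => by ring
  set l := l2 - 2 * K / c * l1
  have hl0 : 0 ≤ l := ge_of_tendsto h3 (Eventually.of_forall fun s => sq_nonneg _)
  have hl : l = 0 := by
    by_contra hne
    have hlp : 0 < l := lt_of_le_of_ne hl0 (Ne.symm hne)
    obtain ⟨S, hS⟩ := eventually_atTop.1 (h3.eventually (lt_mem_nhds (half_lt_self hlp)))
    set R := max S T
    set k := c * (l / 2 / B) with hk
    have hkp : 0 < k := by positivity
    have hm : MonotoneOn (fun s => F s - k * s) (Ici R) := by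
      refine mono_aux (f' := fun s => F' s - k) ?_ ?_
      · intro s hs
        have := (hF s ((le_max_right _ _).trans hs)).sub ((hasDerivAt_id s).const_mul k)
        exact this.congr_deriv (by simp)
      · intro s hs
        have hT := (le_max_right S T).trans hs
        have e1 := hS s ((le_max_left _ _).trans hs)
        have e2 : l / 2 / B ≤ g s := by
          rw [div_le_iff₀ hB]
          nlinarith [hg0 s hT, hgB s hT]
        have e3 := hFg s hT
        have : k ≤ c * g s := mul_le_mul_of_nonneg_left e2 hc.le
        linarith
    have hbig : R ≤ R + (M - F R + 1) / k := by
      have : 0 ≤ M - F R := by linarith [hM R (le_max_right _ _)]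
      have : 0 ≤ (M - F R + 1) / k := by positivity
      linarith
    have e := hm (self_mem_Ici) hbig hbig
    have e2 := hM _ ((le_max_right S T).trans hbig)
    have e3 : k * ((M - F R + 1) / k) = M - F R + 1 := by field_simp
    simp only at e
    nlinarith
  rw [hl] at h3
  have h4 := h3.sqrt
  rw [Real.sqrt_zero] at h4
  refine h4.congr' ?_
  filter_upwards [eventually_ge_atTop T] with s hs
  exact Real.sqrt_sq (hg0 s hs)

lemma exp_lim {f f' : ℝ → ℝ} {T C c : ℝ} (hc : 0 < c) (hC : 0 ≤ C)
    (h : ∀ s, T ≤ s → HasDerivAt f (f' s) s)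
    (h0 : ∀ s, T ≤ s → |f' s| ≤ C * Real.exp (-c * s)) :
    ∃ L, ∀ s, T ≤ s → |f s - L| ≤ C / c * Real.exp (-c * s) := by
  have hu : MonotoneOn (fun s => f s - C / c * Real.exp (-c * s)) (Ici T) := by
    refine mono_aux (fun s hs => (h s hs).sub ((hasDerivAt_expmul (-c) s).const_mul (C / c))) ?_
    intro s hs
    have e : C / c * (-c * Real.exp (-c * s)) = - (C * Real.exp (-c * s)) := by field_simp
    rw [e]; linarith [(abs_le.1 (h0 s hs)).1]
  have hv : MonotoneOn (fun s => - (f s + C / c * Real.exp (-c * s))) (Ici T) := by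
    refine mono_aux (fun s hs => ((h s hs).add ((hasDerivAt_expmul (-c) s).const_mul (C / c))).neg) ?_
    intro s hs
    have e : C / c * (-c * Real.exp (-c * s)) = - (C * Real.exp (-c * s)) := by field_simp
    rw [e]; linarith [(abs_le.1 (h0 s hs)).2]
  have key : ∀ s ∈ Ici T, ∀ t ∈ Ici T,
      f s - C / c * Real.exp (-c * s) ≤ f t + C / c * Real.exp (-c * t) := by
    intro s hs t ht
    have hm : max s t ∈ Ici T := le_trans hs (le_max_left s t)
    have e1 := hu hs hm (le_max_left _ _)
    have e2 := hv ht hm (le_max_right _ _)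
    have : 0 ≤ C / c * Real.exp (-c * max s t) := by positivity
    simp only at e1 e2
    linarith
  refine ⟨sSup ((fun s => f s - C / c * Real.exp (-c * s)) '' Ici T), fun s hs => ?_⟩
  have b1 : f s - C / c * Real.exp (-c * s) ≤
      sSup ((fun s => f s - C / c * Real.exp (-c * s)) '' Ici T) := by
    refine le_csSup ⟨f T + C / c * Real.exp (-c * T), ?_⟩ ⟨s, hs, rfl⟩
    rintro _ ⟨u, hu, rfl⟩
    exact key u hu T self_mem_Ici
  have b2 : sSup ((fun s => f s - C / c * Real.exp (-c * s)) '' Ici T) ≤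
      f s + C / c * Real.exp (-c * s) := by
    refine csSup_le ⟨_, ⟨T, self_mem_Ici, rfl⟩⟩ ?_
    rintro _ ⟨u, hu, rfl⟩
    exact key u hu s hs
  rw [abs_le]; constructor <;> linarith

lemma asym {W D H1 H2 : ℝ → ℝ} {T C : ℝ} (hC : 0 < C)
    (hW : ∀ s, T ≤ s → HasDerivAt W (-(4/9) * W s + H1 s) s)
    (hD : ∀ s, T ≤ s → HasDerivAt D (-(4/9) * D s + W s / 9 + H2 s) s)
    (hH1 : ∀ s, T ≤ s → |H1 s| ≤ C * (W s ^ 2 + D s ^ 2))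
    (hH2 : ∀ s, T ≤ s → |H2 s| ≤ C * (W s ^ 2 + D s ^ 2))
    (hpos : ∀ s, T ≤ s → 0 < W s ^ 2 + D s ^ 2)
    (hlim : Tendsto (fun s => W s ^ 2 + D s ^ 2) atTop (𝓝 0)) :
    ∃ ε : ℝ, (ε = 1 ∨ ε = -1) ∧ (∀ᶠ s in atTop, 0 < ε * D s) ∧
      Tendsto (fun s => W s / D s) atTop (𝓝 0) := by
  set δ : ℝ := (1 / (36 * C)) ^ 2 with hδ
  have hδp : 0 < δ := by positivity
  obtain ⟨S, hS⟩ := eventually_atTop.1 (hlim.eventually (gt_mem_nhds hδp))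
  obtain ⟨R, hR0, hRS, hRT⟩ : ∃ R : ℝ, 1 ≤ R ∧ S ≤ R ∧ T ≤ R :=
    ⟨max 1 (max S T), le_max_left _ _, (le_max_left _ _).trans (le_max_right _ _),
      (le_max_right _ _).trans (le_max_right _ _)⟩
  set N : ℝ → ℝ := fun s => W s ^ 2 + D s ^ 2 with hN
  set N' : ℝ → ℝ := fun s => 2 * W s * (-(4/9) * W s + H1 s)
    + 2 * D s * (-(4/9) * D s + W s / 9 + H2 s) with hN'
  have hNd : ∀ s, R ≤ s → HasDerivAt N (N' s) s := by
    intro s hs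
    have := ((hW s (hRT.trans hs)).pow 2).add ((hD s (hRT.trans hs)).pow 2)
    exact this.congr_deriv (by simp [hN'])
  have hest : ∀ s, R ≤ s → |N' s + 8/9 * N s| ≤ 2/9 * N s := by
    intro s hs
    have hs' := hRT.trans hs
    have n0 : 0 < N s := hpos s hs'
    have hsm : W s ^ 2 + D s ^ 2 < δ := hS s (hRS.trans hs)
    have a1 : |W s| ≤ 1 / (36 * C) := abs_le_of_sq_le_sq (by nlinarith [sq_nonneg (D s)]) (by positivity)
    have a2 : |D s| ≤ 1 / (36 * C) := abs_le_of_sq_le_sq (by nlinarith [sq_nonneg (W s)]) (by positivity)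
    have b1 : |W s * H1 s| ≤ 1 / 36 * N s := by
      rw [abs_mul]
      calc |W s| * |H1 s| ≤ 1 / (36 * C) * (C * N s) :=
            mul_le_mul a1 (hH1 s hs') (abs_nonneg _) (by positivity)
        _ = 1 / 36 * N s := by field_simp
    have b2 : |D s * H2 s| ≤ 1 / 36 * N s := by
      rw [abs_mul]
      calc |D s| * |H2 s| ≤ 1 / (36 * C) * (C * N s) :=
            mul_le_mul a2 (hH2 s hs') (abs_nonneg _) (by positivity)
        _ = 1 / 36 * N s := by field_simp
    have b3 : |2 * (W s * D s)| ≤ N s := by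
      rw [abs_le]; simp only [hN]
      constructor <;> nlinarith [sq_nonneg (W s + D s), sq_nonneg (W s - D s)]
    have e : N' s + 8/9 * N s = 2 * (W s * H1 s) + 2 * (D s * H2 s) + 1/9 * (2 * (W s * D s)) := by
      simp only [hN, hN']; ring
    rw [e]
    rw [abs_le] at *
    constructor <;> linarith
  obtain ⟨c2, hc2, hup⟩ : ∃ c2 : ℝ, 0 < c2 ∧ ∀ s, R ≤ s → N s ≤ c2 * Real.exp (-(2/3) * s) := by
    refine ⟨N R * Real.exp (2/3 * R), mul_pos (hpos R hRT) (Real.exp_pos _), fun s hs => ?_⟩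
    have := gron (f := fun s => - N s) (f' := fun s => - N' s) (K := 2/3) hs
      (fun u hu => (hNd u hu.1).neg) (fun u hu => by
        have := (abs_le.1 (hest u hu.1)).2
        linarith)
    have h2 : N s * Real.exp (2/3 * s) ≤ N R * Real.exp (2/3 * R) := by linarith
    have h3 := mul_le_mul_of_nonneg_right h2 (Real.exp_pos (-(2/3) * s)).le
    have h4 : Real.exp (2/3 * s) * Real.exp (-(2/3) * s) = 1 := by
      rw [← Real.exp_add]; simp
    rwa [mul_assoc, h4, mul_one] at h3
  obtain ⟨c1, hc1, hlow⟩ : ∃ c1 : ℝ, 0 < c1 ∧ ∀ s, R ≤ s → c1 ≤ N s * Real.exp (10/9 * s) := by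
    refine ⟨N R * Real.exp (10/9 * R), mul_pos (hpos R hRT) (Real.exp_pos _), fun s hs => ?_⟩
    exact gron (f := N) (f' := N') (K := 10/9) hs
      (fun u hu => hNd u hu.1) (fun u hu => by
        have := (abs_le.1 (hest u hu.1)).1
        linarith)
  have hHb : ∀ H : ℝ → ℝ, (∀ s, T ≤ s → |H s| ≤ C * N s) → ∀ s, R ≤ s →
      |Real.exp (4/9 * s) * H s| ≤ C * c2 * Real.exp (-(2/9) * s) := by
    intro H hH s hs
    rw [abs_mul, abs_of_pos (Real.exp_pos _)]
    have e : Real.exp (-(2/9) * s) = Real.exp (4/9 * s) * Real.exp (-(2/3) * s) := by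
      rw [← Real.exp_add]; congr 1; ring
    have h1 : |H s| ≤ C * (c2 * Real.exp (-(2/3) * s)) :=
      (hH s (hRT.trans hs)).trans (mul_le_mul_of_nonneg_left (hup s hs) hC.le)
    rw [e]
    calc _ ≤ Real.exp (4/9 * s) * (C * (c2 * Real.exp (-(2/3) * s))) :=
          mul_le_mul_of_nonneg_left h1 (Real.exp_pos _).le
      _ = _ := by ring
  set a : ℝ → ℝ := fun s => Real.exp (4/9 * s) * W s with ha
  set b : ℝ → ℝ := fun s => Real.exp (4/9 * s) * D s with hb
  obtain ⟨α, hα⟩ := exp_lim (f := a) (f' := fun s => Real.exp (4/9 * s) * H1 s) (T := R)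
    (C := C * c2) (c := 2/9) (by norm_num) (by positivity)
    (fun s hs => ((hasDerivAt_expmul (4/9) s).mul (hW s (hRT.trans hs))).congr_deriv (by ring))
    (hHb H1 hH1)
  set k := C * c2 / (2/9) with hk
  have hkp : 0 < k := by positivity
  obtain ⟨β, hβ⟩ := exp_lim (f := fun s => b s - α / 9 * s)
    (f' := fun s => Real.exp (4/9 * s) * H2 s + (a s - α) / 9) (T := R)
    (C := C * c2 + k / 9) (c := 2/9) (by norm_num) (by positivity)
    (fun s hs => (((hasDerivAt_expmul (4/9) s).mul (hD s (hRT.trans hs))).sub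
      ((hasDerivAt_id s).const_mul (α / 9))).congr_deriv (by simp only [ha]; ring))
    (fun s hs => by
      have h1 := hHb H2 hH2 s hs
      have h2 := hα s hs
      refine (abs_add_le _ _).trans ?_
      rw [abs_div, abs_of_pos (by norm_num : (0:ℝ) < 9)]
      linarith)
  set k2 := (C * c2 + k / 9) / (2/9) with hk2
  have hk2p : 0 < k2 := by positivity
  have hexp0 : Tendsto (fun s : ℝ => Real.exp (-(2/9) * s)) atTop (𝓝 0) := by
    refine Real.tendsto_exp_atBot.comp ?_
    exact tendsto_id.const_mul_atTop_of_neg (by norm_num)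
  have hexpk : ∀ q : ℝ, Tendsto (fun s : ℝ => q * Real.exp (-(2/9) * s)) atTop (𝓝 0) := by
    intro q
    have := hexp0.const_mul q
    rwa [mul_zero] at this
  have ha_lim : Tendsto a atTop (𝓝 α) := by
    rw [tendsto_iff_norm_sub_tendsto_zero]
    refine squeeze_zero' (Eventually.of_forall fun s => norm_nonneg _) ?_
      (hexpk k)
    filter_upwards [eventually_ge_atTop R] with s hs using hα s hs
  have hb_lim : Tendsto (fun s => b s - α / 9 * s) atTop (𝓝 β) := by
    rw [tendsto_iff_norm_sub_tendsto_zero]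
    refine squeeze_zero' (Eventually.of_forall fun s => norm_nonneg _) ?_
      (hexpk k2)
    filter_upwards [eventually_ge_atTop R] with s hs using hβ s hs
  have hratio : ∀ s, W s / D s = a s / b s := by
    intro s
    simp only [ha, hb]
    rw [mul_div_mul_left _ _ (Real.exp_pos _).ne']
  have fin : ∀ (m : ℝ → ℝ) (x : ℝ), x ≠ 0 → (∀ᶠ s in atTop, 0 < m s) →
      Tendsto (fun s => b s / m s) atTop (𝓝 x) → Tendsto (fun s => a s / m s) atTop (𝓝 0) →
      ∃ ε : ℝ, (ε = 1 ∨ ε = -1) ∧ (∀ᶠ s in atTop, 0 < ε * D s) ∧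
      Tendsto (fun s => W s / D s) atTop (𝓝 0) := by
    intro m x hx hm hbx hax
    have hr : Tendsto (fun s => W s / D s) atTop (𝓝 0) := by
      have := hax.div hbx hx
      rw [zero_div] at this
      refine this.congr' ?_
      filter_upwards [hm] with s hs
      rw [hratio]
      simp only [Pi.div_apply]
      rw [div_div_div_cancel_right₀ hs.ne']
    have hsign : ∀ ε : ℝ, 0 < ε * x → ∀ᶠ s in atTop, 0 < ε * D s := by
      intro ε hε
      filter_upwards [hm, (hbx.const_mul ε).eventually (lt_mem_nhds hε)] with s h1 h2
      have h3 : ε * (b s / m s) = (Real.exp (4/9 * s) / m s) * (ε * D s) := by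
        simp only [hb]; ring
      rw [h3] at h2
      exact pos_of_mul_pos_right h2 (by positivity)
    rcases lt_or_gt_of_ne hx with h | h
    · exact ⟨-1, Or.inr rfl, hsign _ (by linarith), hr⟩
    · exact ⟨1, Or.inl rfl, hsign _ (by linarith), hr⟩
  by_cases hα0 : α = 0
  · by_cases hβ0 : β = 0
    · exfalso
      have hub : ∀ s, R ≤ s → N s * Real.exp (10/9 * s) ≤ (k ^ 2 + k2 ^ 2) * Real.exp (-(2/9) * s) := by
        intro s hs
        have h1 := hα s hs
        have h2 := hβ s hs
        rw [hα0, sub_zero] at h1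
        rw [hβ0, hα0, zero_div, zero_mul, sub_zero, sub_zero] at h2
        have h3 := sq_le_sq' (abs_le.1 h1).1 (abs_le.1 h1).2
        have h4 := sq_le_sq' (abs_le.1 h2).1 (abs_le.1 h2).2
        have e1 : N s * Real.exp (10/9 * s) = (a s ^ 2 + b s ^ 2) * Real.exp (2/9 * s) := by
          have : Real.exp (10/9 * s) = Real.exp (4/9 * s) ^ 2 * Real.exp (2/9 * s) := by
            rw [← Real.exp_nat_mul, ← Real.exp_add]; congr 1; push_cast; ring
          rw [this]; simp only [hN, ha, hb]; ring
        have e2 : Real.exp (-(2/9) * s) = Real.exp (-(2/9) * s) ^ 2 * Real.exp (2/9 * s) := by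
          rw [← Real.exp_nat_mul, ← Real.exp_add]; congr 1; push_cast; ring
        rw [e1, e2, ← mul_assoc]
        refine mul_le_mul_of_nonneg_right ?_ (Real.exp_pos _).le
        calc _ ≤ _ := add_le_add h3 h4
          _ = _ := by ring
      have h5 : c1 ≤ 0 := by
        refine ge_of_tendsto (hexpk (k ^ 2 + k2 ^ 2)) ?_
        filter_upwards [eventually_ge_atTop R] with s hs using (hlow s hs).trans (hub s hs)
      linarith
    · refine fin (fun _ => 1) β hβ0 (Eventually.of_forall fun _ => one_pos) ?_ ?_
      · simpa [hα0] using hb_lim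
      · simpa [hα0] using ha_lim
  · refine fin (fun s => s) (α / 9) (by positivity) (eventually_gt_atTop 0) ?_ ?_
    · have h1 := (hb_lim.div_atTop tendsto_id).add_const (α / 9)
      rw [zero_add] at h1
      refine h1.congr' ?_
      filter_upwards [eventually_gt_atTop 0] with s hs
      simp only [id]
      field_simp
      ring
    · exact ha_lim.div_atTop tendsto_id

set_option maxHeartbeats 1600000 in
lemma main_aux (x y : ℝ) (hxy : x + y = 9) (hx2 : 2 ≤ x) (hy2 : 2 ≤ y)
    (Z D : ℝ → ℝ) (s0 : ℝ)
    (hZ : ∀ s, s0 ≤ s → HasDerivAt Z (2/9 * D s * (x * y * Z s * D s + x * y / 9 * D s ^ 2 - 8/9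
      + (x - y) * Z s)) s)
    (hD : ∀ s, s0 ≤ s → HasDerivAt D (D s * (x * y / 9 * D s ^ 2 - 8/9) + Z s) s)
    (hB0 : x * Z s0 + x * y / 9 * D s0 ^ 2 < 8/9)
    (hA0 : -y * Z s0 + x * y / 9 * D s0 ^ 2 < 8/9)
    (hne : 0 < (9 * Z s0 - 4 * D s0) ^ 2 + D s0 ^ 2) :
    (∀ s, s0 ≤ s → 0 < (9 * Z s - 4 * D s) ^ 2 + D s ^ 2) ∧
    ∃ ε : ℝ, (ε = 1 ∨ ε = -1) ∧ (∀ᶠ s in atTop, 0 < ε * D s) ∧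
      Tendsto (fun s => (9 * Z s - 4 * D s) / D s) atTop (𝓝 0) := by
  obtain ⟨P, hP⟩ : ∃ P, P = x * y := ⟨_, rfl⟩
  obtain ⟨e, he⟩ : ∃ e, e = x - y := ⟨_, rfl⟩
  have hP1 : 14 ≤ P := by nlinarith
  have hP2 : P ≤ 21 := by nlinarith [sq_nonneg (x - y)]
  have he1 : e ≤ 5 := by linarith
  have he2 : -5 ≤ e := by linarith
  set A : ℝ → ℝ := fun s => 8/9 - P / 9 * D s ^ 2 + y * Z s with hA
  set B : ℝ → ℝ := fun s => 8/9 - P / 9 * D s ^ 2 - x * Z s with hB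
  have hDc : ContinuousOn D (Ici s0) := fun s hs => (hD s hs).continuousAt.continuousWithinAt
  have hAd : ∀ s, s0 ≤ s → HasDerivAt A (2/9 * (P * D s ^ 2 - y * D s) * A s) s := by
    intro s hs
    have := ((((hD s hs).pow 2).const_mul (P/9)).const_sub (8/9)).add ((hZ s hs).const_mul y)
    refine this.congr_deriv ?_
    have hx : x = 9 - y := by linarith
    simp only [hA, hP]
    subst hx
    push_cast
    ring
  have hBd : ∀ s, s0 ≤ s → HasDerivAt B (2/9 * (P * D s ^ 2 + x * D s) * B s) s := by
    intro s hs
    have := ((((hD s hs).pow 2).const_mul (P/9)).const_sub (8/9)).sub ((hZ s hs).const_mul x)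
    refine this.congr_deriv ?_
    have hy : y = 9 - x := by linarith
    simp only [hB, hP]
    subst hy
    push_cast
    ring
  have hApos : ∀ s, s0 ≤ s → 0 < A s := by
    intro s hs
    have hc : ContinuousOn D (Icc s0 s) := hDc.mono Icc_subset_Ici_self
    exact lin_pos (c := fun s => 2/9 * (P * D s ^ 2 - y * D s)) hs (by fun_prop)
      (fun u hu => hAd u hu.1) (by simp only [hA, hP]; linarith)
  have hBpos : ∀ s, s0 ≤ s → 0 < B s := by
    intro s hs
    have hc : ContinuousOn D (Icc s0 s) := hDc.mono Icc_subset_Ici_self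
    exact lin_pos (c := fun s => 2/9 * (P * D s ^ 2 + x * D s)) hs (by fun_prop)
      (fun u hu => hBd u hu.1) (by simp only [hB, hP]; linarith)
  have hQ : ∀ s, s0 ≤ s → 0 ≤ 8/9 - P / 9 * D s ^ 2 := by
    intro s hs
    have h1 := hApos s hs
    have h2 := hBpos s hs
    simp only [hA, hB] at h1 h2
    nlinarith [mul_pos (by linarith : 0 < x) h1, mul_pos (by linarith : 0 < y) h2]
  have hD1 : ∀ s, s0 ≤ s → |D s| ≤ 1 := by
    intro s hs
    have := hQ s hs
    refine abs_le_of_sq_le_sq ?_ (by norm_num)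
    nlinarith [mul_nonneg (by linarith : 0 ≤ P - 14) (sq_nonneg (D s))]
  have hPD : ∀ s, 0 ≤ P / 9 * D s ^ 2 := fun s => by positivity
  have hZ1 : ∀ s, s0 ≤ s → |Z s| ≤ 1 := by
    intro s hs
    have h1 := hApos s hs
    have h2 := hBpos s hs
    have := hPD s
    simp only [hA, hB] at h1 h2
    rw [abs_le]; constructor
    · by_contra hc
      nlinarith
    · by_contra hc
      nlinarith
  set W : ℝ → ℝ := fun s => 9 * Z s - 4 * D s with hW
  set H1 : ℝ → ℝ := fun s => 2 * D s * (P * Z s * D s + P / 9 * D s ^ 2 + e * Z s)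
    - 4 * (P / 9 * D s ^ 3) with hH1
  set H2 : ℝ → ℝ := fun s => P / 9 * D s ^ 3 with hH2
  have hWd : ∀ s, s0 ≤ s → HasDerivAt W (-(4/9) * W s + H1 s) s := by
    intro s hs
    refine (((hZ s hs).const_mul 9).sub ((hD s hs).const_mul 4)).congr_deriv ?_
    simp only [hW, hH1, hP, he]; ring
  have hDd : ∀ s, s0 ≤ s → HasDerivAt D (-(4/9) * D s + W s / 9 + H2 s) s := by
    intro s hs
    refine (hD s hs).congr_deriv ?_
    simp only [hW, hH2, hP]; ring
  have hD3 : ∀ s, s0 ≤ s → |D s ^ 3| ≤ D s ^ 2 := by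
    intro s hs
    rw [pow_succ, abs_mul, abs_of_nonneg (sq_nonneg (D s))]
    nlinarith [hD1 s hs, sq_nonneg (D s)]
  have hH2b : ∀ s, s0 ≤ s → |H2 s| ≤ 100 * (W s ^ 2 + D s ^ 2) := by
    intro s hs
    have := hD3 s hs
    simp only [hH2]
    rw [abs_mul, abs_of_nonneg (by positivity : 0 ≤ P / 9)]
    nlinarith [sq_nonneg (W s), sq_nonneg (D s), abs_nonneg (D s ^ 3)]
  have hH1b : ∀ s, s0 ≤ s → |H1 s| ≤ 100 * (W s ^ 2 + D s ^ 2) := by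
    intro s hs
    have h1 : |Z s * D s ^ 2| ≤ D s ^ 2 := by
      rw [abs_mul, abs_of_nonneg (sq_nonneg (D s))]
      nlinarith [hZ1 s hs, sq_nonneg (D s)]
    have h1' : |P * (Z s * D s ^ 2)| ≤ 21 * D s ^ 2 := by
      rw [abs_mul, abs_of_nonneg (by linarith : 0 ≤ P)]
      exact mul_le_mul hP2 h1 (abs_nonneg _) (by norm_num)
    have h2 : |P * D s ^ 3| ≤ 21 * D s ^ 2 := by
      rw [abs_mul, abs_of_nonneg (by linarith : 0 ≤ P)]
      exact mul_le_mul hP2 (hD3 s hs) (abs_nonneg _) (by norm_num)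
    have h3 : |D s * Z s| ≤ W s ^ 2 + D s ^ 2 := by
      have e1 : D s * Z s = (D s * W s + 4 * D s ^ 2) / 9 := by simp only [hW]; ring
      rw [e1, abs_le]
      constructor <;> nlinarith [sq_nonneg (W s + D s), sq_nonneg (W s - D s), sq_nonneg (W s), sq_nonneg (D s)]
    have h3' : |e * (D s * Z s)| ≤ 5 * (W s ^ 2 + D s ^ 2) := by
      rw [abs_mul]
      exact mul_le_mul (abs_le.2 ⟨he2, he1⟩) h3 (abs_nonneg _) (by norm_num)
    have e1 : H1 s = 2 * (P * (Z s * D s ^ 2)) - 2/9 * (P * D s ^ 3) + 2 * (e * (D s * Z s)) := by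
      simp only [hH1]; ring
    rw [e1]
    have := sq_nonneg (W s)
    rw [abs_le] at *
    constructor <;> linarith
  have hWb : ∀ s, s0 ≤ s → |W s| ≤ 13 := by
    intro s hs
    have h1 := hZ1 s hs
    have h2 := hD1 s hs
    simp only [hW]
    rw [abs_le] at *
    constructor <;> linarith
  set N : ℝ → ℝ := fun s => W s ^ 2 + D s ^ 2 with hN
  set N' : ℝ → ℝ := fun s => 2 * W s * (-(4/9) * W s + H1 s)
    + 2 * D s * (-(4/9) * D s + W s / 9 + H2 s) with hN'
  have hNd : ∀ s, s0 ≤ s → HasDerivAt N (N' s) s := by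
    intro s hs
    have := ((hWd s hs).pow 2).add ((hDd s hs).pow 2)
    exact this.congr_deriv (by simp [hN'])
  have hN0 : ∀ s, 0 ≤ N s := fun s => by simp only [hN]; positivity
  have hN'b : ∀ s, s0 ≤ s → |N' s| ≤ 3000 * N s := by
    intro s hs
    have b1 : |W s * H1 s| ≤ 13 * (100 * N s) := by
      rw [abs_mul]
      exact mul_le_mul (hWb s hs) (hH1b s hs) (abs_nonneg _) (by norm_num)
    have b2 : |D s * H2 s| ≤ 1 * (100 * N s) := by
      rw [abs_mul]
      exact mul_le_mul (hD1 s hs) (hH2b s hs) (abs_nonneg _) (by norm_num)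
    have b3 : |2 * (W s * D s)| ≤ N s := by
      rw [abs_le]; simp only [hN]
      constructor <;> nlinarith [sq_nonneg (W s + D s), sq_nonneg (W s - D s)]
    have e1 : N' s = - (8/9 * N s) + 2 * (W s * H1 s) + 2 * (D s * H2 s) + 1/9 * (2 * (W s * D s)) := by
      simp only [hN, hN']; ring
    have := hN0 s
    rw [e1]
    rw [abs_le] at *
    constructor <;> linarith
  have hNpos : ∀ s, s0 ≤ s → 0 < N s := by
    intro s hs
    refine gron_pos (f := N) (f' := N') (K := 3000) hs (fun u hu => hNd u hu.1) (fun u hu => ?_) hne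
    linarith [(abs_le.1 (hN'b u hu.1)).1]
  have hNb : ∀ s, s0 ≤ s → N s ≤ 170 := by
    intro s hs
    have h1 := sq_le_sq' (abs_le.1 (hWb s hs)).1 (abs_le.1 (hWb s hs)).2
    have h2 := sq_le_sq' (abs_le.1 (hD1 s hs)).1 (abs_le.1 (hD1 s hs)).2
    simp only [hN]; linarith
  have hlim : Tendsto N atTop (𝓝 0) := by
    refine barb (F := fun s => x * Real.log (A s) + y * Real.log (B s) + D s * Z s)
      (F' := fun s => 2 * P * D s ^ 2 + ((D s * (P / 9 * D s ^ 2 - 8/9) + Z s) * Z s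
        + D s * (2/9 * D s * (P * Z s * D s + P / 9 * D s ^ 2 - 8/9 + e * Z s))))
      (g' := N') (T := s0) (c := 1/400) (K := 3000 * 170) (M := 100) (B := 170)
      (by norm_num) (by norm_num) (by norm_num) ?_ hNd ?_ (fun s _ => hN0 s) hNb
      (fun s hs => (hN'b s hs).trans (by linarith [hNb s hs])) ?_
    · intro s hs
      refine (((((hAd s hs).log (hApos s hs).ne').const_mul x).add
        (((hBd s hs).log (hBpos s hs).ne').const_mul y)).add ((hD s hs).mul (hZ s hs))).congr_deriv ?_
      have h1 := (hApos s hs).ne'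
      have h2 := (hBpos s hs).ne'
      rw [mul_div_cancel_right₀ _ h1, mul_div_cancel_right₀ _ h2, hP, he]
      have hx : x = 9 - y := by linarith
      subst hx
      ring
    · intro s hs
      have q0 := hQ s hs
      have q1 := hPD s
      have z1 := abs_le.1 (hZ1 s hs)
      have d1 := abs_le.1 (hD1 s hs)
      have p1 : |P * (Z s * D s)| ≤ 21 := by
        rw [abs_mul, abs_of_nonneg (by linarith : 0 ≤ P), abs_mul]
        have : |Z s| * |D s| ≤ 1 * 1 := mul_le_mul (hZ1 s hs) (hD1 s hs) (abs_nonneg _) (by norm_num)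
        nlinarith [mul_nonneg (abs_nonneg (Z s)) (abs_nonneg (D s))]
      have p2 : |e * Z s| ≤ 5 := by
        rw [abs_mul]
        have := mul_le_mul (abs_le.2 ⟨he2, he1⟩) (hZ1 s hs) (abs_nonneg _) (by norm_num : (0:ℝ) ≤ 5)
        linarith
      have p3 : -30 ≤ P * Z s * D s + P / 9 * D s ^ 2 - 8/9 + e * Z s := by
        have := (abs_le.1 p1).1
        have := (abs_le.1 p2).1
        linarith
      have p4 : -30 * D s ^ 2 ≤ D s ^ 2 * (P * Z s * D s + P / 9 * D s ^ 2 - 8/9 + e * Z s) := by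
        nlinarith [sq_nonneg (D s)]
      have p5 : -(D s ^ 2 + Z s ^ 2) / 2 ≤ (D s * Z s) * (P / 9 * D s ^ 2 - 8/9) := by
        have h1 : |D s * Z s| ≤ (D s ^ 2 + Z s ^ 2) / 2 := by
          rw [abs_le]; constructor <;> nlinarith [sq_nonneg (D s + Z s), sq_nonneg (D s - Z s)]
        have h2 : |P / 9 * D s ^ 2 - 8/9| ≤ 1 := by
          rw [abs_le]; constructor <;> linarith
        have h3 : |(D s * Z s) * (P / 9 * D s ^ 2 - 8/9)| ≤ (D s ^ 2 + Z s ^ 2) / 2 * 1 := by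
          rw [abs_mul]; exact mul_le_mul h1 h2 (abs_nonneg _) (by positivity)
        linarith [(abs_le.1 h3).1]
      have p6 : 28 * D s ^ 2 ≤ 2 * P * D s ^ 2 := by nlinarith [sq_nonneg (D s)]
      have p7 : N s ≤ 162 * Z s ^ 2 + 33 * D s ^ 2 := by
        simp only [hN, hW]; nlinarith [sq_nonneg (9 * Z s + 4 * D s)]
      nlinarith [sq_nonneg (D s), sq_nonneg (Z s)]
    · intro s hs
      have q1 := hPD s
      have z1 := abs_le.1 (hZ1 s hs)
      have a1 : Real.log (A s) ≤ 8 := by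
        have := Real.log_le_sub_one_of_pos (hApos s hs)
        have : A s ≤ 9 := by simp only [hA]; nlinarith
        linarith
      have b1 : Real.log (B s) ≤ 8 := by
        have := Real.log_le_sub_one_of_pos (hBpos s hs)
        have : B s ≤ 9 := by simp only [hB]; nlinarith
        linarith
      have c1 : D s * Z s ≤ 1 := by
        have h3 : |D s * Z s| ≤ 1 * 1 := by
          rw [abs_mul]; exact mul_le_mul (hD1 s hs) (hZ1 s hs) (abs_nonneg _) (by norm_num)
        linarith [(abs_le.1 h3).2]
      nlinarith
  exact ⟨hNpos, asym (by norm_num) hWd hDd hH1b hH2b hNpos hlim⟩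

/-- For `n = d1 + d2 = 9`, any solution of the `H = 1` subsystem
defined on `[s0, ∞)`, starting in the interior of `S₁` and not at the origin,
never reaches the origin, and its normalization converges to `±(4, 9)/√97`
as `s → +∞`.  A point `p : ℝ × ℝ` encodes `(Z, Δ) = (p.1, p.2)`. -/
theorem stmt13 (d1 d2 : ℕ) (hd1 : 2 ≤ d1) (hd2 : 2 ≤ d2) (n : ℕ) (hn : n = d1 + d2)
    (hn9 : n = 9)
    (V : ℝ × ℝ → ℝ × ℝ)
    (hV : ∀ p : ℝ × ℝ,
      V p = ((2 / n) * p.2 * ((d1 : ℝ) * d2 * p.1 * p.2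
               + ((d1 : ℝ) * d2 / n) * p.2 ^ 2 - ((n : ℝ) - 1) / n
               + ((d1 : ℝ) - (d2 : ℝ)) * p.1),
             p.2 * (((d1 : ℝ) * d2 / n) * p.2 ^ 2 - ((n : ℝ) - 1) / n) + p.1))
    (intS1 : Set (ℝ × ℝ))
    (hintS1 : intS1 = {p : ℝ × ℝ |
      (d1 : ℝ) * p.1 + ((d1 : ℝ) * d2 / n) * p.2 ^ 2 < ((n : ℝ) - 1) / n ∧
      -(d2 : ℝ) * p.1 + ((d1 : ℝ) * d2 / n) * p.2 ^ 2 < ((n : ℝ) - 1) / n})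
    (γ : ℝ → ℝ × ℝ) (s0 : ℝ)
    (hsol : ∀ s : ℝ, s0 ≤ s → HasDerivAt γ (V (γ s)) s)
    (hstart : γ s0 ∈ intS1) (hne : γ s0 ≠ ((0 : ℝ), (0 : ℝ))) :
    (∀ s : ℝ, s0 ≤ s → γ s ≠ ((0 : ℝ), (0 : ℝ))) ∧
    (∃ ε : ℝ, (ε = 1 ∨ ε = -1) ∧
      Filter.Tendsto
        (fun s => (Real.sqrt ((γ s).1 ^ 2 + (γ s).2 ^ 2))⁻¹ • γ s)
        Filter.atTop
        (nhds (ε • ((Real.sqrt 97)⁻¹ • ((4 : ℝ), (9 : ℝ)))))) := by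
  subst hintS1
  have hn' : (n : ℝ) = 9 := by exact_mod_cast hn9
  have hxy : (d1 : ℝ) + d2 = 9 := by
    have : d1 + d2 = 9 := by omega
    exact_mod_cast this
  simp only [hn'] at hV hstart
  obtain ⟨hB0, hA0⟩ := hstart
  have hpr : ∀ s, s0 ≤ s → HasDerivAt (fun s => (γ s).1) (V (γ s)).1 s ∧
      HasDerivAt (fun s => (γ s).2) (V (γ s)).2 s := by
    intro s hs
    exact ⟨(hsol s hs).fst, (hsol s hs).snd⟩
  have hz : ∀ p : ℝ × ℝ, p ≠ ((0 : ℝ), (0 : ℝ)) ↔ 0 < (9 * p.1 - 4 * p.2) ^ 2 + p.2 ^ 2 := by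
    intro p
    constructor
    · intro hp
      by_contra hc
      apply hp
      have h2 : p.2 = 0 := by
        have : p.2 ^ 2 = 0 := by nlinarith [sq_nonneg (9 * p.1 - 4 * p.2), sq_nonneg p.2]
        exact pow_eq_zero_iff (two_ne_zero) |>.1 this
      have h1 : p.1 = 0 := by
        rw [h2] at hc
        have : p.1 ^ 2 = 0 := by nlinarith [sq_nonneg p.1]
        exact pow_eq_zero_iff (two_ne_zero) |>.1 this
      exact Prod.ext h1 h2
    · rintro h rfl
      simp at h
  obtain ⟨h1, ε, hε, hpos, hlim⟩ := main_aux (d1 : ℝ) d2 hxy (by exact_mod_cast hd1)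
    (by exact_mod_cast hd2) (fun s => (γ s).1) (fun s => (γ s).2) s0
    (fun s hs => (hpr s hs).1.congr_deriv (by rw [hV]; norm_num))
    (fun s hs => (hpr s hs).2.congr_deriv (by rw [hV]; norm_num))
    (by norm_num at hB0 ⊢; exact hB0) (by norm_num at hA0 ⊢; linarith)
    ((hz _).1 hne)
  refine ⟨fun s hs => (hz _).2 (h1 s hs), ε, hε, ?_⟩
  set m : ℝ → ℝ := fun s => (γ s).1 / (γ s).2 with hm
  have hmlim : Tendsto m atTop (𝓝 (4/9)) := by
    have h2 := (hlim.const_mul (1/9)).add_const (4/9)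
    rw [mul_zero, zero_add] at h2
    refine h2.congr' ?_
    filter_upwards [hpos] with s hs
    have : (γ s).2 ≠ 0 := by
      intro h; rw [h] at hs; simp at hs
    simp only [hm]
    field_simp
    ring
  have hcont : Continuous (fun t : ℝ => ε • ((Real.sqrt (t ^ 2 + 1))⁻¹ • ((t, 1) : ℝ × ℝ))) := by
    have : Continuous (fun t : ℝ => (Real.sqrt (t ^ 2 + 1))⁻¹) := by
      refine Continuous.inv₀ (by fun_prop) (fun t => ?_)
      positivity
    fun_prop
  have hfin := (hcont.tendsto (4/9)).comp hmlim
  have hval : (Real.sqrt ((4/9 : ℝ) ^ 2 + 1))⁻¹ • ((4/9, 1) : ℝ × ℝ)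
      = (Real.sqrt 97)⁻¹ • ((4 : ℝ), (9 : ℝ)) := by
    have e1 : Real.sqrt ((4/9 : ℝ) ^ 2 + 1) = Real.sqrt 97 / 9 := by
      rw [show ((4/9 : ℝ) ^ 2 + 1) = 97 / 9 ^ 2 by norm_num, Real.sqrt_div (by norm_num),
        Real.sqrt_sq (by norm_num)]
    have h97 : Real.sqrt 97 ≠ 0 := by positivity
    rw [e1]
    ext <;> simp <;> field_simp
  rw [hval] at hfin
  refine hfin.congr' ?_
  filter_upwards [hpos] with s hs
  have hε2 : ε * ε = 1 := by rcases hε with h | h <;> rw [h] <;> norm_num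
  have hne2 : (γ s).2 ≠ 0 := by
    intro h; rw [h] at hs; simp at hs
  have e1 : (γ s).1 ^ 2 + (γ s).2 ^ 2 = (ε * (γ s).2) ^ 2 * (m s ^ 2 + 1) := by
    have : (ε * (γ s).2) ^ 2 = (γ s).2 ^ 2 := by
      rw [mul_pow, pow_two ε, hε2, one_mul]
    rw [this]
    simp only [hm]
    field_simp
  have e2 : Real.sqrt ((γ s).1 ^ 2 + (γ s).2 ^ 2) = ε * (γ s).2 * Real.sqrt (m s ^ 2 + 1) := by
    rw [e1, Real.sqrt_mul (sq_nonneg _), Real.sqrt_sq hs.le]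
  have hq : Real.sqrt (m s ^ 2 + 1) ≠ 0 := by positivity
  have hεne : ε ≠ 0 := by rintro rfl; simp at hε2
  have hm1 : (γ s).1 = m s * (γ s).2 := by simp only [hm]; field_simp
  simp only [Function.comp]
  rw [e2]
  have hε3 : ε ^ 2 = 1 := by rw [pow_two, hε2]
  ext
  · simp only [Prod.smul_fst, smul_eq_mul]
    rw [hm1]
    field_simp
    linear_combination (m s) * hε3
  · simp only [Prod.smul_snd, smul_eq_mul]
    field_simp
    linear_combination hε3
end

section
/- Let c : [0, 1] → ℝ² be a continuous closed curve (c(0) = c(1)). Call a point p ∈ ℝ² a self-intersection point of c if there exist t1 ≠ t2 in [0, 1) with c(t1) = c(t2) = p. Assume that the set of self-intersection points of c is finite and that every self-intersection point has exactly two preimages in [0, 1). If x ∈ ℝ² does not lie on the image of c and the winding number of c around x is an integer k ≥ 1, then c has at least k − 1 self-intersection points. -/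
open Set

/-- A continuous angle starting at `0`, with nonnegative sine, ending on the negative real axis,
ends at `π`. -/
lemma angle_end (θ : ℝ → ℝ) (hθ : Continuous θ) (L : ℝ) (h0 : θ 0 = 0)
    (hs : ∀ t, 0 ≤ Real.sin (θ t)) (hsL : Real.sin (θ L) = 0) (hcL : Real.cos (θ L) < 0) :
    θ L = Real.pi := by
  have hpi := Real.pi_pos
  have ivt : uIcc (θ 0) (θ L) ⊆ θ '' uIcc 0 L := intermediate_value_uIcc hθ.continuousOn
  have h1 : θ L ≤ Real.pi := by
    by_contra! h
    have hv : min (θ L) (3 * Real.pi / 2) ∈ uIcc (θ 0) (θ L) := by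
      rw [h0, uIcc_of_le (by linarith)]
      exact ⟨le_min (by linarith) (by linarith), min_le_left _ _⟩
    obtain ⟨t, -, ht⟩ := ivt hv
    have h2 := hs t
    have h3 : Real.pi < θ t := by rw [ht]; exact lt_min h (by linarith)
    have h4 : θ t ≤ 3 * Real.pi / 2 := by rw [ht]; exact min_le_right _ _
    have h5 := Real.sin_pos_of_pos_of_lt_pi (x := θ t - Real.pi) (by linarith) (by linarith)
    rw [Real.sin_sub_pi] at h5
    linarith
  have h2 : 0 ≤ θ L := by
    by_contra! h
    have hv : max (θ L) (-(Real.pi / 2)) ∈ uIcc (θ 0) (θ L) := by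
      rw [h0, uIcc_of_ge (by linarith)]
      exact ⟨le_max_left _ _, max_le (by linarith) (by linarith)⟩
    obtain ⟨t, -, ht⟩ := ivt hv
    have h2 := hs t
    have h3 : θ t < 0 := by rw [ht]; exact max_lt h (by linarith)
    have h4 : -(Real.pi / 2) ≤ θ t := by rw [ht]; exact le_max_right _ _
    have h5 := Real.sin_neg_of_neg_of_neg_pi_lt (x := θ t) h3 (by linarith)
    linarith
  by_contra h
  have h3 : θ L < Real.pi := lt_of_le_of_ne h1 h
  rcases h2.eq_or_lt with h4 | h4
  · rw [← h4, Real.cos_zero] at hcL; linarith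
  · have := Real.sin_pos_of_pos_of_lt_pi h4 h3
    linarith

/-- Key lemma: a quasi-periodic curve in the plane with vertical shift `k > 1` meets its own
unit vertical translate within one period. -/
lemma exists_unit_chord (G : ℝ → ℝ × ℝ) (hG : Continuous G) (L : ℝ) (hL : 0 < L) (k : ℝ)
    (hk : 1 < k) (hper : ∀ t, G (t + L) = G t + (0, k)) :
    ∃ s τ, 0 < τ ∧ τ < L ∧ G (s + τ) = G s + (0, 1) := by
  by_contra! hne
  let cl : ℝ → ℝ := fun t => max 0 (min t L)
  have hcl : Continuous cl := by fun_prop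
  have hcl0 : cl 0 = 0 := by simp [cl, hL.le]
  have hclL : cl L = L := by simp [cl, hL.le]
  let W : C(ℝ × ℝ, ℂ) := ⟨fun p =>
    ((1 - ((G (p.1 + cl p.2)).2 - (G p.1).2) : ℝ) : ℂ) +
      ((((G (p.1 + cl p.2)).1 - (G p.1).1) : ℝ) : ℂ) * Complex.I, by fun_prop⟩
  have hW : ∀ p, W p = ((1 - ((G (p.1 + cl p.2)).2 - (G p.1).2) : ℝ) : ℂ) +
      ((((G (p.1 + cl p.2)).1 - (G p.1).1) : ℝ) : ℂ) * Complex.I := fun p => rfl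
  have hre : ∀ p, (W p).re = 1 - ((G (p.1 + cl p.2)).2 - (G p.1).2) := by
    intro p; rw [hW]; simp
  have him : ∀ p, (W p).im = (G (p.1 + cl p.2)).1 - (G p.1).1 := by
    intro p; rw [hW]; simp
  have hW0 : ∀ s, W (s, 0) = 1 := by
    intro s
    apply Complex.ext
    · rw [hre]; simp [hcl0]
    · rw [him]; simp [hcl0]
  have hWL : ∀ s, W (s, L) = ((1 - k : ℝ) : ℂ) := by
    intro s
    apply Complex.ext
    · rw [hre]; simp [hclL, hper]
    · rw [him]; simp [hclL, hper]
  have hWne : ∀ p, W p ∈ ({0}ᶜ : Set ℂ) := by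
    rintro ⟨s, t⟩ h0
    rw [mem_singleton_iff] at h0
    have h1 := hre (s, t)
    have h2 := him (s, t)
    rw [h0] at h1 h2
    simp only [Complex.zero_re, Complex.zero_im] at h1 h2
    rcases lt_or_ge 0 t with ht | ht
    · rcases lt_or_ge t L with ht' | ht'
      · have hc : cl t = t := by simp [cl, ht.le, ht'.le]
        rw [hc] at h1 h2
        apply hne s t ht ht'
        ext
        · simp; linarith
        · simp; linarith
      · have hc : cl t = L := by simp [cl, ht', hL.le]
        rw [hc, hper] at h1
        simp at h1
        linarith
    · have hc : cl t = 0 := by simp [cl, ht]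
      rw [hc] at h1
      simp at h1
  obtain ⟨Λ, ⟨hΛ0, hΛ⟩, -⟩ := Complex.isCoveringMapOn_exp.existsUnique_continuousMap_lifts W
    (a₀ := ((0 : ℝ), (0 : ℝ))) (e₀ := 0) (by rw [hW0]; simp) hWne
  have hexp : ∀ p, Complex.exp (Λ p) = W p := fun p => congrFun hΛ p
  have hc0 : ∀ s, Λ (s, 0) = 0 := by
    intro s
    have := Complex.isCoveringMap_exp.const_of_comp (g := fun s : ℝ => Λ (s, 0)) (by fun_prop)
      (by intro a b; apply Subtype.ext; simp only [hexp, hW0]) s 0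
    simpa [hΛ0] using this
  have hcL : ∀ s s', Λ (s, L) = Λ (s', L) := by
    intro s s'
    exact Complex.isCoveringMap_exp.const_of_comp (g := fun s : ℝ => Λ (s, L)) (by fun_prop)
      (by intro a b; apply Subtype.ext; simp only [hexp, hWL]) s s'
  have hsin : ∀ p, (W p).im = Real.exp (Λ p).re * Real.sin (Λ p).im := by
    intro p; rw [← hexp, Complex.exp_im]
  have hcos : ∀ p, (W p).re = Real.exp (Λ p).re * Real.cos (Λ p).im := by
    intro p; rw [← hexp, Complex.exp_re]
  have hsL : ∀ s, Real.sin (Λ (s, L)).im = 0 := by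
    intro s
    have h := hsin (s, L)
    rw [hWL, Complex.ofReal_im] at h
    exact (mul_eq_zero.1 h.symm).resolve_left (Real.exp_ne_zero _)
  have hcoL : ∀ s, Real.cos (Λ (s, L)).im < 0 := by
    intro s
    have h := hcos (s, L)
    rw [hWL, Complex.ofReal_re] at h
    by_contra! h'
    have := mul_nonneg (Real.exp_pos (Λ (s, L)).re).le h'
    linarith
  have hP : Function.Periodic (fun t => (G t).1) L := by intro t; simp [hper]
  have hcomp := hP.compact_of_continuous hL.ne' (by fun_prop)
  obtain ⟨M, ⟨a, ha⟩, hM⟩ := hcomp.exists_isGreatest (range_nonempty _)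
  obtain ⟨m, ⟨b, hb⟩, hm⟩ := hcomp.exists_isLeast (range_nonempty _)
  have eb := angle_end (fun t => (Λ (b, t)).im) (by fun_prop) L (by simp [hc0])
    (by
      intro t
      have h := hsin (b, t)
      rw [him] at h
      have h1 : m ≤ (G (b + cl t)).1 := hm ⟨_, rfl⟩
      by_contra! h'
      have := mul_neg_of_pos_of_neg (Real.exp_pos (Λ (b, t)).re) h'
      simp only at hb h this
      linarith) (hsL b) (hcoL b)
  have ea := angle_end (fun t => -(Λ (a, t)).im) (by fun_prop) L (by simp [hc0])
    (by
      intro t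
      have h := hsin (a, t)
      rw [him] at h
      have h1 : (G (a + cl t)).1 ≤ M := hM ⟨_, rfl⟩
      rw [Real.sin_neg]
      by_contra! h'
      have := mul_pos (Real.exp_pos (Λ (a, t)).re) (neg_lt_zero.1 h')
      simp only at ha h this
      linarith) (by simp [hsL a]) (by simpa using hcoL a)
  rw [hcL a b] at ea
  linarith [Real.pi_pos]

/-- Quasi-periodic continuous extension. -/
lemma exists_ext (g : ℝ → ℝ × ℝ) (a L : ℝ) (hL : 0 < L) (v : ℝ × ℝ)
    (hg : ContinuousOn g (Icc a (a + L))) (hv : g (a + L) = g a + v) :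
    ∃ G : ℝ → ℝ × ℝ, Continuous G ∧ (∀ t, G (t + L) = G t + v) ∧
      ∀ t ∈ Ico a (a + L), G t = g t := by
  haveI : Fact (0 < L) := ⟨hL⟩
  let f : ℝ → ℝ × ℝ := fun t => g t - (t / L) • v
  have hf : f a = f (a + L) := by
    simp only [f, hv, add_div, div_self hL.ne', add_smul, one_smul]
    abel
  have hfc : ContinuousOn f (Icc a (a + L)) := by
    apply hg.sub; fun_prop
  have hc := AddCircle.liftIco_continuous hf hfc
  refine ⟨fun t => AddCircle.liftIco L a f (t : AddCircle L) + (t / L) • v, ?_, ?_, ?_⟩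
  · exact (hc.comp (AddCircle.continuous_mk' L)).add (by fun_prop)
  · intro t
    simp only [AddCircle.coe_add_period, add_div, div_self hL.ne', add_smul, one_smul]
    abel
  · intro t ht
    simp only [AddCircle.liftIco_coe_apply ht, f]
    abel

/-- Moving pairs to a base interval. -/
lemma pair_base {Q : Type*} (F : ℝ → Q) (a L : ℝ) (hL : 0 < L) (hF : Function.Periodic F L)
    (P : Q → Prop)
    (h : ∀ t₁ t₂, a ≤ t₁ → t₁ < t₂ → t₂ < a + L → F t₁ = F t₂ → P (F t₁)) :
    ∀ t₁ t₂, t₁ < t₂ → t₂ < t₁ + L → F t₁ = F t₂ → P (F t₁) := by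
  intro t₁ t₂ h1 h2 he
  obtain ⟨n, hn, -⟩ := existsUnique_sub_zsmul_mem_Ico hL t₁ a
  have e : ∀ t, F (t - n • L) = F t := fun t => hF.sub_zsmul_eq n
  obtain ⟨hn1, hn2⟩ := hn
  rw [← e t₁, ← e t₂] at he
  rw [← e t₁]
  generalize n • L = d at *
  rcases lt_or_ge (t₂ - d) (a + L) with h3 | h3
  · exact h _ _ hn1 (by linarith) h3 he
  · have e2 : F (t₂ - d - L) = F (t₂ - d) := hF.sub_eq _
    rw [he, ← e2]
    exact h _ (t₁ - d) (by linarith) (by linarith) hn2 (by rw [e2, he])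

lemma triple_base {Q : Type*} (F : ℝ → Q) (a L : ℝ) (hL : 0 < L) (hF : Function.Periodic F L)
    (h : ∀ t₁ t₂ t₃, a ≤ t₁ → t₁ < t₂ → t₂ < t₃ → t₃ < a + L → F t₁ = F t₂ → F t₂ = F t₃ → False) :
    ∀ t₁ t₂ t₃, t₁ < t₂ → t₂ < t₃ → t₃ < t₁ + L → F t₁ = F t₂ → F t₂ = F t₃ → False := by
  intro t₁ t₂ t₃ h1 h2 h3 he he'
  obtain ⟨n, hn, -⟩ := existsUnique_sub_zsmul_mem_Ico hL t₁ a
  have e : ∀ t, F (t - n • L) = F t := fun t => hF.sub_zsmul_eq n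
  obtain ⟨hn1, hn2⟩ := hn
  rw [← e t₁, ← e t₂] at he
  rw [← e t₂, ← e t₃] at he'
  generalize n • L = d at *
  have e2 : ∀ t, F (t - L) = F t := fun t => hF.sub_eq t
  rcases lt_or_ge (t₃ - d) (a + L) with h4 | h4
  · exact h _ _ _ hn1 (by linarith) (by linarith) h4 he he'
  rcases lt_or_ge (t₂ - d) (a + L) with h5 | h5
  · exact h (t₃ - d - L) (t₁ - d) (t₂ - d) (by linarith) (by linarith) (by linarith) h5
      (by rw [e2, ← he', he]) he
  · exact h (t₂ - d - L) (t₃ - d - L) (t₁ - d) (by linarith) (by linarith) (by linarith) hn2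
      (by rw [e2, e2, he']) (by rw [e2, ← he', he])

lemma main_induction {Q : Type*} [DecidableEq Q] (E : ℝ × ℝ → Q)
    (hE : ∀ p, E (p + (0, 1)) = E p) (m : ℕ) :
    ∀ (G : ℝ → ℝ × ℝ) (L : ℝ) (S : Finset Q), Continuous G → 0 < L →
      (∀ t, G (t + L) = G t + (0, (m : ℝ) + 1)) →
      (∀ t₁ t₂, t₁ < t₂ → t₂ < t₁ + L → E (G t₁) = E (G t₂) → E (G t₁) ∈ S) →
      (∀ t₁ t₂ t₃, t₁ < t₂ → t₂ < t₃ → t₃ < t₁ + L → E (G t₁) = E (G t₂) →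
        E (G t₂) = E (G t₃) → False) →
      m ≤ S.card := by
  have hEn : ∀ (n : ℕ) p, E (p + (0, (n : ℝ))) = E p := by
    intro n
    induction n with
    | zero => intro p; congr 1; ext <;> simp
    | succ n ih =>
      intro p
      rw [← ih p, ← hE (p + (0, (n : ℝ)))]
      congr 1
      ext
      · simp
      · simp; ring
  induction m with
  | zero => intros; exact Nat.zero_le _
  | succ m ih =>
    intro G L S hG hL hper hS hT
    obtain ⟨s, τ, hτ, hτL, hst⟩ := exists_unit_chord G hG L hL _
      (by push_cast; have : (0 : ℝ) ≤ m := Nat.cast_nonneg m; linarith) hper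
    have hL' : 0 < L - τ := by linarith
    have hsum : s + τ + (L - τ) = s + L := by ring
    obtain ⟨G', hG', hper', heq⟩ := exists_ext G (s + τ) (L - τ) hL' (0, (m : ℝ) + 1)
      hG.continuousOn (by
        rw [hsum, hper, hst]
        ext
        · simp
        · simp; ring)
    rw [hsum] at heq
    have hF' : Function.Periodic (fun t => E (G' t)) (L - τ) := by
      intro t
      simp only [hper']
      exact_mod_cast hEn (m + 1) (G' t)
    have hFs : E (G s) = E (G (s + τ)) := by rw [hst, hE]
    have hmem : E (G s) ∈ S := hS s (s + τ) (by linarith) (by linarith) hFs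
    have key := ih G' (L - τ) (S.erase (E (G s))) hG' hL' hper'
      (pair_base (fun t => E (G' t)) (s + τ) (L - τ) hL' hF' (fun q => q ∈ S.erase (E (G s)))
        (by
          intro t₁ t₂ h1 h2 h3 he
          rw [hsum] at h3
          simp only [heq t₁ ⟨h1, by linarith⟩, heq t₂ ⟨by linarith, h3⟩] at he ⊢
          refine Finset.mem_erase.2 ⟨fun h => ?_, hS t₁ t₂ h2 (by linarith) he⟩
          exact hT s t₁ t₂ (by linarith) h2 h3 h.symm he))
      (triple_base (fun t => E (G' t)) (s + τ) (L - τ) hL' hF'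
        (by
          intro t₁ t₂ t₃ h1 h2 h3 h4 he he'
          rw [hsum] at h4
          simp only [heq t₁ ⟨h1, by linarith⟩, heq t₂ ⟨by linarith, by linarith⟩,
            heq t₃ ⟨by linarith, h4⟩] at he he'
          exact hT t₁ t₂ t₃ h2 h3 (by linarith) he he'))
    have := Finset.card_erase_add_one hmem
    omega

/-- Let `c` be a continuous closed planar curve whose set of
self-intersection points is finite, each such point having exactly two
preimages in `[0, 1)`.  If `x` is not on the image of `c` and the winding
number of `c` around `x` (computed with a continuous angle lift of `c − x`,
using the Euclidean magnitude) is an integer `k ≥ 1`, then `c` has at least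
`k − 1` self-intersection points. -/
theorem stmt15 (c : ℝ → ℝ × ℝ)
    (hc : ContinuousOn c (Icc 0 1)) (hclosed : c 0 = c 1)
    (SelfInt : Set (ℝ × ℝ))
    (hSelfInt : SelfInt = {p : ℝ × ℝ | ∃ t1 ∈ Ico (0 : ℝ) 1, ∃ t2 ∈ Ico (0 : ℝ) 1,
      t1 ≠ t2 ∧ c t1 = p ∧ c t2 = p})
    (hfin : SelfInt.Finite)
    (htwo : ∀ p ∈ SelfInt, (Ico (0 : ℝ) 1 ∩ c ⁻¹' {p}).ncard = 2)
    (x : ℝ × ℝ) (hx : x ∉ c '' Icc 0 1)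
    (k : ℤ) (hk : 1 ≤ k)
    (φ : ℝ → ℝ) (hφ : ContinuousOn φ (Icc 0 1))
    (hlift : ∀ t ∈ Icc (0 : ℝ) 1,
      c t - x = Real.sqrt ((c t - x).1 ^ 2 + (c t - x).2 ^ 2)
        • (Real.cos (φ t), Real.sin (φ t)))
    (hwind : φ 1 - φ 0 = 2 * Real.pi * k) :
    (k - 1 : ℤ) ≤ (SelfInt.ncard : ℤ) := by
  classical
  obtain ⟨m, rfl⟩ : ∃ m : ℕ, k = m + 1 := ⟨(k - 1).toNat, by omega⟩
  have hpi := Real.pi_pos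
  let E : ℝ × ℝ → ℝ × ℝ := fun p =>
    x + p.1 • (Real.cos (2 * Real.pi * p.2), Real.sin (2 * Real.pi * p.2))
  have hE : ∀ p, E (p + (0, 1)) = E p := by
    intro p
    simp [E, mul_add]
  let g : ℝ → ℝ × ℝ := fun t =>
    (Real.sqrt ((c t - x).1 ^ 2 + (c t - x).2 ^ 2), φ t / (2 * Real.pi))
  have hgc : ∀ t ∈ Icc (0 : ℝ) 1, E (g t) = c t := by
    intro t ht
    have h1 : 2 * Real.pi * (φ t / (2 * Real.pi)) = φ t := by field_simp
    simp only [E, g, h1]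
    rw [← hlift t ht]
    abel
  have hg : ContinuousOn g (Icc 0 (0 + 1)) := by
    rw [zero_add]
    have hsub : ContinuousOn (fun t => c t - x) (Icc 0 1) := hc.sub continuousOn_const
    exact ((((continuous_fst.comp_continuousOn hsub).pow 2).add
      ((continuous_snd.comp_continuousOn hsub).pow 2)).sqrt).prodMk (hφ.div_const _)
  obtain ⟨G, hG, hper, heq⟩ := exists_ext g 0 1 one_pos (0, (m : ℝ) + 1) hg (by
    have h1 : φ 1 = φ 0 + 2 * Real.pi * (m + 1) := by push_cast at hwind; linarith
    rw [zero_add]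
    simp only [g, hclosed, h1]
    ext
    · simp
    · simp; field_simp)
  rw [zero_add] at heq
  have hEG : ∀ t ∈ Ico (0 : ℝ) 1, E (G t) = c t := by
    intro t ht
    rw [heq t ht, hgc t (Ico_subset_Icc_self ht)]
  have hF : Function.Periodic (fun t => E (G t)) 1 := by
    intro t
    simp only [hper, E]
    have : 2 * Real.pi * (G t + (0, (m : ℝ) + 1)).2
        = 2 * Real.pi * (G t).2 + ((m + 1 : ℕ) : ℝ) * (2 * Real.pi) := by
      simp; ring
    rw [this, Real.cos_add_nat_mul_two_pi, Real.sin_add_nat_mul_two_pi]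
    simp
  have hpair : ∀ t₁ t₂, 0 ≤ t₁ → t₁ < t₂ → t₂ < 1 → c t₁ = c t₂ → c t₁ ∈ SelfInt := by
    intro t₁ t₂ h1 h2 h3 he
    rw [hSelfInt]
    exact ⟨t₁, ⟨h1, by linarith⟩, t₂, ⟨by linarith, h3⟩, h2.ne, rfl, he.symm⟩
  have key := main_induction E hE m G 1 hfin.toFinset hG one_pos hper
    (pair_base (fun t => E (G t)) 0 1 one_pos hF (fun q => q ∈ hfin.toFinset) (by
      intro t₁ t₂ h1 h2 h3 he
      rw [zero_add] at h3
      simp only [hEG t₁ ⟨h1, by linarith⟩, hEG t₂ ⟨by linarith, h3⟩] at he ⊢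
      exact hfin.mem_toFinset.2 (hpair t₁ t₂ h1 h2 h3 he)))
    (triple_base (fun t => E (G t)) 0 1 one_pos hF (by
      intro t₁ t₂ t₃ h1 h2 h3 h4 he he'
      rw [zero_add] at h4
      simp only [hEG t₁ ⟨h1, by linarith⟩, hEG t₂ ⟨by linarith, by linarith⟩,
        hEG t₃ ⟨by linarith, h4⟩] at he he'
      have hn := htwo _ (hpair t₁ t₂ h1 h2 (by linarith) he)
      obtain ⟨u, v, -, huv⟩ := Set.ncard_eq_two.1 hn
      have m1 : t₁ ∈ Ico (0 : ℝ) 1 ∩ c ⁻¹' {c t₁} := ⟨⟨h1, by linarith⟩, rfl⟩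
      have m2 : t₂ ∈ Ico (0 : ℝ) 1 ∩ c ⁻¹' {c t₁} := ⟨⟨by linarith, by linarith⟩, he.symm⟩
      have m3 : t₃ ∈ Ico (0 : ℝ) 1 ∩ c ⁻¹' {c t₁} :=
        ⟨⟨by linarith, h4⟩, (he.trans he').symm⟩
      rw [huv] at m1 m2 m3
      simp only [mem_insert_iff, mem_singleton_iff] at m1 m2 m3
      rcases m1 with m1 | m1 <;> rcases m2 with m2 | m2 <;> rcases m3 with m3 | m3 <;> linarith))
  rw [Set.ncard_eq_toFinset_card SelfInt hfin]
  push_cast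
  have : (m : ℤ) ≤ (hfin.toFinset.card : ℤ) := by exact_mod_cast key
  linarith
end

section
/- Let n be an integer with 2 ≤ n ≤ 9. Then for all φ ∈ ℝ and all h ∈ [−1, 1], cos²(φ) + (2(n−1)/n²)·sin²(φ) − ((n−1)/n)·h·sin(φ)·cos(φ) ≥ 0. Moreover, if 2 ≤ n ≤ 8, then there exists a constant c > 0 such that for all φ ∈ ℝ and all h ∈ [−1, 1], cos²(φ) + (2(n−1)/n²)·sin²(φ) − ((n−1)/n)·h·sin(φ)·cos(φ) ≥ c. -/
theorem quad_aux (a b c x y h : ℝ) (hc : c < 1) (hb : b ^ 2 ≤ 4 * (1 - c) * (a - c))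
    (hxy : y ^ 2 + x ^ 2 = 1) (hh : h ∈ Set.Icc (-1 : ℝ) 1) :
    c ≤ x ^ 2 + a * y ^ 2 - b * h * y * x := by
  obtain ⟨h1, h2⟩ := hh
  have hsq : h ^ 2 ≤ 1 := by nlinarith
  have hbh : b ^ 2 * h ^ 2 ≤ b ^ 2 := mul_le_of_le_one_right (sq_nonneg b) hsq
  have key : 0 ≤ (4 * (1 - c)) * ((1 - c) * x ^ 2 + (a - c) * y ^ 2 - b * h * y * x) := by
    have e : (4 * (1 - c)) * ((1 - c) * x ^ 2 + (a - c) * y ^ 2 - b * h * y * x)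
        = (2 * (1 - c) * x - b * h * y) ^ 2
          + (4 * (1 - c) * (a - c) - b ^ 2 * h ^ 2) * y ^ 2 := by ring
    rw [e]
    have : 0 ≤ 4 * (1 - c) * (a - c) - b ^ 2 * h ^ 2 := by linarith
    positivity
  have k2 := nonneg_of_mul_nonneg_right key (by linarith : (0 : ℝ) < 4 * (1 - c))
  have e2 : c * (y ^ 2 + x ^ 2) = c := by rw [hxy, mul_one]
  linarith

/-- For `2 ≤ n ≤ 9` the right-hand side of the angle ODE along the
cone solution is non-negative for all `φ ∈ ℝ` and `h ∈ [−1, 1]`; for `2 ≤ n ≤ 8`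
it is bounded below by a positive constant. -/
theorem stmt16 (n : ℕ) (hn2 : 2 ≤ n) (hn9 : n ≤ 9) :
    (∀ φ h : ℝ, h ∈ Set.Icc (-1 : ℝ) 1 →
      0 ≤ Real.cos φ ^ 2 + (2 * ((n : ℝ) - 1) / (n : ℝ) ^ 2) * Real.sin φ ^ 2
        - (((n : ℝ) - 1) / n) * h * Real.sin φ * Real.cos φ) ∧
    (n ≤ 8 → ∃ c : ℝ, 0 < c ∧ ∀ φ h : ℝ, h ∈ Set.Icc (-1 : ℝ) 1 →
      c ≤ Real.cos φ ^ 2 + (2 * ((n : ℝ) - 1) / (n : ℝ) ^ 2) * Real.sin φ ^ 2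
        - (((n : ℝ) - 1) / n) * h * Real.sin φ * Real.cos φ) := by
  constructor
  · intro φ h hh
    refine quad_aux _ _ 0 _ _ h (by norm_num) ?_ (Real.sin_sq_add_cos_sq φ) hh
    interval_cases n <;> norm_num
  · intro hn8
    refine ⟨1 / 100, by norm_num, fun φ h hh => ?_⟩
    refine quad_aux _ _ (1 / 100) _ _ h (by norm_num) ?_ (Real.sin_sq_add_cos_sq φ) hh
    interval_cases n <;> norm_num
end

section
/- Let φ : ℝ → ℝ be the solution of the angle ODE φ'(s) = cos²(φ(s)) + (16/81)·sin²(φ(s)) − (8/9)·h(s)·sin(φ(s))·cos(φ(s)), where h(s) = −tanh(s/9), with initial condition φ(0) = 3π/2. Then φ(s) converges as s → −∞ to a limit L satisfying L < arctan(9/4). -/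
theorem aux_tanh_deriv (s : ℝ) :
    HasDerivAt (fun s : ℝ => Real.tanh (s / 9)) ((1 - Real.tanh (s / 9) ^ 2) / 9) s := by
  have h1 : HasDerivAt (fun s : ℝ => s / 9) (1 / 9) s := (hasDerivAt_id s).div_const 9
  have hc : Real.cosh (s / 9) ≠ 0 := (Real.cosh_pos _).ne'
  have h := (h1.sinh).div (h1.cosh) hc
  have e : (fun s : ℝ => Real.tanh (s / 9)) = fun s => Real.sinh (s / 9) / Real.cosh (s / 9) := by
    funext y; rw [Real.tanh_eq_sinh_div_cosh]
  rw [e]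
  refine HasDerivAt.congr_deriv (f := fun s : ℝ => Real.sinh (s / 9) / Real.cosh (s / 9)) h ?_
  rw [Real.tanh_eq_sinh_div_cosh]
  field_simp

theorem aux_tanh_sq (s : ℝ) : Real.tanh s ^ 2 < 1 := by
  have hc := Real.cosh_pos s
  rw [Real.tanh_eq_sinh_div_cosh, div_pow, div_lt_one (by positivity), Real.cosh_sq]
  linarith

/-- `V(s)`: the even Legendre function `Q₃(tanh t)`, `t = s/9`. -/
noncomputable def auxV (s : ℝ) : ℝ :=
  (s / 9) * ((5 * Real.tanh (s / 9) ^ 3 - 3 * Real.tanh (s / 9)) / 2)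
    + 2 / 3 - 5 / 2 * Real.tanh (s / 9) ^ 2

noncomputable def auxD (s : ℝ) : ℝ :=
  (5 * Real.tanh (s / 9) ^ 3 - 3 * Real.tanh (s / 9)) / 2
    + (1 - Real.tanh (s / 9) ^ 2) * ((s / 9) * ((15 * Real.tanh (s / 9) ^ 2 - 3) / 2)
      - 5 * Real.tanh (s / 9))

theorem auxV_deriv (s : ℝ) : HasDerivAt auxV (auxD s / 9) s := by
  have hx := aux_tanh_deriv s
  have h1 : HasDerivAt (fun s : ℝ => s / 9) (1 / 9) s := (hasDerivAt_id s).div_const 9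
  have h := ((h1.mul ((((hx.pow 3).const_mul 5).sub (hx.const_mul 3)).div_const 2)).add_const
    (2 / 3)).sub ((hx.pow 2).const_mul (5 / 2))
  refine HasDerivAt.congr_deriv (f := auxV) h ?_
  simp only [auxD, Pi.pow_apply, Pi.sub_apply]
  push_cast
  ring

theorem auxD_deriv (s : ℝ) :
    HasDerivAt auxD (-12 * (1 - Real.tanh (s / 9) ^ 2) * auxV s / 9) s := by
  have hx := aux_tanh_deriv s
  have h1 : HasDerivAt (fun s : ℝ => s / 9) (1 / 9) s := (hasDerivAt_id s).div_const 9
  have h := ((((hx.pow 3).const_mul 5).sub (hx.const_mul 3)).div_const 2).add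
    (((hx.pow 2).const_sub 1).mul
      ((h1.mul ((((hx.pow 2).const_mul 15).sub_const 3).div_const 2)).sub (hx.const_mul 5)))
  refine HasDerivAt.congr_deriv (f := auxD) h ?_
  simp only [auxV, Pi.pow_apply, Pi.sub_apply, Pi.mul_apply]
  push_cast
  ring

theorem auxD_ne (s : ℝ) (h : auxV s = 0) : auxD s ≠ 0 := by
  intro hd
  have hw : auxD s * ((5 * Real.tanh (s / 9) ^ 3 - 3 * Real.tanh (s / 9)) / 2)
    - auxV s * ((1 - Real.tanh (s / 9) ^ 2) * ((15 * Real.tanh (s / 9) ^ 2 - 3) / 2)) = 1 := by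
    unfold auxD auxV; ring
  rw [h, hd] at hw
  norm_num at hw


theorem aux_tanh_le (t k : ℝ) (h : 1 + k ≤ (1 - k) * Real.exp (-t) ^ 2) : Real.tanh t ≤ -k := by
  rw [Real.tanh_eq_sinh_div_cosh, div_le_iff₀ (Real.cosh_pos t), Real.sinh_eq, Real.cosh_eq]
  have hp := Real.exp_pos t
  have hm : Real.exp t * Real.exp (-t) = 1 := by rw [← Real.exp_add]; simp
  have : (1 + k) * Real.exp t ≤ (1 - k) * Real.exp (-t) := by
    calc (1 + k) * Real.exp t ≤ ((1 - k) * Real.exp (-t) ^ 2) * Real.exp t := by gcongr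
      _ = (1 - k) * Real.exp (-t) * (Real.exp t * Real.exp (-t)) := by ring
      _ = _ := by rw [hm, mul_one]
  linarith

theorem auxV_pos (s : ℝ) (hs : s ≤ -45) : 0 < auxV s := by
  have hx : Real.tanh (s / 9) ≤ -(9 / 10) := by
    apply aux_tanh_le
    have h1 : 6 ≤ Real.exp (-(s / 9)) := by
      have := Real.add_one_le_exp (-(s / 9)); linarith
    nlinarith
  have hx1 := aux_tanh_sq (s / 9)
  unfold auxV
  set x := Real.tanh (s / 9)
  have hx2 : -1 < x := by nlinarith
  have hP : (5 * x ^ 3 - 3 * x) / 2 ≤ -(47 / 100) := by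
    have : (81 / 100 : ℝ) ≤ x ^ 2 := by nlinarith
    nlinarith
  have : (-5 : ℝ) * -(47 / 100) ≤ (s / 9) * ((5 * x ^ 3 - 3 * x) / 2) := by
    nlinarith
  linarith

theorem auxV_neg : auxV (-9) < 0 := by
  have hx : Real.tanh (-9 / 9) ≤ -(1 / 2) := by
    apply aux_tanh_le
    have h1 : 2 ≤ Real.exp (-(-9 / 9)) := by
      have := Real.add_one_le_exp (-(-9 / 9 : ℝ)); linarith
    nlinarith
  have hx1 := aux_tanh_sq (-9 / 9)
  unfold auxV
  set x := Real.tanh (-9 / 9)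
  have hx2 : -1 < x := by nlinarith
  have : 0 ≤ x ^ 2 * (1 + x) := mul_nonneg (sq_nonneg _) (by linarith)
  nlinarith

theorem auxV_zero : 0 < auxV 0 := by
  simp [auxV]

theorem auxG_zero (φ : ℝ → ℝ)
    (hode : ∀ s : ℝ, HasDerivAt φ
      (Real.cos (φ s) ^ 2 + (16 / 81) * Real.sin (φ s) ^ 2
        - (8 / 9) * (-Real.tanh (s / 9)) * Real.sin (φ s) * Real.cos (φ s)) s)
    (hinit : φ 0 = 3 * Real.pi / 2) (s : ℝ) (hs : s ≤ 0) :
    auxV s * Real.cos (φ s)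
      - (auxD s - 4 * Real.tanh (s / 9) * auxV s) / 9 * Real.sin (φ s) = 0 := by
  set G : ℝ → ℝ := fun s => auxV s * Real.cos (φ s)
      - (auxD s - 4 * Real.tanh (s / 9) * auxV s) / 9 * Real.sin (φ s) with hG
  set κ : ℝ → ℝ := fun s => Real.sin (φ s) * ((16 / 81 - 1) * Real.cos (φ s)
      - 8 / 9 * Real.tanh (s / 9) * Real.sin (φ s)) + 4 / 9 * Real.tanh (s / 9) with hκ
  have hd : ∀ s, HasDerivAt G (κ s * G s) s := by
    intro s
    have hx := aux_tanh_deriv s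
    have h := ((auxV_deriv s).mul (hode s).cos).sub
      ((((auxD_deriv s).sub ((hx.const_mul 4).mul (auxV_deriv s))).div_const 9).mul (hode s).sin)
    refine HasDerivAt.congr_deriv (f := G) h ?_
    simp only [hG, hκ, Pi.pow_apply, Pi.sub_apply, Pi.mul_apply]
    have hsc := Real.sin_sq_add_cos_sq (φ s)
    generalize Real.tanh (s / 9) = x at *
    generalize auxV s = v at *
    generalize auxD s = d at *
    generalize Real.sin (φ s) = a at *
    generalize Real.cos (φ s) = b at *
    have hb : b ^ 2 = 1 - a ^ 2 := by linarith
    have hb3 : b ^ 3 = b * (1 - a ^ 2) := by rw [← hb]; ring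
    ring_nf
    simp only [hb, hb3]
    ring
  have hκb : ∀ s, -4 ≤ κ s := by
    intro s
    have hsc := Real.sin_sq_add_cos_sq (φ s)
    have hx1 := aux_tanh_sq (s / 9)
    simp only [hκ]
    generalize Real.tanh (s / 9) = x at *
    generalize Real.sin (φ s) = a at *
    generalize Real.cos (φ s) = b at *
    have hxl : -1 < x := by nlinarith
    have hxu : x < 1 := by nlinarith
    have ha : a ^ 2 ≤ 1 := by nlinarith
    have h1 : a * b ≤ 1 := by nlinarith [sq_nonneg (a - b)]
    have h2 : x * a ^ 2 ≤ 1 := by nlinarith [sq_nonneg a]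
    nlinarith
  have hF : Monotone (fun s => G s ^ 2 * Real.exp (8 * s)) := by
    have hFd : ∀ s, HasDerivAt (fun s => G s ^ 2 * Real.exp (8 * s))
        (2 * (κ s + 4) * (G s ^ 2 * Real.exp (8 * s))) s := by
      intro s
      have h := ((hd s).pow 2).mul (((hasDerivAt_id s).const_mul 8).exp)
      refine HasDerivAt.congr_deriv (f := fun s => G s ^ 2 * Real.exp (8 * s)) h ?_
      simp only [Pi.pow_apply, id]
      push_cast
      ring
    apply monotone_of_deriv_nonneg (fun s => (hFd s).differentiableAt)
    intro s
    rw [(hFd s).deriv]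
    have := hκb s
    have : 0 ≤ κ s + 4 := by linarith
    positivity
  have h0 : G 0 = 0 := by
    have hc : Real.cos (3 * Real.pi / 2) = 0 := by
      rw [show 3 * Real.pi / 2 = Real.pi / 2 + Real.pi by ring, Real.cos_add_pi]; simp
    simp [hG, hinit, hc, auxD]
  have := hF hs
  simp only [h0] at this
  have hp := Real.exp_pos (8 * s)
  have h2 : G s ^ 2 ≤ 0 := by
    by_contra hh
    push Not at hh
    have := mul_pos hh hp
    linarith
  exact pow_eq_zero_iff (two_ne_zero) |>.1 (le_antisymm h2 (sq_nonneg _))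


/-- The solution of the angle ODE
`φ' = cos²φ + (16/81)·sin²φ − (8/9)·h(s)·sinφ·cosφ`, `h(s) = −tanh(s/9)`,
with `φ(0) = 3π/2`, converges as `s → −∞` to a limit `L < arctan(9/4)`. -/
theorem stmt17 (φ : ℝ → ℝ)
    (hode : ∀ s : ℝ, HasDerivAt φ
      (Real.cos (φ s) ^ 2 + (16 / 81) * Real.sin (φ s) ^ 2
        - (8 / 9) * (-Real.tanh (s / 9)) * Real.sin (φ s) * Real.cos (φ s)) s)
    (hinit : φ 0 = 3 * Real.pi / 2) :
    ∃ L : ℝ, Filter.Tendsto φ Filter.atBot (nhds L) ∧ L < Real.arctan (9 / 4) := by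
  have hG := auxG_zero φ hode hinit
  have hcont : Continuous φ := continuous_iff_continuousAt.2 fun s => (hode s).continuousAt
  have hmono : StrictMono φ := by
    apply strictMono_of_deriv_pos
    intro s
    rw [(hode s).deriv]
    have hsc := Real.sin_sq_add_cos_sq (φ s)
    have hx1 := aux_tanh_sq (s / 9)
    generalize Real.tanh (s / 9) = x at *
    generalize Real.sin (φ s) = a at *
    generalize Real.cos (φ s) = b at *
    have e : b ^ 2 + 16 / 81 * a ^ 2 - 8 / 9 * -x * a * b
      = (b + 4 / 9 * x * a) ^ 2 + 16 / 81 * (1 - x ^ 2) * a ^ 2 := by ring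
    rw [e]
    have hx2 : 0 < 1 - x ^ 2 := by linarith
    rcases eq_or_ne a 0 with h | h
    · subst h
      have : b ^ 2 = 1 := by linarith
      nlinarith
    · positivity
  have hVc : Continuous auxV := continuous_iff_continuousAt.2 fun s => (auxV_deriv s).continuousAt
  have hsin : ∀ s ≤ 0, auxV s = 0 → Real.sin (φ s) = 0 := by
    intro s hs hv
    have h := hG s hs
    rw [hv] at h
    have hD := auxD_ne s hv
    have : auxD s * Real.sin (φ s) = 0 := by linarith
    exact (mul_eq_zero.1 this).resolve_left hD
  obtain ⟨z1, hz1, hv1⟩ : ∃ z ∈ Set.Icc (-9 : ℝ) 0, auxV z = 0 :=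
    intermediate_value_Icc (by norm_num) hVc.continuousOn ⟨auxV_neg.le, auxV_zero.le⟩
  obtain ⟨z2, hz2, hv2⟩ : ∃ z ∈ Set.Icc (-45 : ℝ) (-9), auxV z = 0 :=
    intermediate_value_Icc' (by norm_num) hVc.continuousOn
      ⟨auxV_neg.le, (auxV_pos (-45) le_rfl).le⟩
  have hz12 : z2 < z1 := by
    rcases lt_or_eq_of_le (hz2.2.trans hz1.1) with h | h
    · exact h
    · exfalso
      have : z1 = -9 := le_antisymm (h ▸ hz2.2) hz1.1
      rw [this] at hv1
      exact auxV_neg.ne hv1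
  have hz10 : z1 < 0 := by
    rcases lt_or_eq_of_le hz1.2 with h | h
    · exact h
    · rw [h] at hv1
      exact absurd hv1 auxV_zero.ne'
  obtain ⟨n1, hn1⟩ := Real.sin_eq_zero_iff.1 (hsin z1 hz10.le hv1)
  obtain ⟨n2, hn2⟩ := Real.sin_eq_zero_iff.1 (hsin z2 (hz12.trans hz10).le hv2)
  have hpi := Real.pi_pos
  have hlt1 := hmono hz10
  have hlt2 := hmono hz12
  rw [hinit, ← hn1] at hlt1
  rw [← hn1, ← hn2] at hlt2
  have hn1' : n1 < 2 := by
    have : (n1 : ℝ) < 2 := by nlinarith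
    exact_mod_cast this
  have hn2' : n2 < n1 := by
    have : (n2 : ℝ) < n1 := lt_of_mul_lt_mul_right hlt2 hpi.le
    exact_mod_cast this
  have hφ2 : φ z2 ≤ 0 := by
    have : (n2 : ℝ) ≤ 0 := by exact_mod_cast (by omega : n2 ≤ 0)
    rw [← hn2]
    exact mul_nonpos_of_nonpos_of_nonneg this hpi.le
  have hbdd : BddBelow (Set.range φ) := by
    obtain ⟨k, hk⟩ := exists_int_lt (φ (-45) / Real.pi)
    rw [lt_div_iff₀ hpi] at hk
    refine ⟨k * Real.pi, ?_⟩
    rintro _ ⟨s, rfl⟩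
    by_contra! hlt
    have hs : s ≤ -45 := by
      by_contra! hh
      have := hmono hh
      linarith
    obtain ⟨z, hz, hzv⟩ : ∃ z ∈ Set.Icc s (-45), φ z = k * Real.pi :=
      intermediate_value_Icc hs hcont.continuousOn ⟨hlt.le, hk.le⟩
    have hv := auxV_pos z hz.2
    have hsz : Real.sin (φ z) = 0 := by rw [hzv]; exact Real.sin_int_mul_pi k
    have h := hG z (by linarith [hz.2])
    rw [hsz] at h
    have hc : Real.cos (φ z) = 0 := by
      have : auxV z * Real.cos (φ z) = 0 := by linarith
      exact (mul_eq_zero.1 this).resolve_left hv.ne'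
    have := Real.sin_sq_add_cos_sq (φ z)
    rw [hsz, hc] at this
    norm_num at this
  refine ⟨⨅ s, φ s, tendsto_atBot_ciInf hmono.monotone hbdd, ?_⟩
  exact ((ciInf_le hbdd z2).trans hφ2).trans_lt (Real.arctan_pos.2 (by norm_num))
end
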